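/- (Brown–Zhang) Let k be a field and let H be a noetherian Hopf algebra over k which is a finitely generated module over its centre. Then some positive power of the antipode S of H is an inner automorphism of H. -/

import Mathlib

/-!
STATEMENT 17 (Brown–Zhang):
If a noetherian Hopf algebra over a field is a finitely generated module over its
centre, then some positive power of its antipode is an inner automorphism.
-/

universe u v

section ReesExt

open CategoryTheory CategoryTheory.Abelian CategoryTheory.Limits

variable {C : Type*} [Category* C] [Abelian C] [HasExt C]

/-- Natural endomorphisms of the identity functor act on `Ext` equally through both arguments. -/
lemma ext_comp_mk₀_natEndo [EnoughInjectives C] (τ : 𝟭 C ⟶ 𝟭 C) {K : C} (n : ℕ) {X : C}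
    (e : Ext K X n) :
    e.comp (Ext.mk₀ (τ.app X)) (add_zero n) = (Ext.mk₀ (τ.app K)).comp e (zero_add n) := by
  induction n generalizing X with
  | zero =>
    obtain ⟨f, rfl⟩ := (Ext.mk₀_bijective K X).2 e
    simpa using congrArg Ext.mk₀ (τ.naturality f)
  | succ n ih =>
    let I : InjectivePresentation X := Classical.arbitrary _
    let S := ShortComplex.mk _ _ (cokernel.condition I.f)
    have hS : S.ShortExact := { exact := ShortComplex.exact_cokernel I.f }
    have : Injective S.X₂ := I.injective
    obtain ⟨e', rfl⟩ := Ext.covariant_sequence_exact₁ K hS e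
      (@Subsingleton.elim _ (Ext.subsingleton_of_injective _ _ n) _ _) rfl
    let f : S ⟶ S := ShortComplex.homMk (τ.app _) (τ.app _) (τ.app _)
      (τ.naturality S.f).symm (τ.naturality S.g).symm
    have h1 := ShortComplex.ShortExact.extClass_naturality hS hS f
    have h2 := ih e'
    calc (e'.comp hS.extClass rfl).comp (Ext.mk₀ (τ.app X)) (add_zero (n + 1))
        = e'.comp (hS.extClass.comp (Ext.mk₀ f.τ₁) (add_zero 1)) rfl :=
          Ext.comp_assoc_of_third_deg_zero _ _ _ _
      _ = (e'.comp (Ext.mk₀ (τ.app S.X₃)) (add_zero n)).comp hS.extClass rfl := by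
          rw [h1, Ext.comp_assoc_of_second_deg_zero]; rfl
      _ = _ := by
          rw [h2, Ext.comp_assoc]
          omega

/-- `ReesClass τs π n c`: the natural endomorphisms `τs` form a regular sequence on `X`, the map
`π : X ⟶ Y` is the projection to the quotient, and `c` is the associated Koszul class. -/
inductive ReesClass : List (𝟭 C ⟶ 𝟭 C) → ∀ {X Y : C}, (X ⟶ Y) → ∀ n : ℕ, Ext Y X n → Prop
  | nil {X Y : C} (e : X ≅ Y) : ReesClass [] e.hom 0 (Ext.mk₀ e.inv)
  | cons (τ : 𝟭 C ⟶ 𝟭 C) {τs : List (𝟭 C ⟶ 𝟭 C)} {X Z Y : C} (p : X ⟶ Z)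
      (w : τ.app X ≫ p = 0) (hS : (ShortComplex.mk _ p w).ShortExact) {q : Z ⟶ Y} {n : ℕ}
      {c : Ext Y Z n} (h : ReesClass τs q n c) :
      ReesClass (τ :: τs) (p ≫ q) (n + 1) (c.comp hS.extClass rfl)

theorem ReesClass.of_iso {τs : List (𝟭 C ⟶ 𝟭 C)} {X Y X' : C} {π : X ⟶ Y} {n : ℕ}
    {c : Ext Y X n} (h : ReesClass τs π n c) (e : X' ≅ X) :
    ∃ c', ReesClass τs (e.hom ≫ π) n c' := by
  cases h with
  | nil e' => exact ⟨_, ReesClass.nil (e ≪≫ e')⟩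
  | cons τ p w hS h =>
    have w' : τ.app X' ≫ e.hom ≫ p = 0 := by
      rw [← Category.assoc, ← show e.hom ≫ τ.app X = τ.app X' ≫ e.hom from τ.naturality e.hom,
        Category.assoc, w, comp_zero]
    let i : ShortComplex.mk (τ.app X') (e.hom ≫ p) w' ≅ ShortComplex.mk (τ.app X) p w :=
      ShortComplex.isoMk e e (Iso.refl _) (τ.naturality e.hom) (Category.comp_id _).symm
    have hS' := (ShortComplex.shortExact_iff_of_iso i).2 hS
    rw [← Category.assoc]
    exact ⟨_, ReesClass.cons τ (e.hom ≫ p) w' hS' h⟩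

theorem ReesClass.naturality {τs : List (𝟭 C ⟶ 𝟭 C)} {X Y X' Y' : C} {π : X ⟶ Y} {π' : X' ⟶ Y'}
    {n n' : ℕ} {c : Ext Y X n} {c' : Ext Y' X' n'} (h : ReesClass τs π n c)
    (h' : ReesClass τs π' n' c') (hn : n = n') (f : X ⟶ X') (g : Y ⟶ Y') (hfg : f ≫ π' = π ≫ g) :
    c.comp (Ext.mk₀ f) (add_zero n) = (Ext.mk₀ g).comp c' (by omega) := by
  induction h generalizing X' Y' n' with
  | nil e =>
    cases h' with
    | nil e' =>
      simp only [Ext.mk₀_comp_mk₀]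
      congr 1
      rw [Iso.inv_comp_eq, ← Category.assoc, ← hfg]
      simp
  | @cons τ τs X Z Y p w hS q n c h ih =>
    cases h' with
    | @cons _ _ _ Z' _ p' w' hS' q' m c'' h'' =>
      have : Epi p := hS.epi_g
      obtain rfl : n = m := by omega
      let z : Z ⟶ Z' := hS.exact.desc (f ≫ p') (by
        change τ.app X ≫ f ≫ p' = 0
        rw [← Category.assoc, ← show f ≫ τ.app X' = τ.app X ≫ f from τ.naturality f,
          Category.assoc, w', comp_zero])
      have hz : p ≫ z = f ≫ p' := hS.exact.g_desc _ _
      have hzg : z ≫ q' = q ≫ g := by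
        rw [← cancel_epi p, ← Category.assoc, hz, Category.assoc, hfg, Category.assoc]
      let S : ShortComplex.mk _ p w ⟶ ShortComplex.mk _ p' w' :=
        ShortComplex.homMk f f z (τ.naturality f) hz.symm
      have h1 := ShortComplex.ShortExact.extClass_naturality hS hS' S
      have h2 := ih h'' rfl z g hzg
      calc (c.comp hS.extClass rfl).comp (Ext.mk₀ f) (add_zero (n + 1))
          = c.comp (hS.extClass.comp (Ext.mk₀ S.τ₁) (add_zero 1)) rfl :=
            Ext.comp_assoc_of_third_deg_zero _ _ _ _
        _ = (c.comp (Ext.mk₀ z) (add_zero n)).comp hS'.extClass rfl := by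
            rw [h1, Ext.comp_assoc_of_second_deg_zero]; rfl
        _ = _ := by
            rw [h2, Ext.comp_assoc]
            omega

theorem ReesClass.bijective [EnoughInjectives C] {τs : List (𝟭 C ⟶ 𝟭 C)} {X Y : C} {π : X ⟶ Y}
    {n : ℕ} {c : Ext Y X n} (h : ReesClass τs π n c) (K : C) (hK : ∀ τ ∈ τs, τ.app K = 0) :
    (∀ i < n, Subsingleton (Ext K X i)) ∧
      Function.Bijective fun f : K ⟶ Y ↦ (Ext.mk₀ f).comp c (zero_add n) := by
  induction h with
  | @nil X Y e =>
    refine ⟨fun i hi ↦ absurd hi (by omega), ?_⟩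
    have : (fun f : K ⟶ Y ↦ (Ext.mk₀ f).comp (Ext.mk₀ e.inv) (zero_add 0)) =
        fun f ↦ Ext.mk₀ (f ≫ e.inv) := by
      ext f; simp
    rw [this]
    exact (Ext.mk₀_bijective K X).comp ⟨fun f g h ↦ by simpa using h,
      fun g ↦ ⟨g ≫ e.hom, by simp⟩⟩
  | @cons τ τs X Z Y p w hS q n c h ih =>
    obtain ⟨ih1, ih2⟩ := ih fun τ' h' ↦ hK τ' (List.mem_cons_of_mem _ h')
    have hτ : ∀ (i : ℕ) (e : Ext K X i), e.comp (Ext.mk₀ (τ.app X)) (add_zero i) = 0 := by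
      intro i e
      rw [ext_comp_mk₀_natEndo, hK τ List.mem_cons_self, Ext.mk₀_zero, Ext.zero_comp]
    constructor
    · intro i hi
      refine ⟨fun a b ↦ ?_⟩
      suffices ∀ e : Ext K X i, e = 0 by rw [this a, this b]
      intro e
      match i, e, hi with
      | 0, e, _ =>
        obtain ⟨f, rfl⟩ := (Ext.mk₀_bijective K X).2 e
        have := hτ 0 (Ext.mk₀ f)
        rw [Ext.mk₀_comp_mk₀, Ext.mk₀_eq_zero_iff] at this
        have hm : Mono (τ.app X) := hS.mono_f
        have : f = 0 := by rwa [← cancel_mono (τ.app X), zero_comp]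
        rw [this, Ext.mk₀_zero]
      | i + 1, e, hi =>
        obtain ⟨e', rfl⟩ := Ext.covariant_sequence_exact₁ K hS e (hτ _ e) rfl
        rw [@Subsingleton.elim _ (ih1 i (by omega)) e' 0, Ext.zero_comp]
    · have key : Function.Bijective fun e : Ext K Z n ↦ e.comp hS.extClass rfl := by
        constructor
        · intro a b hab
          obtain ⟨e, he⟩ := Ext.covariant_sequence_exact₃ K hS (a - b) rfl (by
            have : a.comp hS.extClass rfl = b.comp hS.extClass rfl := hab
            simp [sub_eq_add_neg, Ext.add_comp, Ext.neg_comp, this])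
          rw [← sub_eq_zero, ← he]
          match n, e with
          | 0, e =>
            obtain ⟨f, rfl⟩ := (Ext.mk₀_bijective K X).2 e
            have := hτ 0 (Ext.mk₀ f)
            rw [Ext.mk₀_comp_mk₀, Ext.mk₀_eq_zero_iff] at this
            have hm : Mono (τ.app X) := hS.mono_f
            have : f = 0 := by rwa [← cancel_mono (τ.app X), zero_comp]
            rw [this, Ext.mk₀_zero, Ext.zero_comp]
          | n + 1, e =>
            obtain ⟨e', rfl⟩ := Ext.covariant_sequence_exact₁ K hS e (hτ _ e) rfl
            rw [@Subsingleton.elim _ (ih1 n (by omega)) e' 0, Ext.zero_comp, Ext.zero_comp]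
        · intro e
          exact Ext.covariant_sequence_exact₁ K hS e (hτ _ e) rfl
      have : (fun f : K ⟶ Y ↦ (Ext.mk₀ f).comp (c.comp hS.extClass rfl) (zero_add (n + 1))) =
          (fun e : Ext K Z n ↦ e.comp hS.extClass rfl) ∘
            fun f : K ⟶ Y ↦ (Ext.mk₀ f).comp c (zero_add n) :=
        funext fun f ↦ (Ext.comp_assoc _ _ _ _ _ (by omega)).symm
      exact this ▸ key.comp ih2

section Adjoint

variable {D : Type*} [Category* D] [Abelian D] [HasExt D]

/-- If `η : K ⟶ F.obj L` is universal for the exact functor `F` preserving injectives, then `η`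
identifies the `Ext` groups out of `L` with those out of `K`. -/
theorem bijective_mk₀_comp_mapExactFunctor [EnoughInjectives D] (F : D ⥤ C) [F.Additive]
    [PreservesFiniteLimits F] [PreservesFiniteColimits F] [F.PreservesInjectiveObjects]
    {L : D} {K : C} (η : K ⟶ F.obj L)
    (hη : ∀ X : D, Function.Bijective fun f : L ⟶ X ↦ η ≫ F.map f) (n : ℕ) (X : D) :
    Function.Bijective fun e : Ext L X n ↦
      (Ext.mk₀ η).comp (e.mapExactFunctor F) (zero_add n) := by
  let Φ (n : ℕ) (X : D) : Ext L X n →+ Ext K (F.obj X) n :=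
    ((Ext.mk₀ η).precomp (F.obj X) (zero_add n)).comp (F.mapExtAddHom L X n)
  have hΦ (n : ℕ) (X : D) (e : Ext L X n) :
    Φ n X e = (Ext.mk₀ η).comp (e.mapExactFunctor F) (zero_add n) := rfl
  suffices Function.Bijective (Φ n X) from this
  induction n generalizing X with
  | zero =>
    rw [← Function.Bijective.of_comp_iff (Φ 0 X) (Ext.mk₀_bijective L X)]
    convert (Ext.mk₀_bijective K (F.obj X)).comp (hη X) using 1
    ext f
    simp [hΦ, Ext.mapExactFunctor_mk₀]
  | succ n hn =>
    let I : InjectivePresentation X := Classical.arbitrary _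
    let S := ShortComplex.mk _ _ (cokernel.condition I.f)
    have : Injective S.X₂ := I.injective
    have : Injective (S.map F).X₂ := Functor.PreservesInjectiveObjects.injective_obj I.injective
    have hS : S.ShortExact := { exact := ShortComplex.exact_cokernel I.f }
    have := Ext.subsingleton_of_injective (n := n) L S.X₂
    have := Ext.subsingleton_of_injective (n := n) K (S.map F).X₂
    refine AddMonoidHom.bijective_of_surjective_of_bijective_of_right_exact _ _ _ _
      (Φ n S.X₂) (Φ n S.X₃) (Φ (n + 1) S.X₁) ?_ ?_
      ((ShortComplex.ab_exact_iff_function_exact _).mp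
        (Ext.covariant_sequence_exact₃' L hS n (n + 1) rfl))
      ((ShortComplex.ab_exact_iff_function_exact _).mp
        (Ext.covariant_sequence_exact₃' K (hS.map F) n (n + 1) rfl))
      (hn _).surjective (hn _)
      (fun x₁ ↦ Ext.covariant_sequence_exact₁ _ hS x₁ (Subsingleton.elim _ _) rfl)
      (fun y₁ ↦ Ext.covariant_sequence_exact₁ _ (hS.map F) y₁ (Subsingleton.elim _ _) rfl)
    · ext e
      change ((Ext.mk₀ η).comp (e.mapExactFunctor F) (zero_add n)).comp
        (Ext.mk₀ (F.map S.g)) (add_zero n) = (Ext.mk₀ η).comp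
          ((e.comp (Ext.mk₀ S.g) (add_zero n)).mapExactFunctor F) (zero_add n)
      rw [Ext.mapExactFunctor_comp, Ext.mapExactFunctor_mk₀, Ext.comp_assoc_of_third_deg_zero]
    · ext e
      have h := Ext.comp_assoc (Ext.mk₀ η) (e.mapExactFunctor F) (hS.extClass.mapExactFunctor F)
        (zero_add n) (rfl : n + 1 = n + 1) (show 0 + n + 1 = n + 1 by omega)
      rw [← Ext.mapExactFunctor_comp, Ext.mapExactFunctor_extClass] at h
      exact h

theorem ReesClass.exists_addEquiv [EnoughInjectives C] [EnoughInjectives D] (F : D ⥤ C)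
    [F.Additive] [PreservesFiniteLimits F] [PreservesFiniteColimits F]
    [F.PreservesInjectiveObjects] {L : D} {K : C} (η : K ⟶ F.obj L)
    (hη : ∀ X : D, Function.Bijective fun f : L ⟶ X ↦ η ≫ F.map f)
    {τs : List (𝟭 C ⟶ 𝟭 C)} (hK : ∀ τ ∈ τs, τ.app K = 0) {X : D} {Y : C} {π : F.obj X ⟶ Y} {n : ℕ}
    {c : Ext Y (F.obj X) n} (h : ReesClass τs π n c) :
    ∃ θ : Ext L X n ≃+ (K ⟶ Y), ∀ (f : X ⟶ X) (g : Y ⟶ Y), F.map f ≫ π = π ≫ g →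
      ∀ e, θ (e.comp (Ext.mk₀ f) (add_zero n)) = θ e ≫ g := by
  let Φ : Ext L X n →+ Ext K (F.obj X) n :=
    ((Ext.mk₀ η).precomp (F.obj X) (zero_add n)).comp (F.mapExtAddHom L X n)
  have hΦ (e) : Φ e = (Ext.mk₀ η).comp (e.mapExactFunctor F) (zero_add n) := rfl
  let Ω : (K ⟶ Y) →+ Ext K (F.obj X) n :=
    { toFun f := (Ext.mk₀ f).comp c (zero_add n)
      map_zero' := by simp
      map_add' f g := by rw [Ext.mk₀_add, Ext.add_comp] }
  have hΩ (f) : Ω f = (Ext.mk₀ f).comp c (zero_add n) := rfl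
  have hΦb : Function.Bijective Φ := bijective_mk₀_comp_mapExactFunctor F η hη n X
  have hΩb : Function.Bijective Ω := (h.bijective K hK).2
  let Ωe := AddEquiv.ofBijective Ω hΩb
  let θ := (AddEquiv.ofBijective Φ hΦb).trans Ωe.symm
  have hθ (e) : Ω (θ e) = Φ e := Ωe.apply_symm_apply _
  refine ⟨θ, fun f g hfg e ↦ hΩb.1 ?_⟩
  rw [hθ, hΦ, hΩ, Ext.mapExactFunctor_comp, Ext.mapExactFunctor_mk₀, ← Ext.mk₀_comp_mk₀,
    Ext.comp_assoc_of_second_deg_zero, ← h.naturality h rfl (F.map f) g hfg,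
    ← Ext.comp_assoc_of_third_deg_zero, ← hΦ, ← hθ, hΩ, Ext.comp_assoc_of_third_deg_zero]

end Adjoint

end ReesExt

section Baer

open TensorProduct

/-- If `B` is, as a right module along `φ : H → B`, an extended module `W ⊗ H`, then restriction
along `φ` preserves injectivity. -/
theorem baer_of_rightExtended {k H B I W : Type*} [Field k] [Ring H] [Ring B]
    [Algebra k H] [Algebra k B] (φ : H →ₐ[k] B)
    [AddCommGroup W] [Module k W] (Ψ : H ⊗[k] W ≃ₗ[k] B)
    (hΨ : ∀ h h' w, Ψ ((h * h') ⊗ₜ w) = Ψ (h ⊗ₜ w) * φ h')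
    [AddCommGroup I] [Module k I] [Module B I] [IsScalarTower k B I]
    [Module H I] [IsScalarTower k H I] (hφ : ∀ (h : H) (x : I), h • x = φ h • x)
    (hI : Module.Baer B I) : Module.Baer H I := by
  intro A g
  let j : A ⊗[k] W →ₗ[k] B := Ψ.toLinearMap ∘ₗ (A.subtype.restrictScalars k).rTensor W
  have hj : Function.Injective j := Ψ.injective.comp
    (Module.Flat.rTensor_preserves_injective_linearMap _ A.injective_subtype)
  have hj' (a : A) (w : W) : j (a ⊗ₜ w) = Ψ (1 ⊗ₜ w) * φ a := by
    rw [← hΨ, one_mul]; rfl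
  have : IsScalarTower k H A := inferInstance
  let gk : A →ₗ[k] I := g.restrictScalars k
  let actk : W →ₗ[k] I →ₗ[k] I :=
    (Algebra.lsmul k k I).toLinearMap ∘ₗ Ψ.toLinearMap ∘ₗ TensorProduct.mk k H W 1
  let G : A ⊗[k] W →ₗ[k] I := TensorProduct.lift ((actk.flip) ∘ₗ gk)
  have hG (a : A) (w : W) : G (a ⊗ₜ w) = Ψ (1 ⊗ₜ w) • g a := by
    simp [G, actk, gk]
  have key (t : H ⊗[k] W) (a : A) : ∃ t', j t' = Ψ t * φ a ∧ G t' = Ψ t • g a := by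
    induction t with
    | zero => exact ⟨0, by simp, by simp⟩
    | tmul h w =>
      refine ⟨(h • a) ⊗ₜ w, ?_, ?_⟩
      · rw [hj', ← hΨ, ← hΨ, one_mul]; rfl
      · rw [hG, map_smul, hφ, smul_smul, ← hΨ, one_mul]
    | add x y hx hy =>
      obtain ⟨tx, h1, h2⟩ := hx
      obtain ⟨ty, h3, h4⟩ := hy
      exact ⟨tx + ty, by rw [map_add, map_add, h1, h3, add_mul],
        by rw [map_add, map_add, h2, h4, add_smul]⟩
  have key' (b : B) (t : A ⊗[k] W) : ∃ t', j t' = b * j t ∧ G t' = b • G t := by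
    induction t with
    | zero => exact ⟨0, by simp, by simp⟩
    | tmul a w =>
      obtain ⟨t', h1, h2⟩ := key (Ψ.symm (b * Ψ (1 ⊗ₜ w))) a
      rw [LinearEquiv.apply_symm_apply] at h1 h2
      exact ⟨t', by rw [h1, hj', mul_assoc], by rw [h2, hG, mul_smul]⟩
    | add x y hx hy =>
      obtain ⟨tx, h1, h2⟩ := hx
      obtain ⟨ty, h3, h4⟩ := hy
      exact ⟨tx + ty, by rw [map_add, map_add, h1, h3, mul_add],
        by rw [map_add, map_add, h2, h4, smul_add]⟩
  let N : Submodule B B :=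
    { carrier := Set.range j
      add_mem' := by
        rintro _ _ ⟨x, rfl⟩ ⟨y, rfl⟩
        exact ⟨x + y, map_add _ _ _⟩
      zero_mem' := ⟨0, map_zero _⟩
      smul_mem' := by
        rintro b _ ⟨x, rfl⟩
        obtain ⟨t', h, -⟩ := key' b x
        exact ⟨t', h⟩ }
  choose s hs using fun n : N ↦ n.2
  have hGs (n : N) (t : A ⊗[k] W) (h : j t = n) : G (s n) = G t := by
    rw [hj ((hs n).trans h.symm)]
  let F : N →ₗ[B] I :=
    { toFun n := G (s n)
      map_add' x y := by
        rw [hGs (x + y) (s x + s y) (by rw [map_add, hs, hs]; rfl), map_add]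
      map_smul' b x := by
        obtain ⟨t', h, h'⟩ := key' b (s x)
        rw [hGs (b • x) t' (by rw [h, hs]; rfl), h']
        rfl }
  obtain ⟨F', hF'⟩ := hI N F
  refine ⟨{ toFun h := φ h • F' 1, map_add' := ?_, map_smul' := ?_ }, ?_⟩
  · intro x y; rw [map_add, add_smul]
  · intro x y; rw [smul_eq_mul, map_mul, mul_smul, hφ]; rfl
  · intro a ha
    obtain ⟨t', h, h'⟩ := key (Ψ.symm 1) ⟨a, ha⟩
    rw [LinearEquiv.apply_symm_apply, one_mul] at h
    rw [LinearEquiv.apply_symm_apply, one_smul] at h'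
    change φ a • F' 1 = _
    rw [← map_smul, smul_eq_mul, mul_one, hF' (φ a) ⟨t', h⟩, ← h']
    exact hGs _ _ h

end Baer

section CentralEnd

open CategoryTheory

universe w

/-- Multiplication by a central element, as a natural endomorphism of the identity functor. -/
def centralEnd {R : Type v} [Ring R] (x : Subring.center R) :
    𝟭 (ModuleCat.{w} R) ⟶ 𝟭 (ModuleCat.{w} R) where
  app X := ModuleCat.ofHom
    { toFun m := (x : R) • m
      map_add' := smul_add _
      map_smul' r m := by
        rw [smul_smul, RingHom.id_apply, smul_smul, Subring.mem_center_iff.1 x.2 r] }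
  naturality X Y f := by
    ext m
    exact (f.hom.map_smul (x : R) m).symm

lemma centralEnd_app_eq_zero {R : Type v} [Ring R] (x : Subring.center R) (K : ModuleCat.{w} R)
    (h : ∀ m : K, (x : R) • m = 0) : (centralEnd x).app K = 0 := by
  ext m
  exact h m

end CentralEnd

section OuterTensor

open TensorProduct

variable {k H A R : Type*} [Field k] [Ring H] [Ring A] [Ring R] [Algebra k H] [Algebra k A]
  [Algebra k R]

/-- The tensor product `M ⊗ W` of an `H`-module and an `A`-module, regarded as a module over `R`
via `ρ : R → H ⊗ A`. -/
def OuterTensor (_ρ : R →ₐ[k] H ⊗[k] A) (M W : Type*) [AddCommGroup M] [Module k M]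
    [AddCommGroup W] [Module k W] : Type _ := M ⊗[k] W

variable (M W : Type*) [AddCommGroup M] [Module k M] [AddCommGroup W] [Module k W]
  [Module H M] [IsScalarTower k H M] [Module A W] [IsScalarTower k A W]

/-- The action of `H ⊗ A` on `M ⊗ W`. -/
def outerAct : H ⊗[k] A →ₐ[k] Module.End k (M ⊗[k] W) :=
  (Module.endTensorEndAlgHom (R := k) (S := k) (A := k) (M := M) (N := W)).comp
    (Algebra.TensorProduct.map (Algebra.lsmul k k M) (Algebra.lsmul k k W))

@[simp]
lemma outerAct_tmul (h : H) (a : A) (m : M) (w : W) :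
    outerAct M W (h ⊗ₜ[k] a) (m ⊗ₜ w) = (h • m) ⊗ₜ (a • w) := rfl

variable (ρ : R →ₐ[k] H ⊗[k] A)

noncomputable instance : AddCommGroup (OuterTensor ρ M W) :=
  inferInstanceAs (AddCommGroup (M ⊗[k] W))

noncomputable instance : Module k (OuterTensor ρ M W) :=
  inferInstanceAs (Module k (M ⊗[k] W))

noncomputable instance : Module R (OuterTensor ρ M W) :=
  letI : Module (Module.End k (M ⊗[k] W)) (OuterTensor ρ M W) :=
    inferInstanceAs (Module (Module.End k (M ⊗[k] W)) (M ⊗[k] W))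
  Module.compHom _ ((outerAct M W).comp ρ).toRingHom

/-- The identity, from the tensor product to the outer tensor product. -/
def toOuter : M ⊗[k] W ≃ₗ[k] OuterTensor ρ M W := LinearEquiv.refl k _

lemma smul_toOuter (r : R) (t : M ⊗[k] W) :
    r • toOuter M W ρ t = toOuter M W ρ (outerAct M W (ρ r) t) := rfl

variable {M}

lemma rTensor_outerAct {M' : Type*} [AddCommGroup M'] [Module k M'] [Module H M']
    [IsScalarTower k H M'] (f : M →ₗ[H] M') (s : H ⊗[k] A) (t : M ⊗[k] W) :
    (f.restrictScalars k).rTensor W (outerAct M W s t) =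
      outerAct M' W s ((f.restrictScalars k).rTensor W t) := by
  induction s with
  | zero => simp
  | add x y hx hy => simp only [map_add, LinearMap.add_apply, hx, hy]
  | tmul h a =>
    induction t with
    | zero => simp
    | add x y hx hy => simp only [map_add, hx, hy]
    | tmul m w => simp

/-- Functoriality of the outer tensor product in the first variable. -/
def OuterTensor.map {M' : Type*} [AddCommGroup M'] [Module k M'] [Module H M']
    [IsScalarTower k H M'] (f : M →ₗ[H] M') : OuterTensor ρ M W →ₗ[R] OuterTensor ρ M' W where
  toFun := (f.restrictScalars k).rTensor W
  map_add' := map_add _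
  map_smul' r t := rTensor_outerAct W f (ρ r) t

lemma OuterTensor.map_toOuter {M' : Type*} [AddCommGroup M'] [Module k M'] [Module H M']
    [IsScalarTower k H M'] (f : M →ₗ[H] M') (t : M ⊗[k] W) :
    OuterTensor.map W ρ f (toOuter M W ρ t) =
      toOuter M' W ρ ((f.restrictScalars k).rTensor W t) := rfl

lemma OuterTensor.map_id : OuterTensor.map W ρ (LinearMap.id : M →ₗ[H] M) = LinearMap.id :=
  LinearMap.ext fun t ↦ LinearMap.rTensor_id_apply (R := k) W M t

lemma OuterTensor.map_comp {M' M'' : Type*} [AddCommGroup M'] [Module k M'] [Module H M']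
    [IsScalarTower k H M'] [AddCommGroup M''] [Module k M''] [Module H M'']
    [IsScalarTower k H M''] (f : M →ₗ[H] M') (g : M' →ₗ[H] M'') :
    OuterTensor.map W ρ (g ∘ₗ f) = OuterTensor.map W ρ g ∘ₗ OuterTensor.map W ρ f :=
  LinearMap.ext fun t ↦
    LinearMap.rTensor_comp_apply W (g.restrictScalars k) (f.restrictScalars k) t

end OuterTensor

section RegularChain

open TensorProduct CategoryTheory

/-- `RegularChain xs J J'`: the central elements `xs` form a regular sequence on `H ⧸ J`, with
quotient `H ⧸ J'`. -/
inductive RegularChain {H : Type*} [Ring H] :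
    List (Subring.center H) → Submodule H H → Submodule H H → Prop
  | nil (J : Submodule H H) : RegularChain [] J J
  | cons (x : Subring.center H) {xs : List (Subring.center H)} {J J' : Submodule H H}
      (hx : ∀ a, (x : H) * a ∈ J → a ∈ J)
      (h : RegularChain xs (J ⊔ Submodule.span H {(x : H)}) J') :
      RegularChain (x :: xs) J J'

lemma RegularChain.le {H : Type*} [Ring H] {xs : List (Subring.center H)} {J J' : Submodule H H}
    (h : RegularChain xs J J') : J ≤ J' := by
  induction h with
  | nil J => exact le_rfl
  | cons x hx h ih => exact le_sup_left.trans ih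

theorem RegularChain.exists_reesClass {k : Type u} {A : Type*} {H R W : Type v} [Field k] [Ring H]
    [Ring A] [Ring R] [Algebra k H] [Algebra k A] [Algebra k R] [AddCommGroup W] [Module k W]
    [Module A W] [IsScalarTower k A W] (ρ : R →ₐ[k] H ⊗[k] A)
    (ξ : Subring.center H → Subring.center R) (hξ : ∀ x, ρ (ξ x) = (x : H) ⊗ₜ 1)
    {xs : List (Subring.center H)} {J J' : Submodule H H} (h : RegularChain xs J J') :
    ∃ c, ReesClass (xs.map fun x ↦ centralEnd.{v, v} (ξ x))
      (ModuleCat.ofHom (OuterTensor.map W ρ (Submodule.factor h.le))) xs.length c := by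
  induction h with
  | nil J =>
    let e : ModuleCat.of R (OuterTensor ρ (H ⧸ J) W) ≅ ModuleCat.of R (OuterTensor ρ (H ⧸ J) W) :=
      Iso.refl _
    have hid : Submodule.factor (le_refl J) = LinearMap.id := by ext; rfl
    have : ModuleCat.ofHom (OuterTensor.map W ρ (Submodule.factor (le_refl J))) = e.hom := by
      rw [hid, OuterTensor.map_id]; rfl
    rw [this]
    exact ⟨_, ReesClass.nil e⟩
  | @cons x xs J J' hx h ih =>
    obtain ⟨c, hc⟩ := ih
    have hle : J ≤ J ⊔ Submodule.span H {(x : H)} := le_sup_left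
    let mulx : (H ⧸ J) →ₗ[H] (H ⧸ J) :=
      { toFun m := (x : H) • m
        map_add' := smul_add _
        map_smul' r m := by
          rw [smul_smul, RingHom.id_apply, smul_smul, Subring.mem_center_iff.1 x.2 r] }
    have hinj : Function.Injective (mulx.restrictScalars k) := by
      rw [injective_iff_map_eq_zero]
      intro m hm
      obtain ⟨a, rfl⟩ := Submodule.Quotient.mk_surjective _ m
      rw [Submodule.Quotient.mk_eq_zero]
      exact hx a ((Submodule.Quotient.mk_eq_zero _).1 hm)
    have hexact : Function.Exact (mulx.restrictScalars k)
        ((Submodule.factor hle).restrictScalars k) := by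
      intro m
      obtain ⟨a, rfl⟩ := Submodule.Quotient.mk_surjective _ m
      change (Submodule.Quotient.mk a : H ⧸ (J ⊔ Submodule.span H {(x : H)})) = 0 ↔ _
      rw [Submodule.Quotient.mk_eq_zero, Submodule.mem_sup]
      constructor
      · rintro ⟨j, hj, s, hs, rfl⟩
        obtain ⟨r, rfl⟩ := Submodule.mem_span_singleton.1 hs
        refine ⟨Submodule.Quotient.mk r, ?_⟩
        change (Submodule.Quotient.mk ((x : H) * r) : H ⧸ J) = _
        rw [Submodule.Quotient.eq, ← Subring.mem_center_iff.1 x.2 r, smul_eq_mul]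
        simpa using hj
      · rintro ⟨m, hm⟩
        obtain ⟨r, rfl⟩ := Submodule.Quotient.mk_surjective _ m
        change (Submodule.Quotient.mk ((x : H) * r) : H ⧸ J) = _ at hm
        rw [eq_comm, Submodule.Quotient.eq, ← Subring.mem_center_iff.1 x.2 r] at hm
        exact ⟨_, hm, r * x, Submodule.mem_span_singleton.2 ⟨r, rfl⟩, by simp⟩
    have hact (t : OuterTensor ρ (H ⧸ J) W) :
        (ξ x : R) • t = OuterTensor.map W ρ mulx t := by
      change (H ⧸ J) ⊗[k] W at t
      change (ξ x : R) • toOuter _ W ρ t = OuterTensor.map W ρ mulx (toOuter _ W ρ t)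
      rw [smul_toOuter, hξ, OuterTensor.map_toOuter]
      congr 1
      induction t with
      | zero => simp
      | add a b ha hb => rw [map_add, map_add, ha, hb]
      | tmul m w =>
        rw [outerAct_tmul, one_smul]; rfl
    have hex2 : Function.Exact ((mulx.restrictScalars k).rTensor W)
        (((Submodule.factor hle).restrictScalars k).rTensor W) :=
      rTensor_exact W hexact (Submodule.factor_surjective hle)
    let p := ModuleCat.ofHom (OuterTensor.map W ρ (Submodule.factor hle))
    have w : (centralEnd (ξ x)).app _ ≫ p = 0 := by
      ext t
      change OuterTensor.map W ρ _ ((ξ x : R) • t) = 0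
      rw [hact]
      exact hex2.apply_apply_eq_zero t
    have hS : (ShortComplex.mk _ p w).ShortExact := by
      apply ModuleCat.shortComplex_shortExact
      · intro t
        refine (hex2 t).trans ?_
        constructor
        · rintro ⟨s, hs⟩
          exact ⟨s, (hact s).trans hs⟩
        · rintro ⟨s, hs⟩
          exact ⟨s, (hact s).symm.trans hs⟩
      · intro s t hst
        have : OuterTensor.map W ρ mulx s = OuterTensor.map W ρ mulx t := by
          rw [← hact, ← hact]; exact hst
        exact Module.Flat.rTensor_preserves_injective_linearMap _ hinj this
      · exact LinearMap.rTensor_surjective W (Submodule.factor_surjective hle)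
    have hπ : ModuleCat.ofHom (OuterTensor.map W ρ (Submodule.factor (hle.trans h.le))) =
        p ≫ ModuleCat.ofHom (OuterTensor.map W ρ (Submodule.factor h.le)) := by
      rw [← Submodule.factor_comp hle h.le, OuterTensor.map_comp]
      rfl
    rw [hπ]
    exact ⟨_, ReesClass.cons (centralEnd (ξ x)) p w hS hc⟩

end RegularChain

section Comparison

open CategoryTheory CategoryTheory.Abelian TensorProduct

/-- `ℓ` is the universal element of a `B`-module on which `H` acts (via `φ`) through `ε`. -/
structure IsUniversalInvariant {k : Type u} {H B L : Type v} [Field k] [Ring H] [Ring B]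
    [Algebra k H] [Algebra k B] [AddCommGroup L] [Module B L]
    (φ : H →ₐ[k] B) (ε : H →ₐ[k] k) (ℓ : L) : Prop where
  smul_eq (h : H) : φ h • ℓ = algebraMap k B (ε h) • ℓ
  exists_hom (X : Type v) [AddCommGroup X] [Module B X] (ξ : X)
    (hξ : ∀ h, φ h • ξ = algebraMap k B (ε h) • ξ) : ∃ f : L →ₗ[B] X, f ℓ = ξ
  hom_ext (X : Type v) [AddCommGroup X] [Module B X] (f g : L →ₗ[B] X) (hfg : f ℓ = g ℓ) : f = g

variable {k : Type u} {H B : Type v} [Field k] [Ring H] [Ring B] [Algebra k H] [Algebra k B]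

lemma isUniversalInvariant_quotient_ker (ε : H →ₐ[k] k) :
    IsUniversalInvariant (AlgHom.id k H) ε
      (Submodule.Quotient.mk 1 : H ⧸ (RingHom.ker ε : Ideal H)) where
  smul_eq h := by
    rw [← Submodule.Quotient.mk_smul, ← Submodule.Quotient.mk_smul, Submodule.Quotient.eq,
      RingHom.mem_ker]
    simp
  exists_hom X _ _ ξ hξ := by
    refine ⟨Submodule.liftQ _ (LinearMap.toSpanSingleton H X ξ) ?_, ?_⟩
    · intro h hh
      rw [LinearMap.mem_ker, LinearMap.toSpanSingleton_apply]
      have := hξ h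
      rwa [(RingHom.mem_ker).1 hh, map_zero, zero_smul] at this
    · rw [Submodule.liftQ_apply, LinearMap.toSpanSingleton_apply, one_smul]
  hom_ext X _ _ f g hfg := by
    ext
    exact hfg

lemma preservesInjectiveObjects_restrictScalars (φ : H →ₐ[k] B) {W : Type v} [AddCommGroup W]
    [Module k W] (Ψ : H ⊗[k] W ≃ₗ[k] B)
    (hΨ : ∀ h h' w, Ψ ((h * h') ⊗ₜ w) = Ψ (h ⊗ₜ w) * φ h') :
    (ModuleCat.restrictScalars.{v} φ.toRingHom).PreservesInjectiveObjects where
  injective_obj {I} hI := by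
    let _ : Module k I := Module.compHom I (algebraMap k B)
    let _ : Module H I := Module.compHom I φ.toRingHom
    have : IsScalarTower k B I := ⟨fun c b m ↦ by
      rw [Algebra.smul_def, mul_smul]; rfl⟩
    have : IsScalarTower k H I := ⟨fun c b m ↦ by
      change φ (c • b) • m = algebraMap k B c • φ b • m
      rw [map_smul, Algebra.smul_def, mul_smul]⟩
    have h1 : CategoryTheory.Injective (ModuleCat.of B I) := hI
    have h2 : Module.Baer B I :=
      Module.Baer.iff_injective.2 (Module.injective_module_of_injective_object B I)
    have h3 := baer_of_rightExtended φ Ψ hΨ (I := I) (fun _ _ ↦ rfl) h2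
    have h4 : Module.Injective H I := h3.injective
    exact Module.injective_object_of_injective_module H I

lemma preservesFinite_restrictScalars {R S : Type*} [Ring R] [Ring S] (f : R →+* S) :
    Limits.PreservesFiniteLimits (ModuleCat.restrictScalars.{v} f) ∧
      Limits.PreservesFiniteColimits (ModuleCat.restrictScalars.{v} f) :=
  ((Functor.exact_tfae (ModuleCat.restrictScalars.{v} f)).out 1 3).mp fun S h ↦ by
    rw [ShortComplex.ShortExact.moduleCat_exact_iff_function_exact] at h ⊢
    exact h

theorem ReesClass.exists_extComparison (φ : H →ₐ[k] B) {W' : Type v} [AddCommGroup W']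
    [Module k W'] (Ψr : H ⊗[k] W' ≃ₗ[k] B)
    (hΨr : ∀ h h' w, Ψr ((h * h') ⊗ₜ w) = Ψr (h ⊗ₜ w) * φ h')
    (ε : H →ₐ[k] k) {L : Type v} [AddCommGroup L] [Module B L] {ℓ : L}
    (hℓ : IsUniversalInvariant φ ε ℓ) {xs : List (Subring.center H)}
    (hxs : ∀ x ∈ xs, ε (x : H) = 0) {X : ModuleCat.{v} B} {Y : ModuleCat.{v} H}
    {π : (ModuleCat.restrictScalars.{v} φ.toRingHom).obj X ⟶ Y} {n : ℕ} {c}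
    (h : ReesClass (xs.map centralEnd.{v, v}) π n c) :
    ∃ θ : Ext (ModuleCat.of B L) X n →+ Y, Function.Injective θ ∧
      (∀ y, y ∈ Set.range θ ↔ ∀ h : H, h • y = algebraMap k H (ε h) • y) ∧
      ∀ (f : X ⟶ X) (g : Y ⟶ Y),
        (ModuleCat.restrictScalars.{v} φ.toRingHom).map f ≫ π = π ≫ g →
        ∀ e : Ext (ModuleCat.of B L) X n,
          θ (e.comp (Ext.mk₀ f) (add_zero n)) = g (θ e) := by
  let F := ModuleCat.restrictScalars.{v} φ.toRingHom
  obtain ⟨_, _⟩ := preservesFinite_restrictScalars φ.toRingHom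
  have hF := preservesInjectiveObjects_restrictScalars φ Ψr hΨr
  have hκ := isUniversalInvariant_quotient_ker ε
  let K := ModuleCat.of H (H ⧸ (RingHom.ker ε : Ideal H))
  let κ : K := (Submodule.Quotient.mk 1 : H ⧸ (RingHom.ker ε : Ideal H))
  have hφk (c : k) : φ (algebraMap k H c) = algebraMap k B c := φ.commutes c
  have hinv (X : ModuleCat.{v} B) (ξ : F.obj X) (h : H) :
      h • ξ = algebraMap k H (ε h) • ξ ↔ φ h • (ξ : X) = algebraMap k B (ε h) • (ξ : X) := by
    rw [← hφk]; rfl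
  have hex (Y : ModuleCat.{v} H) (y : Y) (hy : ∀ h : H, h • y = algebraMap k H (ε h) • y) :
      ∃ η : K ⟶ Y, η.hom κ = y := by
    obtain ⟨η, hη⟩ := hκ.exists_hom Y y hy
    exact ⟨ModuleCat.ofHom η, hη⟩
  obtain ⟨η, hη⟩ := hex (F.obj (ModuleCat.of B L)) ℓ
    fun h ↦ (hinv (ModuleCat.of B L) ℓ h).2 (hℓ.smul_eq h)
  have hκinv {Y : ModuleCat.{v} H} (g : K ⟶ Y) (h : H) :
      h • g.hom κ = algebraMap k H (ε h) • g.hom κ := by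
    rw [← map_smul, ← map_smul]
    exact congrArg _ (hκ.smul_eq h)
  have hu (X : ModuleCat.{v} B) : Function.Bijective fun f : ModuleCat.of B L ⟶ X ↦
      η ≫ F.map f := by
    constructor
    · intro f f' hff
      apply ModuleCat.hom_ext
      apply hℓ.hom_ext
      have := congrArg (fun q : K ⟶ F.obj X ↦ q.hom κ) hff
      change f.hom (η.hom κ) = f'.hom (η.hom κ) at this
      rwa [hη] at this
    · intro g
      obtain ⟨f, hf⟩ := hℓ.exists_hom X (g.hom κ : F.obj X) fun h ↦
        (hinv X (g.hom κ) h).1 (hκinv g h)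
      refine ⟨ModuleCat.ofHom f, ?_⟩
      apply ModuleCat.hom_ext
      apply hκ.hom_ext
      change f (η.hom κ) = g.hom κ
      rw [hη, hf]
  have hK : ∀ τ ∈ xs.map centralEnd.{v, v}, τ.app K = 0 := by
    intro τ hτ
    obtain ⟨x, hx, rfl⟩ := List.mem_map.1 hτ
    apply centralEnd_app_eq_zero
    intro m
    obtain ⟨a, rfl⟩ := Submodule.Quotient.mk_surjective _ m
    rw [← Submodule.Quotient.mk_smul, Submodule.Quotient.mk_eq_zero, RingHom.mem_ker]
    simp [hxs x hx]
  obtain ⟨θ, hθ⟩ := h.exists_addEquiv (ModuleCat.restrictScalars.{v} φ.toRingHom) η hu hK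
  refine ⟨{ toFun e := (θ e).hom κ, map_zero' := ?_, map_add' := ?_ }, ?_, ?_, ?_⟩
  · rw [map_zero]; rfl
  · intro e e'
    rw [map_add]
    rfl
  · intro e e' hee
    exact θ.injective (ModuleCat.hom_ext (hκ.hom_ext _ _ _ hee))
  · intro y
    constructor
    · rintro ⟨e, rfl⟩ h
      exact hκinv (θ e) h
    · intro hy
      obtain ⟨f, hf⟩ := hex Y y hy
      refine ⟨θ.symm f, ?_⟩
      change (θ (θ.symm f)).hom κ = y
      rw [AddEquiv.apply_symm_apply, hf]
  · intro f g hfg e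
    change (θ _).hom κ = g.hom ((θ e).hom κ)
    rw [hθ f g hfg e]
    rfl

end Comparison

section ExtInvariants

open CategoryTheory CategoryTheory.Abelian TensorProduct

variable {k : Type u} {H B : Type v} [Field k] [Ring H] [Ring B] [Algebra k H] [Algebra k B]

/-- The projection from an `H`-module `X ≅ H ⊗ W` to `(H ⧸ J) ⊗ W`. -/
def chainProj {X W : Type*} [AddCommGroup X] [AddCommGroup W] [Module k W]
    (Ψ : H ⊗[k] W ≃+ X) (J : Submodule H H) : X →+ (H ⧸ J) ⊗[k] W :=
  (((J.mkQ).restrictScalars k).rTensor W).toAddMonoidHom.comp Ψ.symm.toAddMonoidHom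

lemma chainProj_apply {X W : Type*} [AddCommGroup X] [AddCommGroup W] [Module k W]
    (Ψ : H ⊗[k] W ≃+ X) (J : Submodule H H) (h : H) (w : W) :
    chainProj Ψ J (Ψ (h ⊗ₜ w)) = Submodule.Quotient.mk h ⊗ₜ w := by
  simp [chainProj]

lemma chainProj_surjective {X W : Type*} [AddCommGroup X] [AddCommGroup W] [Module k W]
    (Ψ : H ⊗[k] W ≃+ X) (J : Submodule H H) : Function.Surjective (chainProj Ψ J) :=
  (LinearMap.rTensor_surjective W (Submodule.mkQ_surjective J)).comp Ψ.symm.surjective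

/-- The `Ext` group of degree the length of a regular chain, out of a module with a universal
invariant, is the space of invariants of `(H ⧸ J) ⊗ W`. -/
theorem exists_ext_invariants (φ : H →ₐ[k] B) {W' : Type v} [AddCommGroup W']
    [Module k W'] (Ψr : H ⊗[k] W' ≃ₗ[k] B)
    (hΨr : ∀ h h' w, Ψr ((h * h') ⊗ₜ w) = Ψr (h ⊗ₜ w) * φ h')
    (ε : H →ₐ[k] k) {L : Type v} [AddCommGroup L] [Module B L] {ℓ : L}
    (hℓ : IsUniversalInvariant φ ε ℓ) {xs : List (Subring.center H)}
    (hxs : ∀ x ∈ xs, ε (x : H) = 0) {J : Submodule H H} (hJ : RegularChain xs ⊥ J)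
    {X W : Type v} [AddCommGroup X] [Module B X] [AddCommGroup W] [Module k W]
    (Ψ : H ⊗[k] W ≃+ X) (hΨ : ∀ h h' w, Ψ ((h * h') ⊗ₜ w) = φ h • Ψ (h' ⊗ₜ w)) :
    ∃ θ : Ext (ModuleCat.of B L) (ModuleCat.of B X) xs.length →+ (H ⧸ J) ⊗[k] W,
      Function.Injective θ ∧
      (∀ y, y ∈ Set.range θ ↔ ∀ h : H, h • y = ε h • y) ∧
      ∀ (f : X →ₗ[B] X) (g : (H ⧸ J) ⊗[k] W →+ (H ⧸ J) ⊗[k] W),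
        (∀ x, chainProj Ψ J (f x) = g (chainProj Ψ J x)) →
        ∀ e : Ext (ModuleCat.of B L) (ModuleCat.of B X) xs.length,
          θ (e.comp (Ext.mk₀ (ModuleCat.ofHom f)) (add_zero _)) = g (θ e) := by
  let ρ : H →ₐ[k] H ⊗[k] k := Algebra.TensorProduct.includeLeft
  obtain ⟨c, hc⟩ := hJ.exists_reesClass (W := W) ρ id (fun x ↦ rfl)
  have hout {M : Type v} [AddCommGroup M] [Module k M] [Module H M] [IsScalarTower k H M]
      (h : H) (t : M ⊗[k] W) : h • toOuter M W ρ t = toOuter M W ρ (h • t) := by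
    rw [smul_toOuter]
    congr 1
    induction t with
    | zero => simp
    | add a b ha hb => rw [map_add, smul_add, ha, hb]
    | tmul m w =>
      change outerAct M W (h ⊗ₜ 1) (m ⊗ₜ w) = _
      rw [outerAct_tmul, one_smul]; rfl
  let b : H ≃ₗ[k] (H ⧸ (⊥ : Submodule H H)) :=
    (Submodule.quotEquivOfEqBot ⊥ rfl).symm.restrictScalars k
  have hb (h : H) : b h = Submodule.Quotient.mk h := rfl
  let α : OuterTensor ρ (H ⧸ (⊥ : Submodule H H)) W ≃+ X :=
    ((TensorProduct.congr b (LinearEquiv.refl k W)).symm.toAddEquiv.trans Ψ)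
  have hα (h : H) (w : W) : α (toOuter _ W ρ (Submodule.Quotient.mk h ⊗ₜ w)) = Ψ (h ⊗ₜ w) := by
    change Ψ ((TensorProduct.congr b (LinearEquiv.refl k W)).symm (b h ⊗ₜ w)) = _
    rw [TensorProduct.congr_symm_tmul, LinearEquiv.symm_apply_apply]
    rfl
  have hαH (h : H) (t : OuterTensor ρ (H ⧸ (⊥ : Submodule H H)) W) :
      α (h • t) = φ h • α t := by
    obtain ⟨t, rfl⟩ := (toOuter _ W ρ).surjective t
    induction t with
    | zero => simp
    | add a b ha hb => rw [map_add, smul_add, map_add, ha, hb, map_add, smul_add]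
    | tmul m w =>
      obtain ⟨a, rfl⟩ := Submodule.Quotient.mk_surjective _ m
      rw [hout, hα, ← hΨ, ← hα]
      rfl
  let αH : OuterTensor ρ (H ⧸ (⊥ : Submodule H H)) W ≃ₗ[H]
      (ModuleCat.restrictScalars.{v} φ.toRingHom).obj (ModuleCat.of B X) :=
    { α with map_smul' := hαH }
  let i : (ModuleCat.restrictScalars.{v} φ.toRingHom).obj (ModuleCat.of B X) ≅
      ModuleCat.of H (OuterTensor ρ (H ⧸ (⊥ : Submodule H H)) W) := αH.symm.toModuleIso
  obtain ⟨c', hc'⟩ := hc.of_iso i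
  obtain ⟨θ, hθ1, hθ2, hθ3⟩ := ReesClass.exists_extComparison φ Ψr hΨr ε hℓ hxs hc'
  have hπ (x : X) : (i.hom ≫ ModuleCat.ofHom (OuterTensor.map W ρ (Submodule.factor hJ.le))).hom x =
      toOuter _ W ρ (chainProj Ψ J x) := by
    change OuterTensor.map W ρ (Submodule.factor hJ.le) (α.symm x) = _
    obtain ⟨t, rfl⟩ := Ψ.surjective x
    induction t with
    | zero => simp
    | add a b ha hb => simp only [map_add, ha, hb]
    | tmul a w =>
      rw [chainProj_apply, ← hα, AddEquiv.symm_apply_apply]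
      rfl
  have hs (h : H) (x : X) : chainProj Ψ J (φ h • x) = h • chainProj Ψ J x := by
    apply (toOuter (H ⧸ J) W ρ).injective
    rw [← hout, ← hπ, ← hπ]
    exact LinearMap.map_smul
      (i.hom ≫ ModuleCat.ofHom (OuterTensor.map W ρ (Submodule.factor hJ.le))).hom h x
  refine ⟨(toOuter _ W ρ).symm.toAddEquiv.toAddMonoidHom.comp θ,
    (toOuter _ W ρ).symm.injective.comp hθ1, fun y ↦ ?_, fun f g hfg e ↦ ?_⟩
  · have h1 : (y ∈ Set.range ((toOuter _ W ρ).symm.toAddEquiv.toAddMonoidHom.comp θ)) ↔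
        toOuter _ W ρ y ∈ Set.range θ :=
      exists_congr fun e ↦ (toOuter _ W ρ).symm_apply_eq
    rw [h1, hθ2]
    refine forall_congr' fun h ↦ ?_
    rw [hout]
    have : algebraMap k H (ε h) • toOuter _ W ρ y = toOuter _ W ρ (ε h • y) := by
      rw [hout]
      congr 1
      clear h1
      induction y with
      | zero => simp
      | add a b ha hb => rw [smul_add, smul_add, ha, hb]
      | tmul m w => rw [smul_tmul', smul_tmul', algebraMap_smul]
    rw [this]
    exact (toOuter _ W ρ).injective.eq_iff
  · let g' : OuterTensor ρ (H ⧸ J) W →ₗ[H] OuterTensor ρ (H ⧸ J) W :=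
      { toFun t := toOuter _ W ρ (g ((toOuter _ W ρ).symm t))
        map_add' a b := by simp only [map_add]
        map_smul' h t := by
          obtain ⟨t, rfl⟩ := (toOuter _ W ρ).surjective t
          obtain ⟨x, rfl⟩ := chainProj_surjective Ψ J t
          rw [hout, LinearEquiv.symm_apply_apply, LinearEquiv.symm_apply_apply, ← hs, ← hfg,
            map_smul, hs, ← hout, hfg]
          rfl }
    have := hθ3 (ModuleCat.ofHom f) (ModuleCat.ofHom g') (by
      ext x
      change (i.hom ≫ ModuleCat.ofHom (OuterTensor.map W ρ (Submodule.factor hJ.le))).hom (f x) =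
        g' ((i.hom ≫ ModuleCat.ofHom (OuterTensor.map W ρ (Submodule.factor hJ.le))).hom x)
      refine (hπ (f x)).trans (Eq.trans ?_ (congrArg g' (hπ x)).symm)
      exact congrArg (toOuter _ W ρ) (hfg x)) e
    exact congrArg (toOuter _ W ρ).symm this

end ExtInvariants

section Twist

open TensorProduct

variable {k H W : Type*} [Field k] [Ring H] [AddCommGroup W] [Module k W]

/-- The map `a ⊗ w ↦ a₁ ⊗ σ(a₂) w`. -/
noncomputable def hopfTwist [Algebra k H] [Coalgebra k H] (σ : H →ₗ[k] Module.End k W) :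
    H ⊗[k] W →ₗ[k] H ⊗[k] W :=
  (TensorProduct.lift σ).lTensor H ∘ₗ (TensorProduct.assoc k H H W).toLinearMap ∘ₗ
    (Coalgebra.comul (R := k) (A := H)).rTensor W

section Coalgebra

variable [Algebra k H] [Coalgebra k H]

lemma hopfTwist_tmul (σ : H →ₗ[k] Module.End k W) (a : H) (w : W) :
    hopfTwist σ (a ⊗ₜ w) = (σ.flip w).lTensor H (Coalgebra.comul (R := k) a) := by
  change (TensorProduct.lift σ).lTensor H (TensorProduct.assoc k H H W
    (Coalgebra.comul (R := k) a ⊗ₜ w)) = _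
  generalize Coalgebra.comul (R := k) a = s
  induction s with
  | zero => simp
  | add x y hx hy => simp only [map_add, add_tmul, hx, hy]
  | tmul b c => simp

lemma hopfTwist_hopfTwist (σ τ : H →ₗ[k] Module.End k W)
    (h : ∀ a, LinearMap.mul' k (Module.End k W) (TensorProduct.map σ τ (Coalgebra.comul (R := k) a))
      = algebraMap k _ (Coalgebra.counit (R := k) a)) (t : H ⊗[k] W) :
    hopfTwist σ (hopfTwist τ t) = t := by
  induction t with
  | zero => simp
  | add x y hx hy => simp only [map_add, hx, hy]
  | tmul a w =>
    let g : H ⊗[k] H →ₗ[k] W :=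
      (LinearMap.applyₗ w) ∘ₗ LinearMap.mul' k (Module.End k W) ∘ₗ TensorProduct.map σ τ
    have h1 (s : H ⊗[k] H) : hopfTwist σ ((τ.flip w).lTensor H s) =
        g.lTensor H (TensorProduct.assoc k H H H
          ((Coalgebra.comul (R := k) (A := H)).rTensor H s)) := by
      induction s with
      | zero => simp
      | add x y hx hy => simp only [map_add, hx, hy]
      | tmul b c =>
        rw [LinearMap.lTensor_tmul, hopfTwist_tmul, LinearMap.rTensor_tmul]
        generalize Coalgebra.comul (R := k) b = s
        induction s with
        | zero => simp
        | add x y hx hy => simp only [map_add, add_tmul, hx, hy]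
        | tmul b c => simp [g]
    rw [hopfTwist_tmul, h1, Coalgebra.coassoc_apply, ← LinearMap.lTensor_comp_apply]
    have h2 : g ∘ₗ Coalgebra.comul (R := k) (A := H) =
        (LinearMap.toSpanSingleton k W w) ∘ₗ Coalgebra.counit (R := k) (A := H) := by
      ext b
      change LinearMap.mul' k (Module.End k W) _ w = _
      rw [h]
      rfl
    rw [h2, LinearMap.lTensor_comp_apply, Coalgebra.lTensor_counit_comul]
    simp

/-- The bijection `a ⊗ w ↦ a₁ ⊗ σ(a₂) w`, for `σ` convolution invertible. -/
noncomputable def hopfTwistEquiv (σ τ : H →ₗ[k] Module.End k W)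
    (h : ∀ a, LinearMap.mul' k (Module.End k W) (TensorProduct.map σ τ (Coalgebra.comul (R := k) a))
      = algebraMap k _ (Coalgebra.counit (R := k) a))
    (h' : ∀ a, LinearMap.mul' k (Module.End k W)
      (TensorProduct.map τ σ (Coalgebra.comul (R := k) a)) =
        algebraMap k _ (Coalgebra.counit (R := k) a)) : H ⊗[k] W ≃ₗ[k] H ⊗[k] W :=
  LinearEquiv.ofLinearMap (hopfTwist σ) (hopfTwist τ) (LinearMap.ext (hopfTwist_hopfTwist σ τ h))
    (LinearMap.ext (hopfTwist_hopfTwist τ σ h'))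

end Coalgebra

variable [HopfAlgebra k H] {A : Type*} [Ring A] [Algebra k A]

/-- The algebra map `h ↦ h₁ ⊗ ψ(h₂)`. -/
noncomputable def comulTwist (ψ : H →ₐ[k] A) : H →ₐ[k] H ⊗[k] A :=
  (Algebra.TensorProduct.map (AlgHom.id k H) ψ).comp (Bialgebra.comulAlgHom k H)

/-- `a ⊗ w ↦ a₁ ⊗ ψ(a₂) w`. -/
noncomputable def leftTwist (ψ : H →ₐ[k] A) (W : Type*) [AddCommGroup W] [Module k W] [Module A W]
    [IsScalarTower k A W] : H ⊗[k] W ≃ₗ[k] H ⊗[k] W :=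
  hopfTwistEquiv ((Algebra.lsmul k k W).comp ψ).toLinearMap
    (((Algebra.lsmul k k W).comp ψ).toLinearMap ∘ₗ HopfAlgebra.antipode k)
    (fun a ↦ by
      have := congrArg ((Algebra.lsmul k k W).comp ψ)
        (HopfAlgebra.mul_antipode_lTensor_comul_apply (R := k) a)
      rw [AlgHom.commutes] at this
      rw [← this]
      generalize Coalgebra.comul (R := k) a = s
      induction s with
      | zero => simp
      | add x y hx hy => simp only [map_add, hx, hy]
      | tmul b c =>
        rw [LinearMap.lTensor_tmul, LinearMap.mul'_apply, map_mul, TensorProduct.map_tmul,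
          LinearMap.mul'_apply]
        rfl)
    (fun a ↦ by
      have := congrArg ((Algebra.lsmul k k W).comp ψ)
        (HopfAlgebra.mul_antipode_rTensor_comul_apply (R := k) a)
      rw [AlgHom.commutes] at this
      rw [← this]
      generalize Coalgebra.comul (R := k) a = s
      induction s with
      | zero => simp
      | add x y hx hy => simp only [map_add, hx, hy]
      | tmul b c =>
        rw [LinearMap.rTensor_tmul, LinearMap.mul'_apply, map_mul, TensorProduct.map_tmul,
          LinearMap.mul'_apply]
        rfl)

lemma leftTwist_tmul (ψ : H →ₐ[k] A) [Module A W] [IsScalarTower k A W] (a : H) (w : W) :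
    leftTwist ψ W (a ⊗ₜ w) = (((Algebra.lsmul k k W).comp ψ).toLinearMap.flip w).lTensor H
      (Coalgebra.comul (R := k) a) := hopfTwist_tmul _ a w

lemma leftTwist_mul_tmul (ψ : H →ₐ[k] A) [Module A W] [IsScalarTower k A W] (a b : H) (w : W) :
    leftTwist ψ W ((a * b) ⊗ₜ w) = outerAct H W (comulTwist ψ a) (leftTwist ψ W (b ⊗ₜ w)) := by
  rw [leftTwist_tmul, leftTwist_tmul, Bialgebra.comul_mul, comulTwist, AlgHom.comp_apply]
  change _ = outerAct H W (Algebra.TensorProduct.map (AlgHom.id k H) ψ (Coalgebra.comul a)) _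
  generalize Coalgebra.comul (R := k) a = s
  generalize Coalgebra.comul (R := k) b = t
  induction s with
  | zero => simp
  | add x y hx hy => simp only [map_add, add_mul, hx, hy, LinearMap.add_apply]
  | tmul a a' =>
    induction t with
    | zero => simp
    | add x y hx hy => simp only [map_add, mul_add, hx, hy]
    | tmul b b' => simp

/-- The inverse of the antipode. -/
noncomputable def antipodeEquiv (hS : Function.Bijective (HopfAlgebra.antipode k : H →ₗ[k] H)) :
    H ≃ₗ[k] H := LinearEquiv.ofBijective (HopfAlgebra.antipode k) hS

lemma sum_antipodeEquiv_symm_mul (hS : Function.Bijective (HopfAlgebra.antipode k : H →ₗ[k] H))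
    (a : H) : LinearMap.mul' k H (TensorProduct.comm k H H
      ((antipodeEquiv hS).symm.toLinearMap.lTensor H (Coalgebra.comul (R := k) a))) =
        algebraMap k H (Coalgebra.counit (R := k) a) := by
  apply hS.1
  have h1 : HopfAlgebra.antipode k (algebraMap k H (Coalgebra.counit (R := k) a)) =
      algebraMap k H (Coalgebra.counit (R := k) a) := by
    rw [Algebra.algebraMap_eq_smul_one, map_smul, HopfAlgebra.antipode_one]
  rw [h1, ← HopfAlgebra.mul_antipode_rTensor_comul_apply]
  generalize Coalgebra.comul (R := k) a = s
  induction s with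
  | zero => simp
  | add x y hx hy => simp only [map_add, hx, hy]
  | tmul b c =>
    simp only [LinearMap.lTensor_tmul, comm_tmul, LinearMap.mul'_apply,
      HopfAlgebra.antipode_mul_antidistrib, LinearMap.rTensor_tmul]
    congr 1
    exact (antipodeEquiv hS).apply_symm_apply c

lemma sum_mul_antipodeEquiv_symm (hS : Function.Bijective (HopfAlgebra.antipode k : H →ₗ[k] H))
    (a : H) : LinearMap.mul' k H (TensorProduct.comm k H H
      ((antipodeEquiv hS).symm.toLinearMap.rTensor H (Coalgebra.comul (R := k) a))) =
        algebraMap k H (Coalgebra.counit (R := k) a) := by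
  apply hS.1
  have h1 : HopfAlgebra.antipode k (algebraMap k H (Coalgebra.counit (R := k) a)) =
      algebraMap k H (Coalgebra.counit (R := k) a) := by
    rw [Algebra.algebraMap_eq_smul_one, map_smul, HopfAlgebra.antipode_one]
  rw [h1, ← HopfAlgebra.mul_antipode_lTensor_comul_apply]
  generalize Coalgebra.comul (R := k) a = s
  induction s with
  | zero => simp
  | add x y hx hy => simp only [map_add, hx, hy]
  | tmul b c =>
    simp only [LinearMap.rTensor_tmul, comm_tmul, LinearMap.mul'_apply,
      HopfAlgebra.antipode_mul_antidistrib, LinearMap.lTensor_tmul]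
    congr 1
    exact (antipodeEquiv hS).apply_symm_apply b

/-- `a ⊗ y ↦ a₁ ⊗ y ψ(a₂)`. -/
noncomputable def rightTwist (hS : Function.Bijective (HopfAlgebra.antipode k : H →ₗ[k] H))
    (ψ : H →ₐ[k] A) : H ⊗[k] A ≃ₗ[k] H ⊗[k] A :=
  hopfTwistEquiv ((LinearMap.mul k A).flip ∘ₗ ψ.toLinearMap)
    ((LinearMap.mul k A).flip ∘ₗ ψ.toLinearMap ∘ₗ (antipodeEquiv hS).symm.toLinearMap)
    (fun a ↦ by
      ext y
      rw [Module.algebraMap_end_apply, Algebra.smul_def, Algebra.commutes, ← ψ.commutes,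
        ← sum_antipodeEquiv_symm_mul hS]
      generalize Coalgebra.comul (R := k) a = s
      induction s with
      | zero => simp
      | add x y hx hy => simp only [map_add, mul_add, LinearMap.add_apply, hx, hy]
      | tmul b c => simp [mul_assoc])
    (fun a ↦ by
      ext y
      rw [Module.algebraMap_end_apply, Algebra.smul_def, Algebra.commutes, ← ψ.commutes,
        ← sum_mul_antipodeEquiv_symm hS]
      generalize Coalgebra.comul (R := k) a = s
      induction s with
      | zero => simp
      | add x y hx hy => simp only [map_add, mul_add, LinearMap.add_apply, hx, hy]
      | tmul b c => simp [mul_assoc])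

lemma rightTwist_tmul (hS : Function.Bijective (HopfAlgebra.antipode k : H →ₗ[k] H))
    (ψ : H →ₐ[k] A) (a : H) (y : A) :
    rightTwist hS ψ (a ⊗ₜ y) = 1 ⊗ₜ y * comulTwist ψ a := by
  refine (hopfTwist_tmul _ a y).trans ?_
  change _ = 1 ⊗ₜ y * Algebra.TensorProduct.map (AlgHom.id k H) ψ (Coalgebra.comul a)
  generalize Coalgebra.comul (R := k) a = s
  induction s with
  | zero => simp
  | add x y hx hy => simp only [map_add, mul_add, hx, hy]
  | tmul b c => simp

lemma rightTwist_mul_tmul (hS : Function.Bijective (HopfAlgebra.antipode k : H →ₗ[k] H))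
    (ψ : H →ₐ[k] A) (a b : H) (y : A) :
    rightTwist hS ψ ((a * b) ⊗ₜ y) = rightTwist hS ψ (a ⊗ₜ y) * comulTwist ψ b := by
  rw [rightTwist_tmul, rightTwist_tmul, map_mul, mul_assoc]

end Twist

section Formanek

variable {R M : Type*} [CommRing R] [AddCommGroup M] [Module R M]

lemma isNoetherian_of_annihilator_quotient [Module.Finite R M]
    {N : Type*} [AddCommGroup N] [Module R N] [IsNoetherian R N]
    (h : ∀ z : R, (∀ n : N, z • n = 0) → ∀ m : M, z • m = 0) : IsNoetherian R M := by
  obtain ⟨s, hs⟩ := (Module.Finite.fg_top : (⊤ : Submodule R N).FG)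
  let f : R →ₗ[R] (s → N) := LinearMap.pi fun i ↦ LinearMap.toSpanSingleton R N i
  have hf : ∀ z, f z = 0 → ∀ m : M, z • m = 0 := by
    intro z hz
    apply h
    intro n
    have hn : n ∈ Submodule.span R (s : Set N) := hs ▸ Submodule.mem_top
    induction hn using Submodule.span_induction with
    | mem x hx => exact congrFun hz ⟨x, hx⟩
    | zero => simp
    | add x y _ _ hx hy => rw [smul_add, hx, hy, add_zero]
    | smul a x _ hx => rw [smul_comm, hx, smul_zero]
  have : IsNoetherian R (R ⧸ LinearMap.ker f) :=
    isNoetherian_of_linearEquiv f.quotKerEquivRange.symm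
  obtain ⟨t, ht⟩ := (Module.Finite.fg_top : (⊤ : Submodule R M).FG)
  have h1 (m : M) : IsNoetherian R (Submodule.span R {m}) := by
    let g : (R ⧸ LinearMap.ker f) →ₗ[R] M :=
      (LinearMap.ker f).liftQ (LinearMap.toSpanSingleton R M m) fun z hz ↦ hf z hz m
    have hg : Submodule.span R {m} ≤ LinearMap.range g := by
      rw [Submodule.span_singleton_le_iff_mem]
      exact ⟨Submodule.Quotient.mk 1, one_smul R m⟩
    exact isNoetherian_of_le hg
  have h2 : IsNoetherian R (⨆ m : t, Submodule.span R {(m : M)} : Submodule R M) :=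
    isNoetherian_iSup
  rw [← isNoetherian_top_iff, ← ht]
  have h3 : (⨆ m : t, Submodule.span R {(m : M)} : Submodule R M) = Submodule.span R t := by
    rw [← Submodule.span_iUnion]
    congr 1
    ext; simp
  rwa [← h3]

lemma isNoetherian_of_quotient_smul_top [Module.Finite R M]
    (h : ∀ z : R, (∃ m : M, z • m ≠ 0) →
      IsNoetherian R (M ⧸ LinearMap.range (LinearMap.lsmul R M z))) : IsNoetherian R M := by
  obtain ⟨s, hs⟩ := (Module.Finite.fg_top : (⊤ : Submodule R M).FG)
  let S : Set (Submodule R M) := {N | ∀ z : R, (∀ m : M, z • m ∈ N) → ∀ m : M, z • m = 0}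
  obtain ⟨N, -, hN⟩ := zorn_le_nonempty₀ S (fun c hcS hc y hy ↦ by
    refine ⟨sSup c, fun z hz ↦ ?_, fun N hN ↦ le_sSup hN⟩
    have hne : c.Nonempty := ⟨y, hy⟩
    have hmem (m : M) : ∃ N ∈ c, z • m ∈ N :=
      (Submodule.mem_sSup_of_directed hne hc.directedOn).1 (hz m)
    choose F hFc hF using hmem
    obtain ⟨N, hNc, hN⟩ : ∃ N ∈ c, ∀ m ∈ s, F m ≤ N := by
      clear hs hz
      classical
      induction s using Finset.induction_on with
      | empty => exact ⟨y, hy, by simp⟩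
      | insert a t _ ih =>
        obtain ⟨N, hNc, hN⟩ := ih
        rcases hc.total hNc (hFc a) with h1 | h1
        · refine ⟨F a, hFc a, fun m hm ↦ ?_⟩
          rcases Finset.mem_insert.1 hm with rfl | hm
          · exact le_rfl
          · exact (hN m hm).trans h1
        · refine ⟨N, hNc, fun m hm ↦ ?_⟩
          rcases Finset.mem_insert.1 hm with rfl | hm
          · exact h1
          · exact hN m hm
    refine hcS hNc z fun m ↦ ?_
    have hm : m ∈ Submodule.span R (s : Set M) := hs ▸ Submodule.mem_top
    induction hm using Submodule.span_induction with
    | mem x hx => exact hN x hx (hF x)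
    | zero => simp
    | add x y _ _ hx hy => rw [smul_add]; exact N.add_mem hx hy
    | smul a x _ hx => rw [smul_comm]; exact N.smul_mem a hx) ⊥ (fun z hz m ↦ by simpa using hz m)
  have key (N' : Submodule R M) (hN' : N < N') : N'.FG := by
    have : N' ∉ S := fun h' ↦ hN'.not_ge (hN.2 h' hN'.le)
    simp only [S, Set.mem_ofPred_eq, not_forall] at this
    obtain ⟨z, hz, m, hm⟩ := this
    have := h z ⟨m, hm⟩
    apply Submodule.fg_of_fg_map_of_fg_inf_ker (LinearMap.range (LinearMap.lsmul R M z)).mkQ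
    · exact IsNoetherian.noetherian _
    · rw [Submodule.ker_mkQ, inf_of_le_right]
      · exact LinearMap.range_eq_map (LinearMap.lsmul R M z) ▸ Module.Finite.fg_top.map _
      · rintro _ ⟨m, rfl⟩
        exact hz m
  have : IsNoetherian R (M ⧸ N) := by
    refine ⟨fun Q ↦ ?_⟩
    have hQ : Q = (Q.comap N.mkQ).map N.mkQ :=
      (Submodule.map_comap_eq_of_surjective N.mkQ_surjective Q).symm
    have hle : N ≤ Q.comap N.mkQ := Submodule.le_comap_mkQ N Q
    rcases hle.eq_or_lt with h1 | h1
    · rw [hQ, ← h1, Submodule.mkQ_map_self]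
      exact Submodule.fg_bot
    · rw [hQ]
      exact (key _ h1).map _
  refine isNoetherian_of_annihilator_quotient (N := M ⧸ N) fun z hz ↦ hN.1 z fun m ↦ ?_
  rw [← Submodule.Quotient.mk_eq_zero, Submodule.Quotient.mk_smul]
  exact hz _

/-- Formanek: a finite module with the ascending chain condition on the submodules `I • M` is
noetherian. -/
theorem isNoetherian_of_wellFounded_smul_top [Module.Finite R M]
    (hwf : WellFounded fun I J : Ideal R ↦ J • (⊤ : Submodule R M) < I • ⊤) : IsNoetherian R M := by
  have key (I : Ideal R) : IsNoetherian R (M ⧸ I • (⊤ : Submodule R M)) := by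
    induction I using hwf.induction with
    | _ I ih =>
      apply isNoetherian_of_quotient_smul_top
      rintro z ⟨m, hm⟩
      obtain ⟨m, rfl⟩ := Submodule.Quotient.mk_surjective _ m
      rw [← Submodule.Quotient.mk_smul, ne_eq, Submodule.Quotient.mk_eq_zero] at hm
      have hz (m : M) : z • m ∈ (I ⊔ Ideal.span {z}) • (⊤ : Submodule R M) :=
        Submodule.smul_mem_smul (Ideal.mem_sup_right (Ideal.mem_span_singleton_self z))
          Submodule.mem_top
      have hle : I • (⊤ : Submodule R M) ≤ (I ⊔ Ideal.span {z}) • ⊤ :=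
        Submodule.smul_mono_left le_sup_left
      have := ih (I ⊔ Ideal.span {z}) (lt_of_le_of_ne hle fun h ↦ hm (h ▸ hz m))
      let p := (LinearMap.range (LinearMap.lsmul R (M ⧸ I • (⊤ : Submodule R M)) z)).mkQ ∘ₗ
        (I • (⊤ : Submodule R M)).mkQ
      have hp : (I ⊔ Ideal.span {z}) • ⊤ ≤ LinearMap.ker p := by
        rw [Submodule.smul_le]
        intro r hr m _
        obtain ⟨a, ha, b, hb, rfl⟩ := Submodule.mem_sup.1 hr
        obtain ⟨c, rfl⟩ := Ideal.mem_span_singleton'.1 hb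
        rw [add_smul]
        refine Submodule.add_mem _ ?_ ?_
        · rw [LinearMap.mem_ker, LinearMap.comp_apply, Submodule.mkQ_apply _ (a • m),
            (Submodule.Quotient.mk_eq_zero _).2 (Submodule.smul_mem_smul ha Submodule.mem_top),
            map_zero]
        · rw [LinearMap.mem_ker, LinearMap.comp_apply, Submodule.mkQ_apply _ _,
            Submodule.mkQ_apply, Submodule.Quotient.mk_eq_zero]
          exact ⟨Submodule.Quotient.mk (c • m), by simp [mul_smul]⟩
      refine isNoetherian_of_surjective (Submodule.liftQ _ p hp) ?_
      rw [Submodule.range_liftQ, LinearMap.range_eq_top]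
      exact (Submodule.mkQ_surjective _).comp (Submodule.mkQ_surjective _)
  have := key ⊥
  exact isNoetherian_of_linearEquiv
    (Submodule.quotEquivOfEqBot _ (by simp : (⊥ : Ideal R) • (⊤ : Submodule R M) = ⊥))

end Formanek

section Chain

variable {k : Type u} {H : Type v} [Field k] [Ring H] [Algebra k H]

lemma isNoetherian_center [IsNoetherianRing H] [Module.Finite (Subring.center H) H] :
    IsNoetherian (Subring.center H) H := by
  let J (I : Ideal (Subring.center H)) : Submodule H H :=
    { carrier := {a | a ∈ I • (⊤ : Submodule (Subring.center H) H)}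
      add_mem' := (I • (⊤ : Submodule (Subring.center H) H)).add_mem
      zero_mem' := (I • (⊤ : Submodule (Subring.center H) H)).zero_mem
      smul_mem' c a ha := by
        change a ∈ I • (⊤ : Submodule (Subring.center H) H) at ha
        change c * a ∈ I • (⊤ : Submodule (Subring.center H) H)
        induction ha using Submodule.smul_induction_on' with
        | smul r hr n hn =>
          rw [mul_smul_comm]
          exact Submodule.smul_mem_smul hr Submodule.mem_top
        | add x _ y _ hx hy => rw [mul_add]; exact Submodule.add_mem _ hx hy }
  apply isNoetherian_of_wellFounded_smul_top
  have hwf : WellFounded fun I J : Submodule H H ↦ J < I := wellFounded_gt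
  exact Subrelation.wf (r := InvImage (fun I J : Submodule H H ↦ J < I) J)
    (fun {I I'} h ↦ ⟨h.1, h.2⟩) (InvImage.wf J hwf)

lemma isNoetherianRing_center [IsNoetherianRing H] [Module.Finite (Subring.center H) H] :
    IsNoetherianRing (Subring.center H) := by
  have := isNoetherian_center (H := H)
  exact isNoetherian_of_injective (Algebra.linearMap (Subring.center H) H) Subtype.val_injective

/-- A maximal regular chain of central elements in the kernel of `ε`. -/
theorem exists_regularChain [IsNoetherianRing H] [Module.Finite (Subring.center H) H]
    (ε : H →ₐ[k] k) :
    ∃ (xs : List (Subring.center H)) (J : Submodule H H), RegularChain xs ⊥ J ∧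
      (∀ x ∈ xs, ε (x : H) = 0) ∧ (∀ a ∈ J, ∀ b, a * b ∈ J) ∧ (∀ a ∈ J, ε a = 0) ∧
      ∃ a ∉ J, ∀ z : Subring.center H, ε (z : H) = 0 → (z : H) * a ∈ J := by
  suffices key : ∀ J₀ : Submodule H H, (∀ a ∈ J₀, ∀ b, a * b ∈ J₀) → (∀ a ∈ J₀, ε a = 0) →
      ∃ (xs : List (Subring.center H)) (J : Submodule H H), RegularChain xs J₀ J ∧
      (∀ x ∈ xs, ε (x : H) = 0) ∧ (∀ a ∈ J, ∀ b, a * b ∈ J) ∧ (∀ a ∈ J, ε a = 0) ∧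
      ∃ a ∉ J, ∀ z : Subring.center H, ε (z : H) = 0 → (z : H) * a ∈ J by
    exact key ⊥ (by simp) (by simp)
  intro J₀
  induction J₀ using (wellFounded_gt (α := Submodule H H)).induction with
  | _ J₀ ih =>
    intro h1 h2
    by_cases hreg : ∃ x : Subring.center H, ε (x : H) = 0 ∧ ∀ a, (x : H) * a ∈ J₀ → a ∈ J₀
    · obtain ⟨x, hx, hreg⟩ := hreg
      have hxJ : (x : H) ∉ J₀ := fun h ↦ by
        have := h2 1 (hreg 1 (by simpa using h))
        simp at this
      have hlt : J₀ < J₀ ⊔ Submodule.span H {(x : H)} :=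
        lt_of_le_of_ne le_sup_left fun h ↦
          hxJ (h ▸ Submodule.mem_sup_right (Submodule.mem_span_singleton_self _))
      obtain ⟨xs, J, hJ, hxs, hrest⟩ := ih _ hlt (by
        intro a ha b
        obtain ⟨c, hc, d, hd, rfl⟩ := Submodule.mem_sup.1 ha
        obtain ⟨r, rfl⟩ := Submodule.mem_span_singleton.1 hd
        rw [add_mul]
        refine Submodule.add_mem _ (Submodule.mem_sup_left (h1 c hc b))
          (Submodule.mem_sup_right (Submodule.mem_span_singleton.2 ⟨r * b, ?_⟩))
        rw [smul_eq_mul, smul_eq_mul, mul_assoc, mul_assoc, Subring.mem_center_iff.1 x.2 b]) (by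
        intro a ha
        obtain ⟨c, hc, d, hd, rfl⟩ := Submodule.mem_sup.1 ha
        obtain ⟨r, rfl⟩ := Submodule.mem_span_singleton.1 hd
        rw [map_add, h2 c hc, smul_eq_mul, map_mul, hx, mul_zero, add_zero])
      refine ⟨x :: xs, J, RegularChain.cons x hreg hJ, ?_, hrest⟩
      intro y hy
      rcases List.mem_cons.1 hy with rfl | hy
      · exact hx
      · exact hxs y hy
    · refine ⟨[], J₀, RegularChain.nil J₀, by simp, h1, h2, ?_⟩
      have := isNoetherianRing_center (H := H)
      let m : Ideal (Subring.center H) :=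
        RingHom.ker ((ε : H →+* k).comp (Subring.center H).subtype)
      have hm (z : Subring.center H) : z ∈ m ↔ ε (z : H) = 0 := RingHom.mem_ker
      have h3 : ¬ Subsingleton ((Subring.center H ⧸ m) →ₗ[Subring.center H] (H ⧸ J₀)) := by
        rw [IsSMulRegular.subsingleton_linearMap_iff]
        rintro ⟨r, hr, hr'⟩
        rw [Ideal.annihilator_quotient] at hr
        refine hreg ⟨r, (hm r).1 hr, fun a ha ↦ ?_⟩
        rw [← Submodule.Quotient.mk_eq_zero] at ha ⊢
        refine hr' ?_
        change r • (Submodule.Quotient.mk a : H ⧸ J₀) = r • (0 : H ⧸ J₀)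
        rw [smul_zero]
        exact ha
      rw [not_subsingleton_iff_nontrivial] at h3
      obtain ⟨f, hf⟩ := exists_ne (0 : (Subring.center H ⧸ m) →ₗ[Subring.center H] (H ⧸ J₀))
      obtain ⟨a, ha⟩ := Submodule.Quotient.mk_surjective _ (f (Submodule.Quotient.mk 1))
      refine ⟨a, fun haJ ↦ hf ?_, fun z hz ↦ ?_⟩
      · ext
        rw [← Submodule.Quotient.mk_eq_zero, ha] at haJ
        exact haJ
      · rw [← Submodule.Quotient.mk_eq_zero]
        change z • (Submodule.Quotient.mk a : H ⧸ J₀) = 0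
        rw [ha, ← map_smul, ← Submodule.Quotient.mk_smul, smul_eq_mul, mul_one,
          (Submodule.Quotient.mk_eq_zero _).2 ((hm z).2 hz), map_zero]

end Chain

section Bimodule

open TensorProduct MulOpposite

variable {k : Type u} {H Q : Type v} [Field k] [Ring H] [HopfAlgebra k H] [Ring Q] [Algebra k Q]

/-- The algebra map `h ↦ q(S(h))` to the opposite algebra. -/
noncomputable def opAntipode (q : H →ₐ[k] Q) : H →ₐ[k] Qᵐᵒᵖ :=
  (AlgHom.op q).comp (HopfAlgebra.antipodeAlgHomOp (R := k) (A := H))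

lemma opAntipode_apply (q : H →ₐ[k] Q) (h : H) :
    opAntipode q h = op (q (HopfAlgebra.antipode k h)) := rfl

/-- The algebra `Q` as an `H`-`Q`-bimodule via `q : H → Q`. -/
def AlgBimodule (_q : H →ₐ[k] Q) : Type v := Q

/-- The bimodule action on `Q`. -/
noncomputable def algBimoduleAct (q : H →ₐ[k] Q) : H ⊗[k] Qᵐᵒᵖ →ₐ[k] Module.End k Q :=
  Algebra.TensorProduct.lift ((Algebra.lmul k Q).comp q) (Algebra.lsmul k k Q)
    fun h p ↦ LinearMap.ext fun x ↦ by simp [mul_assoc]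

noncomputable instance (q : H →ₐ[k] Q) : AddCommGroup (AlgBimodule q) :=
  inferInstanceAs (AddCommGroup Q)

noncomputable instance (q : H →ₐ[k] Q) : Module (H ⊗[k] Qᵐᵒᵖ) (AlgBimodule q) :=
  letI : Module (Module.End k Q) (AlgBimodule q) := inferInstanceAs (Module (Module.End k Q) Q)
  Module.compHom _ (algBimoduleAct q).toRingHom

/-- The identity from `Q` to the bimodule `Q`. -/
def toAlgBimodule (q : H →ₐ[k] Q) : Q ≃+ AlgBimodule q := AddEquiv.refl Q

lemma tmul_smul_toAlgBimodule (q : H →ₐ[k] Q) (h : H) (p x : Q) :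
    (h ⊗ₜ[k] op p) • toAlgBimodule q x = toAlgBimodule q (q h * (x * p)) := by
  change algBimoduleAct q (h ⊗ₜ[k] op p) x = q h * (x * p)
  exact congrArg (fun f : Module.End k Q ↦ f x)
    (Algebra.TensorProduct.lift_tmul ((Algebra.lmul k Q).comp q) (Algebra.lsmul k k Q)
      (fun h p ↦ LinearMap.ext fun x ↦ by simp [mul_assoc]) h (op p))

lemma sum_op_mul_comulTwist (q : H →ₐ[k] Q) (h : H) :
    LinearMap.mul' k (H ⊗[k] Qᵐᵒᵖ) (TensorProduct.comm k _ _
      (TensorProduct.map (comulTwist (opAntipode q)).toLinearMap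
        ((TensorProduct.mk k H Qᵐᵒᵖ 1) ∘ₗ (opLinearEquiv k).toLinearMap ∘ₗ q.toLinearMap)
        (Coalgebra.comul (R := k) h))) = h ⊗ₜ 1 := by
  let g : H ⊗[k] H →ₗ[k] Qᵐᵒᵖ := (opLinearEquiv k).toLinearMap ∘ₗ q.toLinearMap ∘ₗ
    LinearMap.mul' k H ∘ₗ (HopfAlgebra.antipode k).rTensor H
  have h1 (s : H ⊗[k] H) : LinearMap.mul' k (H ⊗[k] Qᵐᵒᵖ) (TensorProduct.comm k _ _
      (TensorProduct.map (comulTwist (opAntipode q)).toLinearMap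
        ((TensorProduct.mk k H Qᵐᵒᵖ 1) ∘ₗ (opLinearEquiv k).toLinearMap ∘ₗ q.toLinearMap) s)) =
      g.lTensor H (TensorProduct.assoc k H H H
        ((Coalgebra.comul (R := k) (A := H)).rTensor H s)) := by
    induction s with
    | zero => simp
    | add x y hx hy => simp only [map_add, hx, hy]
    | tmul b c =>
      rw [TensorProduct.map_tmul, comm_tmul, LinearMap.mul'_apply, LinearMap.rTensor_tmul]
      change (1 ⊗ₜ op (q c)) * Algebra.TensorProduct.map (AlgHom.id k H) (opAntipode q)
        (Coalgebra.comul b) = _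
      generalize Coalgebra.comul (R := k) b = s
      induction s with
      | zero => simp
      | add x y hx hy => simp only [map_add, add_tmul, mul_add, hx, hy]
      | tmul a b => simp [g, opAntipode_apply]
  rw [h1, Coalgebra.coassoc_apply, ← LinearMap.lTensor_comp_apply]
  have h2 : g ∘ₗ Coalgebra.comul (R := k) (A := H) =
      (LinearMap.toSpanSingleton k Qᵐᵒᵖ 1) ∘ₗ Coalgebra.counit (R := k) (A := H) := by
    ext b
    change op (q (LinearMap.mul' k H ((HopfAlgebra.antipode k).rTensor H
      (Coalgebra.comul b)))) = _
    rw [HopfAlgebra.mul_antipode_rTensor_comul_apply, AlgHom.commutes]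
    simp [Algebra.algebraMap_eq_smul_one]
  rw [h2, LinearMap.lTensor_comp_apply, Coalgebra.lTensor_counit_comul]
  simp

lemma comulTwist_opAntipode_invariant_iff (q : H →ₐ[k] Q) {X : Type*} [AddCommGroup X]
    [Module (H ⊗[k] Qᵐᵒᵖ) X] (ξ : X) :
    (∀ h, comulTwist (opAntipode q) h • ξ =
      algebraMap k (H ⊗[k] Qᵐᵒᵖ) (Bialgebra.counitAlgHom k H h) • ξ) ↔
    ∀ h : H, (h ⊗ₜ[k] (1 : Qᵐᵒᵖ)) • ξ = ((1 : H) ⊗ₜ[k] op (q h)) • ξ := by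
  let _ : Module k X := Module.compHom X (algebraMap k (H ⊗[k] Qᵐᵒᵖ))
  have : IsScalarTower k (H ⊗[k] Qᵐᵒᵖ) X := ⟨fun c b m ↦
    (congrArg (· • m) (Algebra.smul_def c b)).trans (mul_smul _ b m)⟩
  have halg (c : k) (x : X) : algebraMap k (H ⊗[k] Qᵐᵒᵖ) c • x = c • x := rfl
  let ev : (H ⊗[k] Qᵐᵒᵖ) →ₗ[k] X := (LinearMap.toSpanSingleton (H ⊗[k] Qᵐᵒᵖ) X ξ).restrictScalars k
  have hev (b) : ev b = b • ξ := rfl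
  constructor
  · intro hξ h
    rw [← sum_op_mul_comulTwist]
    have h1 (s : H ⊗[k] H) : LinearMap.mul' k (H ⊗[k] Qᵐᵒᵖ) (TensorProduct.comm k _ _
      (TensorProduct.map (comulTwist (opAntipode q)).toLinearMap
        ((TensorProduct.mk k H Qᵐᵒᵖ 1) ∘ₗ (opLinearEquiv k).toLinearMap ∘ₗ q.toLinearMap) s)) • ξ =
      (ev ∘ₗ (TensorProduct.mk k H Qᵐᵒᵖ 1) ∘ₗ (opLinearEquiv k).toLinearMap ∘ₗ q.toLinearMap)
        (TensorProduct.lid k H ((Coalgebra.counit (R := k) (A := H)).rTensor H s)) := by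
      induction s with
      | zero => simp only [map_zero]; exact zero_smul (H ⊗[k] Qᵐᵒᵖ) ξ
      | add x y hx hy => simp only [map_add, add_smul, hx, hy]
      | tmul b c =>
        rw [TensorProduct.map_tmul, comm_tmul, LinearMap.mul'_apply, mul_smul,
          AlgHom.toLinearMap_apply, hξ, LinearMap.rTensor_tmul, lid_tmul, map_smul, halg,
          smul_comm]
        rfl
    rw [h1, Coalgebra.rTensor_counit_comul, lid_tmul, one_smul]
    rfl
  · intro hξ h
    change (Algebra.TensorProduct.map (AlgHom.id k H) (opAntipode q) (Coalgebra.comul h)) • ξ = _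
    have h1 (s : H ⊗[k] H) :
        (Algebra.TensorProduct.map (AlgHom.id k H) (opAntipode q) s) • ξ =
        (ev ∘ₗ (TensorProduct.mk k H Qᵐᵒᵖ 1) ∘ₗ (opLinearEquiv k).toLinearMap ∘ₗ q.toLinearMap)
          (LinearMap.mul' k H ((HopfAlgebra.antipode k).lTensor H s)) := by
      induction s with
      | zero => simp only [map_zero]; exact zero_smul (H ⊗[k] Qᵐᵒᵖ) ξ
      | add x y hx hy => simp only [map_add, add_smul, hx, hy]
      | tmul b c =>
        have : (b ⊗ₜ[k] op (q (HopfAlgebra.antipode k c))) =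
          ((1 : H) ⊗ₜ[k] op (q (HopfAlgebra.antipode k c))) * (b ⊗ₜ[k] (1 : Qᵐᵒᵖ)) := by simp
        rw [Algebra.TensorProduct.map_tmul, opAntipode_apply, AlgHom.id_apply, this, mul_smul, hξ,
          ← mul_smul, LinearMap.lTensor_tmul, LinearMap.mul'_apply]
        simp [hev, ← op_mul]
    rw [h1, HopfAlgebra.mul_antipode_lTensor_comul_apply]
    change ((1 : H) ⊗ₜ[k] op (q (algebraMap k H _))) • ξ = _
    rw [AlgHom.commutes]
    congr 1
    rw [Algebra.algebraMap_eq_smul_one, Algebra.algebraMap_eq_smul_one, op_smul, tmul_smul]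
    rfl

theorem isUniversalInvariant_algBimodule (q : H →ₐ[k] Q) :
    IsUniversalInvariant (comulTwist (opAntipode q)) (Bialgebra.counitAlgHom k H)
      (toAlgBimodule q 1) where
  smul_eq := (comulTwist_opAntipode_invariant_iff q _).2 fun h ↦ by
    rw [← op_one, tmul_smul_toAlgBimodule, tmul_smul_toAlgBimodule]
    simp
  exists_hom X _ _ ξ hξ := by
    rw [comulTwist_opAntipode_invariant_iff] at hξ
    refine ⟨{ toFun p := ((1 : H) ⊗ₜ[k] op ((toAlgBimodule q).symm p)) • ξ
              map_add' x y := by rw [map_add, op_add, tmul_add, add_smul]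
              map_smul' b x := ?_ }, ?_⟩
    · obtain ⟨x, rfl⟩ := (toAlgBimodule q).surjective x
      induction b with
      | zero =>
        simp only [zero_smul, map_zero, op_zero, tmul_zero]
        exact zero_smul (H ⊗[k] Qᵐᵒᵖ) ξ
      | add b c hb hc => simp only [add_smul, map_add, op_add, tmul_add, hb, hc]
      | tmul h p =>
        obtain ⟨p, rfl⟩ := op_surjective p
        have h1 : ((1 : H) ⊗ₜ[k] op (q h * (x * p))) =
            ((1 : H) ⊗ₜ[k] op (x * p)) * ((1 : H) ⊗ₜ[k] op (q h)) := by simp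
        rw [tmul_smul_toAlgBimodule, AddEquiv.symm_apply_apply, AddEquiv.symm_apply_apply, h1,
          mul_smul, ← hξ, ← mul_smul, RingHom.id_apply, ← mul_smul]
        congr 1
        simp
    · change ((1 : H) ⊗ₜ[k] op ((toAlgBimodule q).symm (toAlgBimodule q 1))) • ξ = ξ
      rw [AddEquiv.symm_apply_apply, op_one, ← Algebra.TensorProduct.one_def, one_smul]
  hom_ext X _ _ f g hfg := by
    ext p
    obtain ⟨p, rfl⟩ := (toAlgBimodule q).surjective p
    have : toAlgBimodule q p = ((1 : H) ⊗ₜ[k] op p) • toAlgBimodule q 1 := by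
      rw [tmul_smul_toAlgBimodule]; simp
    rw [this, map_smul, map_smul, hfg]

end Bimodule

section TwistedInvariants

open CategoryTheory CategoryTheory.Abelian TensorProduct

variable {k : Type u} [Field k]

lemma nonempty_linearEquiv_of_range {M V V' : Type*} [AddCommGroup M] [AddCommGroup V]
    [AddCommGroup V'] [Module k V] [Module k V'] (E : M →+ V) (G : M →+ V')
    (hE : Function.Injective E) (hG : Function.Injective G)
    (h : ∀ (s : k) (m : M), ∃ m', E m' = s • E m ∧ G m' = s • G m)
    (S : Submodule k V) (S' : Submodule k V') (hS : ∀ y, y ∈ Set.range E ↔ y ∈ S)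
    (hS' : ∀ y, y ∈ Set.range G ↔ y ∈ S') : Nonempty (S ≃ₗ[k] S') := by
  let e : M ≃+ S := AddEquiv.ofBijective (E.codRestrict S fun m ↦ (hS _).1 ⟨m, rfl⟩)
    ⟨fun a b hab ↦ hE (congrArg Subtype.val hab),
      fun y ↦ ((hS _).2 y.2).imp fun m hm ↦ Subtype.ext hm⟩
  let g : M ≃+ S' := AddEquiv.ofBijective (G.codRestrict S' fun m ↦ (hS' _).1 ⟨m, rfl⟩)
    ⟨fun a b hab ↦ hG (congrArg Subtype.val hab),
      fun y ↦ ((hS' _).2 y.2).imp fun m hm ↦ Subtype.ext hm⟩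
  refine ⟨{ e.symm.trans g with map_smul' := fun s y ↦ ?_ }⟩
  obtain ⟨m, rfl⟩ := e.surjective y
  obtain ⟨m', h1, h2⟩ := h s m
  have : s • e m = e m' := Subtype.ext h1.symm
  change g (e.symm (s • e m)) = s • g (e.symm (e m))
  rw [this, AddEquiv.symm_apply_apply, AddEquiv.symm_apply_apply]
  exact Subtype.ext h2

variable {H A : Type v} [Ring H] [HopfAlgebra k H] [Ring A] [Algebra k A]

/-- The elements of `M ⊗ W` on which `H` acts trivially via `h ↦ h₁ ⊗ ψ(h₂)`. -/
def twistInvariants (ψ : H →ₐ[k] A) (M W : Type v) [AddCommGroup M] [Module k M] [Module H M]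
    [IsScalarTower k H M] [AddCommGroup W] [Module k W] [Module A W] [IsScalarTower k A W] :
    Submodule k (M ⊗[k] W) where
  carrier := {ξ | ∀ h, outerAct M W (comulTwist ψ h) ξ = Coalgebra.counit (R := k) h • ξ}
  add_mem' ha hb h := by rw [map_add, smul_add, ha, hb]
  zero_mem' h := by rw [map_zero, smul_zero]
  smul_mem' c x hx h := by rw [map_smul, hx, smul_comm]

/-- The elements of `M ⊗ W` on which `H` acts trivially through `M`. -/
def tensorInvariants (k H : Type*) [Field k] [Ring H] [HopfAlgebra k H] (M W : Type*)
    [AddCommGroup M] [Module k M] [Module H M]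
    [IsScalarTower k H M] [AddCommGroup W] [Module k W] :
    Submodule k (M ⊗[k] W) where
  carrier := {ξ | ∀ h : H, h • ξ = Coalgebra.counit (R := k) h • ξ}
  add_mem' ha hb h := by rw [smul_add, smul_add, ha, hb]
  zero_mem' h := by rw [smul_zero, smul_zero]
  smul_mem' c x hx h := by rw [smul_comm, hx, smul_comm]

/-- The two descriptions of `Ext` from a module with a universal invariant. -/
theorem nonempty_twistInvariants_equiv
    (hS : Function.Bijective (HopfAlgebra.antipode k : H →ₗ[k] H)) (ψ : H →ₐ[k] A)
    {L : Type v} [AddCommGroup L] [Module (H ⊗[k] A) L] {ℓ : L}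
    (hℓ : IsUniversalInvariant (comulTwist ψ) (Bialgebra.counitAlgHom k H) ℓ)
    {xs : List (Subring.center H)} (hxs : ∀ x ∈ xs, Coalgebra.counit (R := k) (x : H) = 0)
    {J : Submodule H H} (hJ : RegularChain xs ⊥ J)
    (hL : ∀ x ∈ xs, ∀ l : L, ((x : H) ⊗ₜ[k] (1 : A)) • l = 0)
    (W : Type v) [AddCommGroup W] [Module k W] [Module A W] [IsScalarTower k A W] :
    Nonempty (twistInvariants ψ (H ⧸ J) W ≃ₗ[k] tensorInvariants k H (H ⧸ J) W) := by
  let ρ : H ⊗[k] A →ₐ[k] H ⊗[k] A := AlgHom.id k _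
  let ξ (x : Subring.center H) : Subring.center (H ⊗[k] A) :=
    ⟨(x : H) ⊗ₜ 1, Subring.mem_center_iff.2 fun g ↦ by
      induction g with
      | zero => simp
      | add a b ha hb => rw [add_mul, mul_add, ha, hb]
      | tmul h a => simp [Subring.mem_center_iff.1 x.2 h]⟩
  obtain ⟨c, hc⟩ := hJ.exists_reesClass (W := W) ρ ξ (fun x ↦ rfl)
  let b : H ≃ₗ[H] (H ⧸ (⊥ : Submodule H H)) := (Submodule.quotEquivOfEqBot ⊥ rfl).symm
  let Ψ : H ⊗[k] W ≃ₗ[k] OuterTensor ρ (H ⧸ (⊥ : Submodule H H)) W :=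
    (leftTwist ψ W).trans
      ((TensorProduct.congr (b.restrictScalars k) (LinearEquiv.refl k W)).trans (toOuter _ W ρ))
  have hΨ (h h' : H) (w : W) : Ψ ((h * h') ⊗ₜ w) = comulTwist ψ h • Ψ (h' ⊗ₜ w) := by
    refine (congrArg (OuterTensor.map W ρ b.toLinearMap) ?_).trans
      (map_smul (OuterTensor.map W ρ b.toLinearMap) (comulTwist ψ h)
        (toOuter H W ρ (leftTwist ψ W (h' ⊗ₜ w))))
    exact leftTwist_mul_tmul ψ h h' w
  obtain ⟨θ, hθ1, hθ2, hθ3⟩ := exists_ext_invariants (comulTwist ψ) (rightTwist hS ψ)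
    (rightTwist_mul_tmul hS ψ) (Bialgebra.counitAlgHom k H) hℓ hxs hJ Ψ.toAddEquiv hΨ
  let Y := OuterTensor ρ (H ⧸ J) W
  have hbij := (hc.bijective (ModuleCat.of (H ⊗[k] A) L) (by
    intro τ hτ
    obtain ⟨x, hx, rfl⟩ := List.mem_map.1 hτ
    exact centralEnd_app_eq_zero _ _ fun l ↦ hL x hx l)).2
  let G : (L →ₗ[H ⊗[k] A] Y) →+ (H ⧸ J) ⊗[k] W :=
    { toFun f := θ ((Ext.mk₀ (ModuleCat.ofHom f)).comp c (zero_add _))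
      map_zero' := by simp
      map_add' f g := by rw [ModuleCat.ofHom_add, Ext.mk₀_add, Ext.add_comp, map_add] }
  let E : (L →ₗ[H ⊗[k] A] Y) →+ (H ⧸ J) ⊗[k] W :=
    { toFun f := (toOuter (H ⧸ J) W ρ).symm (f ℓ)
      map_zero' := by simp
      map_add' f g := by rw [LinearMap.add_apply, map_add] }
  let σ (M : Type v) [AddCommGroup M] [Module k M] [Module H M] [IsScalarTower k H M] (s : k) :
      OuterTensor ρ M W →ₗ[H ⊗[k] A] OuterTensor ρ M W :=
    { toFun t := s • t
      map_add' := smul_add _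
      map_smul' r t := by
        obtain ⟨t, rfl⟩ := (toOuter _ W ρ).surjective t
        rw [smul_toOuter, ← map_smul, ← map_smul, ← map_smul, RingHom.id_apply, smul_toOuter] }
  refine nonempty_linearEquiv_of_range E G
    (fun f g hfg ↦ hℓ.hom_ext _ f g ((toOuter (H ⧸ J) W ρ).symm.injective hfg))
    (fun f g hfg ↦ ?_) (fun s f ↦ ⟨σ _ s ∘ₗ f, ?_, ?_⟩) _ _ (fun y ↦ ?_) (fun y ↦ ?_)
  · have := hbij.1 (hθ1 hfg)
    exact congrArg ModuleCat.Hom.hom this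
  · exact map_smul (toOuter (H ⧸ J) W ρ).symm s (f ℓ)
  · have hnat := hc.naturality hc rfl (ModuleCat.ofHom (σ _ s)) (ModuleCat.ofHom (σ _ s)) (by
      ext t
      exact (map_smul ((Submodule.factor hJ.le).restrictScalars k |>.rTensor W) s t))
    change θ ((Ext.mk₀ (ModuleCat.ofHom f ≫ ModuleCat.ofHom (σ _ s))).comp c (zero_add _)) =
      s • θ _
    rw [← Ext.mk₀_comp_mk₀, Ext.comp_assoc (h₁₂ := zero_add 0) (h₂₃ := zero_add _), ← hnat,
      ← Ext.comp_assoc (h₁₂ := zero_add _) (h₂₃ := add_zero _)]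
    · exact hθ3 (σ _ s) (DistribSMul.toAddMonoidHom _ s) (fun x ↦ by
        obtain ⟨t, rfl⟩ := Ψ.surjective x
        change chainProj Ψ.toAddEquiv J (s • Ψ t) = s • chainProj Ψ.toAddEquiv J (Ψ t)
        rw [← map_smul]
        have h1 (t) : chainProj Ψ.toAddEquiv J (Ψ t) =
          ((J.mkQ).restrictScalars k).rTensor W t := by
          change ((J.mkQ).restrictScalars k).rTensor W (Ψ.symm (Ψ t)) = _
          rw [Ψ.symm_apply_apply]
        rw [h1, h1, map_smul]) _
    · omega
    · omega
  · have halg (h : H) (y : (H ⧸ J) ⊗[k] W) :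
        algebraMap k (H ⊗[k] A) (Bialgebra.counitAlgHom k H h) • toOuter _ W ρ y =
          toOuter _ W ρ (Coalgebra.counit (R := k) h • y) := by
      rw [smul_toOuter]
      change toOuter _ W ρ (outerAct (H ⧸ J) W (algebraMap k _ _) y) = _
      rw [AlgHom.commutes]
      rfl
    constructor
    · rintro ⟨f, rfl⟩ h
      apply (toOuter (H ⧸ J) W ρ).injective
      rw [← halg]
      refine (smul_toOuter (H ⧸ J) W ρ (comulTwist ψ h)
        ((toOuter (H ⧸ J) W ρ).symm (f ℓ))).symm.trans ?_
      have : toOuter (H ⧸ J) W ρ (E f) = f ℓ := (toOuter (H ⧸ J) W ρ).apply_symm_apply (f ℓ)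
      change _ • toOuter (H ⧸ J) W ρ (E f) = _
      rw [this, ← map_smul, hℓ.smul_eq, map_smul]
    · intro hy
      obtain ⟨f, hf⟩ := hℓ.exists_hom Y (toOuter (H ⧸ J) W ρ y) fun h ↦ by
        refine Eq.trans ?_ (halg h y).symm
        exact congrArg (toOuter (H ⧸ J) W ρ) (hy h)
      exact ⟨f, ((toOuter (H ⧸ J) W ρ).symm_apply_eq).2 hf⟩
  · refine Iff.trans ?_ (hθ2 y)
    constructor
    · rintro ⟨f, rfl⟩
      exact ⟨_, rfl⟩
    · rintro ⟨e, rfl⟩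
      obtain ⟨f, rfl⟩ := hbij.2 e
      exact ⟨f.hom, rfl⟩

end TwistedInvariants

section Annihilator

open TensorProduct MulOpposite

variable {k : Type u} [Field k]

section Dual

variable {H P M W : Type*} [Ring H] [Algebra k H] [Ring P] [Algebra k P] [Module.Finite k P]
  [AddCommGroup M] [Module k M] [AddCommGroup W] [Module k W]

/-- `M ⊗ W ≃ Hom(P, M)` for `W ≃ P*`. -/
noncomputable def tensorEquivHom (e : W ≃ₗ[k] Module.Dual k P) (M : Type*) [AddCommGroup M]
    [Module k M] : M ⊗[k] W ≃ₗ[k] (P →ₗ[k] M) :=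
  (TensorProduct.comm k M W).trans ((TensorProduct.congr e (LinearEquiv.refl k M)).trans
    (dualTensorHomEquiv k P M))

lemma tensorEquivHom_tmul (e : W ≃ₗ[k] Module.Dual k P) (m : M) (w : W) (x : P) :
    tensorEquivHom e M (m ⊗ₜ w) x = e w x • m := by
  simp [tensorEquivHom]

variable [Module H M] [IsScalarTower k H M]

lemma tensorEquivHom_smul (e : W ≃ₗ[k] Module.Dual k P) (h : H) (t : M ⊗[k] W) (x : P) :
    tensorEquivHom e M (h • t) x = h • tensorEquivHom e M t x := by
  induction t with
  | zero => simp
  | add a b ha hb => simp only [smul_add, map_add, LinearMap.add_apply, ha, hb]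
  | tmul m w => rw [smul_tmul', tensorEquivHom_tmul, tensorEquivHom_tmul, smul_comm]

variable [Module Pᵐᵒᵖ W] [IsScalarTower k Pᵐᵒᵖ W]

lemma tensorEquivHom_outerAct (e : W ≃ₗ[k] Module.Dual k P)
    (he : ∀ (p : P) w x, e (op p • w) x = e w (p * x)) (h : H) (p : P) (t : M ⊗[k] W) (x : P) :
    tensorEquivHom e M (outerAct M W (h ⊗ₜ op p) t) x = h • tensorEquivHom e M t (p * x) := by
  induction t with
  | zero => simp
  | add a b ha hb => simp only [smul_add, map_add, LinearMap.add_apply, ha, hb]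
  | tmul m w => rw [outerAct_tmul, tensorEquivHom_tmul, tensorEquivHom_tmul, he, smul_comm]

end Dual

lemma exists_dual_module (P V : Type*) [Ring P] [Algebra k P] [AddCommGroup V] [Module k V]
    (e : V ≃ₗ[k] Module.Dual k P) : ∃ (_ : Module Pᵐᵒᵖ V) (_ : IsScalarTower k Pᵐᵒᵖ V),
      ∀ (p : P) w x, e (op p • w) x = e w (p * x) := by
  let act (p : P) : V →ₗ[k] V :=
    e.symm.toLinearMap ∘ₗ (LinearMap.mulLeft k p).dualMap ∘ₗ e.toLinearMap
  have hact (p : P) (w : V) (x : P) : e (act p w) x = e w (p * x) := by simp [act]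
  let i : Module Pᵐᵒᵖ V :=
    { smul p w := act (unop p) w
      one_smul w := e.injective (LinearMap.ext fun x ↦ (hact _ _ _).trans (by simp))
      mul_smul p p' w := e.injective (LinearMap.ext fun x ↦ by
        refine (hact _ _ _).trans (Eq.trans ?_ (hact _ _ _).symm)
        refine Eq.trans ?_ (hact _ _ _).symm
        rw [unop_mul, mul_assoc])
      smul_zero p := map_zero _
      smul_add p := map_add _
      add_smul p p' w := e.injective (LinearMap.ext fun x ↦ by
        refine (hact _ _ _).trans (Eq.trans ?_ (congrArg (fun f ↦ f x) (map_add e _ _)).symm)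
        refine Eq.trans ?_ (congrArg₂ (· + ·) (hact _ _ _) (hact _ _ _)).symm
        rw [unop_add, add_mul, map_add])
      zero_smul w := e.injective (LinearMap.ext fun x ↦ (hact _ _ _).trans (by simp)) }
  have hact' (p : Pᵐᵒᵖ) (w : V) (x : P) : e (p • w) x = e w (unop p * x) := hact _ w x
  refine ⟨i, ⟨fun c p w ↦ e.injective (LinearMap.ext fun x ↦ ?_)⟩, fun p w x ↦ hact p w x⟩
  rw [hact', map_smul, LinearMap.smul_apply, hact']
  simp

variable {H : Type v} [Ring H] [HopfAlgebra k H]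

/-- The elements of `M` killed by `I`. -/
def annihilated (k : Type*) {H : Type*} [Field k] [Ring H] [Algebra k H] (I : Ideal H)
    (M : Type*) [AddCommGroup M] [Module k M] [Module H M] [IsScalarTower k H M] :
    Submodule k M where
  carrier := {a | ∀ i ∈ I, i • a = 0}
  add_mem' ha hb i hi := by rw [smul_add, ha i hi, hb i hi, add_zero]
  zero_mem' i _ := smul_zero i
  smul_mem' c x hx i hi := by rw [smul_comm, hx i hi, smul_zero]

/-- The elements of `M` on which `H` acts trivially. -/
def invariantElements (k H : Type*) [Field k] [Ring H] [HopfAlgebra k H]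
    (M : Type*) [AddCommGroup M] [Module k M] [Module H M] [IsScalarTower k H M] :
    Submodule k M where
  carrier := {t | ∀ h : H, h • t = Coalgebra.counit (R := k) h • t}
  add_mem' ha hb h := by rw [smul_add, smul_add, ha, hb]
  zero_mem' h := by rw [smul_zero, smul_zero]
  smul_mem' c x hx h := by rw [smul_comm, hx, smul_comm]

section Quotient

variable {P : Type v} [Ring P] [Algebra k P] [Module.Finite k P] (q : H →ₐ[k] P)
  {V : Type v} [AddCommGroup V] [Module k V] (e : V ≃ₗ[k] Module.Dual k P)
  {M : Type v} [AddCommGroup M] [Module k M] [Module H M] [IsScalarTower k H M]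

lemma mem_tensorInvariants_iff (ξ : M ⊗[k] V) : ξ ∈ tensorInvariants k H M V ↔
    ∀ x, tensorEquivHom e M ξ x ∈ invariantElements k H M := by
  refine Iff.trans ?_ forall_comm
  refine forall_congr' fun h ↦ ?_
  rw [← (tensorEquivHom e M).injective.eq_iff, LinearMap.ext_iff]
  refine forall_congr' fun x ↦ ?_
  rw [tensorEquivHom_smul, map_smul]
  rfl

/-- The trivial invariants of `M ⊗ P*`. -/
noncomputable def tensorInvariantsEquiv :
    tensorInvariants k H M V ≃ₗ[k] (P →ₗ[k] invariantElements k H M) where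
  toFun ξ := LinearMap.codRestrict _ (tensorEquivHom e M ξ.1)
    ((mem_tensorInvariants_iff e _).1 ξ.2)
  map_add' a b := by ext x; simp
  map_smul' a b := by ext x; simp
  invFun F := ⟨(tensorEquivHom e M).symm (Submodule.subtype _ ∘ₗ F),
    (mem_tensorInvariants_iff e _).2 fun x ↦ by
      rw [LinearEquiv.apply_symm_apply]
      exact (F x).2⟩
  left_inv ξ := Subtype.ext ((LinearEquiv.symm_apply_eq _).2 rfl)
  right_inv F := by
    ext x
    change tensorEquivHom e M ((tensorEquivHom e M).symm _) x = _
    rw [LinearEquiv.apply_symm_apply]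
    rfl

variable [Module Pᵐᵒᵖ V] [IsScalarTower k Pᵐᵒᵖ V]

lemma mem_twistInvariants_iff (he : ∀ (p : P) w x, e (op p • w) x = e w (p * x))
    (ξ : M ⊗[k] V) : ξ ∈ twistInvariants (opAntipode q) M V ↔
    ∀ h x, h • tensorEquivHom e M ξ x = tensorEquivHom e M ξ (q h * x) := by
  let ρ := AlgHom.id k (H ⊗[k] Pᵐᵒᵖ)
  have h1 := comulTwist_opAntipode_invariant_iff q (toOuter M V ρ ξ)
  have h2 : ξ ∈ twistInvariants (opAntipode q) M V ↔
      ∀ h : H, outerAct M V (h ⊗ₜ[k] (1 : Pᵐᵒᵖ)) ξ =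
        outerAct M V ((1 : H) ⊗ₜ[k] op (q h)) ξ := by
    refine Iff.trans (forall_congr' fun h ↦ ?_) h1
    have halg : algebraMap k (H ⊗[k] Pᵐᵒᵖ) (Bialgebra.counitAlgHom k H h) •
        toOuter M V ρ ξ = toOuter _ V ρ (Coalgebra.counit (R := k) h • ξ) := by
      rw [smul_toOuter]
      change toOuter M V _ (outerAct M V (algebraMap k _ _) ξ) = _
      rw [AlgHom.commutes]
      rfl
    rw [halg, smul_toOuter, (toOuter _ _ _).injective.eq_iff]
    rfl
  rw [h2]
  refine forall_congr' fun h ↦ ?_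
  rw [← (tensorEquivHom e M).injective.eq_iff, LinearMap.ext_iff]
  refine forall_congr' fun x ↦ ?_
  rw [← op_one, tensorEquivHom_outerAct e he, tensorEquivHom_outerAct e he, one_mul, one_smul]

lemma nonempty_twistInvariants_equiv_annihilated
    (he : ∀ (p : P) w x, e (op p • w) x = e w (p * x)) (hq : Function.Surjective q) :
    Nonempty (twistInvariants (opAntipode q) M V ≃ₗ[k] annihilated k (RingHom.ker q) M) := by
  let Φ := tensorEquivHom e M
  have hinv := mem_twistInvariants_iff q e (M := M) he
  let α : twistInvariants (opAntipode q) M V →ₗ[k] annihilated k (RingHom.ker q) M :=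
    LinearMap.codRestrict _ (LinearMap.applyₗ (1 : P) ∘ₗ Φ.toLinearMap ∘ₗ Submodule.subtype _)
      fun ξ i hi ↦ by
        change i • Φ ξ.1 1 = 0
        rw [(hinv _).1 ξ.2, (RingHom.mem_ker).1 hi, zero_mul, map_zero]
  have hα (ξ) : (α ξ : M) = Φ ξ.1 1 := rfl
  refine ⟨LinearEquiv.ofBijective α ⟨?_, fun a ↦ ?_⟩⟩
  · rw [injective_iff_map_eq_zero]
    intro ξ hξ
    apply Subtype.ext
    apply Φ.injective
    ext p
    obtain ⟨h, rfl⟩ := hq p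
    rw [← mul_one (q h), ← (hinv _).1 ξ.2, ← hα, hξ]
    simp
  · have hle : LinearMap.ker q.toLinearMap ≤
        LinearMap.ker ((LinearMap.toSpanSingleton H _ a.1).restrictScalars k) :=
      fun i hi ↦ a.2 i hi
    let F : P →ₗ[k] M := Submodule.liftQ _ _ hle ∘ₗ
      (q.toLinearMap.quotKerEquivOfSurjective hq).symm.toLinearMap
    have hF (h : H) : F (q h) = h • a.1 := by
      have : (q.toLinearMap.quotKerEquivOfSurjective hq).symm (q h) = Submodule.Quotient.mk h :=
        (LinearEquiv.symm_apply_eq _).2 rfl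
      change Submodule.liftQ _ _ hle ((q.toLinearMap.quotKerEquivOfSurjective hq).symm (q h)) = _
      rw [this]
      rfl
    refine ⟨⟨Φ.symm F, (hinv _).2 fun h x ↦ ?_⟩, Subtype.ext ?_⟩
    · obtain ⟨x, rfl⟩ := hq x
      rw [Φ.apply_symm_apply, ← map_mul, hF, hF, mul_smul]
    · rw [hα, Φ.apply_symm_apply, ← map_one q, hF, one_smul]

end Quotient

theorem nonempty_annihilated_equiv
    (hS : Function.Bijective (HopfAlgebra.antipode k : H →ₗ[k] H))
    {xs : List (Subring.center H)} (hxs : ∀ x ∈ xs, Coalgebra.counit (R := k) (x : H) = 0)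
    {J : Submodule H H} (hJ : RegularChain xs ⊥ J) {P : Type v} [Ring P] [Algebra k P]
    [Module.Finite k P] (q : H →ₐ[k] P) (hq : Function.Surjective q)
    (hqx : ∀ x ∈ xs, q (x : H) = 0) :
    Nonempty (annihilated k (RingHom.ker q) (H ⧸ J) ≃ₗ[k]
      (P →ₗ[k] invariantElements k H (H ⧸ J))) := by
  suffices ∀ (V : Type v) [AddCommGroup V] [Module k V] (e : V ≃ₗ[k] Module.Dual k P),
      Nonempty (annihilated k (RingHom.ker q) (H ⧸ J) ≃ₗ[k]
        (P →ₗ[k] invariantElements k H (H ⧸ J))) from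
    this _ (Module.finBasis k P).toDualEquiv
  intro V _ _ e
  obtain ⟨_, _, he⟩ := exists_dual_module P V e
  obtain ⟨Θ⟩ := nonempty_twistInvariants_equiv hS (opAntipode q)
    (isUniversalInvariant_algBimodule q) hxs hJ (fun x hx l ↦ by
      obtain ⟨p, rfl⟩ := (toAlgBimodule q).surjective l
      rw [← op_one, tmul_smul_toAlgBimodule, hqx x hx, zero_mul, map_zero]) V
  obtain ⟨α⟩ := nonempty_twistInvariants_equiv_annihilated q e (M := H ⧸ J) he hq
  exact ⟨α.symm.trans (Θ.trans (tensorInvariantsEquiv e))⟩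

end Annihilator

section Finiteness

lemma exists_fg_of_pow_smul_eq_bot {k Z M : Type*} [Field k] [CommRing Z] [AddCommGroup M]
    [Module k M] [Module Z M] [IsNoetherian Z M] (m : Ideal Z)
    (hm : ∀ z : Z, ∃ c : k, ∃ y ∈ m, ∀ x : M, z • x = c • x + y • x) (n : ℕ) (N : Submodule Z M)
    (hN : m ^ n • N = ⊥) : ∃ F : Submodule k M, F.FG ∧ ∀ x ∈ N, x ∈ F := by
  induction n generalizing N with
  | zero =>
    rw [pow_zero, Ideal.one_eq_top, Submodule.top_smul] at hN
    refine ⟨⊥, Submodule.fg_bot, fun x hx ↦ ?_⟩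
    rw [hN] at hx
    simpa using hx
  | succ n ih =>
    obtain ⟨F, hF, hNF⟩ := ih (m • N) (by rw [← Submodule.mul_smul, ← pow_succ, hN])
    obtain ⟨s, hs⟩ := IsNoetherian.noetherian N
    refine ⟨Submodule.span k s ⊔ F, (Submodule.fg_span s.finite_toSet).sup hF, fun x hx ↦ ?_⟩
    have h1 : ∀ x ∈ Submodule.span Z (s : Set M), x ∈ N ∧ x ∈ Submodule.span k (s : Set M) ⊔ F := by
      intro x hx
      induction hx using Submodule.span_induction with
      | mem x hx => exact ⟨hs ▸ Submodule.subset_span hx,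
          Submodule.mem_sup_left (Submodule.subset_span hx)⟩
      | zero => exact ⟨zero_mem _, zero_mem _⟩
      | add x y _ _ hx hy => exact ⟨add_mem hx.1 hy.1, add_mem hx.2 hy.2⟩
      | smul z x _ hx =>
        obtain ⟨c, y, hy, h⟩ := hm z
        refine ⟨N.smul_mem _ hx.1, ?_⟩
        rw [h]
        exact add_mem (Submodule.smul_mem _ _ hx.2)
          (Submodule.mem_sup_right (hNF _ (Submodule.smul_mem_smul hy hx.1)))
    exact (h1 x (hs ▸ hx)).2

end Finiteness

section TwoSided

variable {H : Type*} [Ring H] {J : Submodule H H}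

/-- Right multiplication on the quotient by a two-sided ideal. -/
def quotientMulRight (hJ : ∀ a ∈ J, ∀ b, a * b ∈ J) (a : H ⧸ J) : (H ⧸ J) →ₗ[H] (H ⧸ J) :=
  J.liftQ (LinearMap.toSpanSingleton H _ a) fun j hj ↦ by
    obtain ⟨b, rfl⟩ := Submodule.Quotient.mk_surjective _ a
    rw [LinearMap.mem_ker, LinearMap.toSpanSingleton_apply, ← Submodule.Quotient.mk_smul,
      Submodule.Quotient.mk_eq_zero]
    exact hJ j hj b

@[simp]
lemma quotientMulRight_mk (hJ : ∀ a ∈ J, ∀ b, a * b ∈ J) (a : H ⧸ J) (h : H) :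
    quotientMulRight hJ a (Submodule.Quotient.mk h) = h • a := rfl

lemma map_mem_center_smul_top {M : Type*} [AddCommGroup M] [Module H M]
    (I : Ideal (Subring.center H)) (f : M →ₗ[H] M) {t : M}
    (ht : t ∈ I • (⊤ : Submodule (Subring.center H) M)) :
    f t ∈ I • (⊤ : Submodule (Subring.center H) M) := by
  induction ht using Submodule.smul_induction_on' with
  | smul z hz x hx =>
    have : f (z • x) = z • f x := map_smul f (z : H) x
    rw [this]
    exact Submodule.smul_mem_smul hz Submodule.mem_top
  | add x _ y _ hx hy => rw [map_add]; exact add_mem hx hy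

lemma smul_mem_center_smul_top {M : Type*} [AddCommGroup M] [Module H M]
    (I : Ideal (Subring.center H)) (h : H) {t : M}
    (ht : t ∈ I • (⊤ : Submodule (Subring.center H) M)) :
    h • t ∈ I • (⊤ : Submodule (Subring.center H) M) := by
  induction ht using Submodule.smul_induction_on' with
  | smul z hz x hx =>
    have : h • z • x = z • h • x := by
      change h • (z : H) • x = (z : H) • h • x
      rw [smul_smul, smul_smul, Subring.mem_center_iff.1 z.2 h]
    rw [this]
    exact Submodule.smul_mem_smul hz Submodule.mem_top
  | add x _ y _ hx hy => rw [smul_add]; exact add_mem hx hy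

/-- The left ideal `J + I H` of `H`, for `I` an ideal of the center. -/
def centralSup (J : Submodule H H) (I : Ideal (Subring.center H)) : Ideal H where
  carrier :=
    {h | (Submodule.Quotient.mk h : H ⧸ J) ∈ I • (⊤ : Submodule (Subring.center H) (H ⧸ J))}
  add_mem' := (I • (⊤ : Submodule (Subring.center H) (H ⧸ J))).add_mem
  zero_mem' := (I • (⊤ : Submodule (Subring.center H) (H ⧸ J))).zero_mem
  smul_mem' h _ ha := smul_mem_center_smul_top I h ha

lemma mem_centralSup {I : Ideal (Subring.center H)} {h : H} : h ∈ centralSup J I ↔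
    (Submodule.Quotient.mk h : H ⧸ J) ∈ I • (⊤ : Submodule (Subring.center H) (H ⧸ J)) := Iff.rfl

lemma le_centralSup (I : Ideal (Subring.center H)) : J ≤ centralSup J I := fun h hh ↦ by
  rw [mem_centralSup, (Submodule.Quotient.mk_eq_zero _).2 hh]
  exact zero_mem _

lemma isTwoSided_centralSup (hJ : ∀ a ∈ J, ∀ b, a * b ∈ J) (I : Ideal (Subring.center H)) :
    (centralSup J I).IsTwoSided where
  mul_mem_of_left b ha := by
    exact map_mem_center_smul_top I (quotientMulRight hJ (Submodule.Quotient.mk b)) ha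

lemma centralSup_mono {I I' : Ideal (Subring.center H)} (h : I ≤ I') :
    centralSup J I ≤ centralSup J I' := fun _ ha ↦ Submodule.smul_mono_left h ha

lemma coe_mul_mem_centralSup {I : Ideal (Subring.center H)} {z : Subring.center H} (hz : z ∈ I)
    (h : H) : (z : H) * h ∈ centralSup J I :=
  Submodule.smul_mem_smul (n := (Submodule.Quotient.mk h : H ⧸ J)) hz Submodule.mem_top

lemma mem_annihilated_centralSup {k : Type*} [Field k] [Algebra k H]
    (hJ : ∀ a ∈ J, ∀ b, a * b ∈ J) (I : Ideal (Subring.center H)) (a : H ⧸ J) :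
    a ∈ annihilated k (centralSup J I) (H ⧸ J) ↔ ∀ z ∈ I, z • a = 0 := by
  constructor
  · intro ha z hz
    have := coe_mul_mem_centralSup (J := J) hz 1
    rw [mul_one] at this
    exact ha _ this
  · intro ha h hh
    rw [← quotientMulRight_mk hJ]
    rw [mem_centralSup] at hh
    generalize (Submodule.Quotient.mk h : H ⧸ J) = t at hh
    induction hh using Submodule.smul_induction_on' with
    | smul z hz x hx =>
      obtain ⟨h, rfl⟩ := Submodule.Quotient.mk_surjective _ x
      have : quotientMulRight hJ a (z • Submodule.Quotient.mk h) = h • z • a := by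
        change ((z : H) * h) • a = h • (z : H) • a
        rw [smul_smul, Subring.mem_center_iff.1 z.2 h]
      rw [this, ha z hz, smul_zero]
    | add x _ y _ hx hy => rw [map_add, hx, hy, add_zero]

lemma RegularChain.mem {xs : List (Subring.center H)} {J J' : Submodule H H}
    (h : RegularChain xs J J') {x} (hx : x ∈ xs) : (x : H) ∈ J' := by
  induction h with
  | nil J => simp at hx
  | cons y hy h ih =>
    rcases List.mem_cons.1 hx with rfl | hx
    · exact h.le (Submodule.mem_sup_right (Submodule.mem_span_singleton_self _))
    · exact ih hx

end TwoSided

section OneDimensional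

variable {k : Type u} {H : Type v} [Field k] [Ring H]

/-- The intersection of the center with the augmentation ideal. -/
noncomputable def centerAugmentation (k H : Type*) [Field k] [Ring H] [HopfAlgebra k H] :
    Ideal (Subring.center H) :=
  RingHom.ker ((Bialgebra.counitAlgHom k H : H →+* k).comp (Subring.center H).subtype)

lemma mem_centerAugmentation [HopfAlgebra k H] {z : Subring.center H} :
    z ∈ centerAugmentation k H ↔ Coalgebra.counit (R := k) (z : H) = 0 := Iff.rfl

lemma centerAugmentation_smul [HopfAlgebra k H] {M : Type*} [AddCommGroup M] [Module k M]
    [Module H M] [IsScalarTower k H M] (z : Subring.center H) :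
    ∃ c : k, ∃ y ∈ centerAugmentation k H, ∀ x : M, z • x = c • x + y • x := by
  refine ⟨Coalgebra.counit (R := k) (z : H),
    z - ⟨algebraMap k H (Coalgebra.counit (R := k) (z : H)),
      Subring.mem_center_iff.2 fun g ↦ (Algebra.commutes _ g).symm⟩, ?_, fun x ↦ ?_⟩
  · rw [mem_centerAugmentation]
    simp
  · have : (⟨algebraMap k H (Coalgebra.counit (R := k) (z : H)),
      Subring.mem_center_iff.2 fun g ↦ (Algebra.commutes _ g).symm⟩ : Subring.center H) • x =
        Coalgebra.counit (R := k) (z : H) • x := algebraMap_smul H _ x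
    rw [sub_smul, this, add_sub_cancel]

lemma isNoetherian_center_quotient [IsNoetherianRing H] [Module.Finite (Subring.center H) H]
    (J : Submodule H H) : IsNoetherian (Subring.center H) (H ⧸ J) := by
  have := isNoetherian_center (H := H)
  let f : H →ₗ[Subring.center H] H ⧸ J :=
    { toFun h := Submodule.Quotient.mk h
      map_add' _ _ := rfl
      map_smul' _ _ := rfl }
  exact isNoetherian_of_surjective f (LinearMap.range_eq_top.2 (Submodule.mkQ_surjective J))

theorem exists_regularChain_finrank_eq_one [HopfAlgebra k H]
    (hS : Function.Bijective (HopfAlgebra.antipode k : H →ₗ[k] H))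
    [IsNoetherianRing H] [Module.Finite (Subring.center H) H] :
    ∃ (xs : List (Subring.center H)) (J : Submodule H H), RegularChain xs ⊥ J ∧
      (∀ x ∈ xs, Coalgebra.counit (R := k) (x : H) = 0) ∧ (∀ a ∈ J, ∀ b, a * b ∈ J) ∧
      Module.finrank k (invariantElements k H (H ⧸ J)) = 1 := by
  obtain ⟨xs, J, hch, hxs, hJ, -, a₀, ha₀, hma₀⟩ :=
    exists_regularChain (Bialgebra.counitAlgHom k H)
  refine ⟨xs, J, hch, hxs, hJ, ?_⟩
  have hnoe (J : Submodule H H) := isNoetherian_center_quotient J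
  let m := centerAugmentation k H
  let I (n : ℕ) := centralSup J (m ^ n)
  have hI (n : ℕ) : (I n).IsTwoSided := isTwoSided_centralSup hJ _
  let Γ (n : ℕ) := annihilated k (I n) (H ⧸ J)
  have hΓ (n : ℕ) (a : H ⧸ J) : a ∈ Γ n ↔ ∀ z ∈ m ^ n, z • a = 0 :=
    mem_annihilated_centralSup hJ _ a
  have hfinP (n : ℕ) : Module.Finite k (H ⧸ I n) := by
    obtain ⟨F, hF, hF'⟩ := exists_fg_of_pow_smul_eq_bot (k := k) m
      centerAugmentation_smul n (⊤ : Submodule (Subring.center H) (H ⧸ I n)) (by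
        rw [eq_bot_iff, Submodule.smul_le]
        intro z hz x _
        obtain ⟨h, rfl⟩ := Submodule.Quotient.mk_surjective _ x
        exact (Submodule.Quotient.mk_eq_zero _).2 (coe_mul_mem_centralSup hz h))
    have : F = ⊤ := eq_top_iff.2 fun x _ ↦ hF' x trivial
    exact ⟨this ▸ hF⟩
  have hfinΓ (n : ℕ) : Module.Finite k (Γ n) := by
    obtain ⟨F, hF, hF'⟩ := exists_fg_of_pow_smul_eq_bot (k := k) m
      centerAugmentation_smul n
      (Submodule.torsionBySet (Subring.center H) (H ⧸ J) ((m ^ n : Ideal _) : Set _)) (by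
        rw [eq_bot_iff, Submodule.smul_le]
        intro z hz x hx
        exact (Submodule.mem_torsionBySet_iff _ _).1 hx ⟨z, hz⟩)
    have := Module.Finite.iff_fg.2 hF
    refine Submodule.finiteDimensional_of_le (S₂ := F) fun a ha ↦ hF' a ?_
    rw [Submodule.mem_torsionBySet_iff]
    exact fun z ↦ (hΓ n a).1 ha z.1 z.2
  have hmono {i j : ℕ} (h : i ≤ j) : Γ i ≤ Γ j := fun a ha ↦
    (hΓ j a).2 fun z hz ↦ (hΓ i a).1 ha z (Ideal.pow_le_pow_right h hz)
  have hVΓ : invariantElements k H (H ⧸ J) ≤ Γ 1 := fun a ha ↦ (hΓ 1 a).2 fun z hz ↦ by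
    rw [pow_one] at hz
    refine (ha (z : H)).trans ?_
    rw [mem_centerAugmentation.1 hz, zero_smul]
  have hfinV : Module.Finite k (invariantElements k H (H ⧸ J)) :=
    Submodule.finiteDimensional_of_le hVΓ
  have hrank (n : ℕ) (hn : 1 ≤ n) : Module.finrank k (Γ n) =
      Module.finrank k (H ⧸ I n) * Module.finrank k (invariantElements k H (H ⧸ J)) := by
    have hker : RingHom.ker (Ideal.Quotient.mkₐ k (I n)) = I n := Ideal.Quotient.mkₐ_ker k (I n)
    obtain ⟨e⟩ := nonempty_annihilated_equiv hS hxs hch (Ideal.Quotient.mkₐ k (I n))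
      Ideal.Quotient.mk_surjective fun x hx ↦ Ideal.Quotient.eq_zero_iff_mem.2
        (le_centralSup _ (hch.mem hx))
    rw [hker] at e
    rw [← Module.finrank_linearMap k k]
    exact e.finrank_eq
  have hne (n : ℕ) (hn : 1 ≤ n) : Module.finrank k (Γ n) ≠ 0 := by
    intro h0
    rw [Submodule.finrank_eq_zero] at h0
    have : (Submodule.Quotient.mk a₀ : H ⧸ J) ∈ Γ n := hmono hn ((hΓ 1 _).2 fun z hz ↦ by
      rw [pow_one] at hz
      exact (Submodule.Quotient.mk_eq_zero _).2 (hma₀ z hz))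
    rw [h0, Submodule.mem_bot, Submodule.Quotient.mk_eq_zero] at this
    exact ha₀ this
  obtain ⟨n, hn1, hn⟩ : ∃ n, 1 ≤ n ∧ Γ n = Γ (n + 1) := by
    obtain ⟨n, hn⟩ := monotone_stabilizes_iff_noetherian.2 (hnoe J)
      ⟨fun n ↦ Submodule.torsionBySet (Subring.center H) (H ⧸ J) ((m ^ n : Ideal _) : Set _),
        fun i j hij ↦ Submodule.torsionBySet_le_torsionBySet_of_subset
          (Ideal.pow_le_pow_right hij)⟩
    have hiff (i : ℕ) (a : H ⧸ J) : a ∈ Γ i ↔ a ∈ Submodule.torsionBySet (Subring.center H)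
        (H ⧸ J) ((m ^ i : Ideal _) : Set _) := by
      rw [hΓ, Submodule.mem_torsionBySet_iff]
      exact ⟨fun h z ↦ h z.1 z.2, fun h z hz ↦ h ⟨z, hz⟩⟩
    refine ⟨n + 1, by omega, Submodule.ext fun a ↦ ?_⟩
    rw [hiff, hiff]
    have h1 := hn (n + 1) (by omega)
    have h2 := hn (n + 1 + 1) (by omega)
    exact iff_of_eq (congrArg (a ∈ ·) (h1.symm.trans h2))
  have hV0 : Module.finrank k (invariantElements k H (H ⧸ J)) ≠ 0 := fun h ↦
    hne n hn1 (by rw [hrank n hn1, h, mul_zero])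
  have hII : I n ≤ I (n + 1) := by
    have hle : I (n + 1) ≤ I n := centralSup_mono (Ideal.pow_le_pow_right (Nat.le_succ n))
    let f : (H ⧸ I (n + 1)) →ₗ[k] (H ⧸ I n) := (Submodule.factor hle).restrictScalars k
    have hd : Module.finrank k (H ⧸ I (n + 1)) = Module.finrank k (H ⧸ I n) := by
      apply Nat.eq_of_mul_eq_mul_right (Nat.pos_of_ne_zero hV0)
      rw [← hrank n hn1, ← hrank (n + 1) (by omega), hn]
    have hf : Function.Injective f :=
      (LinearMap.injective_iff_surjective_of_finrank_eq_finrank hd).2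
        (Submodule.factor_surjective hle)
    intro h hh
    rw [← Submodule.Quotient.mk_eq_zero]
    apply hf
    rw [map_zero]
    exact (Submodule.Quotient.mk_eq_zero _).2 hh
  obtain ⟨r, hr, hr0⟩ := Submodule.exists_sub_one_mem_and_smul_eq_zero_of_fg_of_le_smul m
    (m ^ n • (⊤ : Submodule (Subring.center H) (H ⧸ J))) (IsNoetherian.noetherian _) (by
      rw [← Submodule.mul_smul, ← pow_succ']
      intro a ha
      obtain ⟨h, rfl⟩ := Submodule.Quotient.mk_surjective _ a
      exact hII ha)
  have hinj : ∀ a ∈ Γ n, a ∈ m ^ n • (⊤ : Submodule (Subring.center H) (H ⧸ J)) → a = 0 := by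
    intro a ha hma
    have h1 : ∀ i : ℕ, (1 - r) ^ i • a = a := by
      intro i
      induction i with
      | zero => rw [pow_zero, one_smul]
      | succ i ih => rw [pow_succ, mul_smul, sub_smul, one_smul, hr0 a hma, sub_zero, ih]
    rw [← h1 n]
    refine (hΓ n a).1 ha _ (Ideal.pow_mem_pow ?_ n)
    rw [← neg_sub]
    exact neg_mem hr
  have hle : Module.finrank k (Γ n) ≤ Module.finrank k (H ⧸ I n) := by
    let f : Γ n →ₗ[k] (H ⧸ I n) :=
      ((Submodule.factor (le_centralSup (J := J) (m ^ n))).restrictScalars k) ∘ₗ (Γ n).subtype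
    refine LinearMap.finrank_le_finrank_of_injective (f := f) ?_
    rw [injective_iff_map_eq_zero]
    rintro ⟨a, ha⟩ hfa
    apply Subtype.ext
    refine hinj a ha ?_
    obtain ⟨h, rfl⟩ := Submodule.Quotient.mk_surjective _ a
    exact (Submodule.Quotient.mk_eq_zero (I n)).1 hfa
  have hP0 : 0 < Module.finrank k (H ⧸ I n) := Nat.pos_of_ne_zero fun h ↦
    hne n hn1 (by rw [hrank n hn1, h, zero_mul])
  rw [hrank n hn1] at hle
  have := Nat.le_of_mul_le_mul_left (hle.trans_eq (mul_one _).symm) hP0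
  omega

end OneDimensional

section RightAction

open CategoryTheory CategoryTheory.Abelian TensorProduct

lemma exists_addEquiv_of_range_eq {E A X : Type*} [AddCommGroup E] [AddCommGroup A]
    [AddCommGroup X] (θ : E →+ X) (j : A →+ X) (hθ : Function.Injective θ)
    (hj : Function.Injective j) (h : ∀ x, x ∈ Set.range θ ↔ x ∈ Set.range j) :
    ∃ η : E ≃+ A, ∀ e, j (η e) = θ e := by
  choose f hf using fun e ↦ (h (θ e)).1 ⟨e, rfl⟩
  let F : E →+ A :=
    { toFun := f
      map_zero' := hj (by rw [hf, map_zero, map_zero])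
      map_add' a b := hj (by rw [hf, map_add, map_add, hf, hf]) }
  refine ⟨AddEquiv.ofBijective F ⟨fun a b hab ↦ hθ ?_, fun a ↦ ?_⟩, hf⟩
  · rw [← hf, ← hf]
    exact congrArg j hab
  · obtain ⟨e, he⟩ := (h (j a)).2 ⟨a, rfl⟩
    exact ⟨e, hj ((hf e).trans he)⟩

variable {k : Type u} [Field k]

lemma tmul_injective_of_ne_zero {T W : Type*} [AddCommGroup T] [Module k T] [AddCommGroup W]
    [Module k W] {t : T} (ht : t ≠ 0) : Function.Injective fun w : W ↦ t ⊗ₜ[k] w := by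
  obtain ⟨f, hf⟩ := LinearMap.exists_leftInverse_of_injective
    (LinearMap.toSpanSingleton k T t) (LinearMap.ker_toSpanSingleton k ht)
  have h1 : f t = 1 := by simpa using LinearMap.congr_fun hf 1
  intro w w' h
  have := congrArg (fun x ↦ TensorProduct.lid k W (f.rTensor W x)) h
  simpa [h1] using this

variable {H : Type v} [Ring H] [HopfAlgebra k H]

lemma invariant_tmul_iff {T W : Type*} [AddCommGroup T] [Module k T] [Module H T]
    [IsScalarTower k H T] [AddCommGroup W] [Module k W] {t : T}
    (ht : ∀ x : T, (∀ h : H, h • x = Coalgebra.counit (R := k) h • x) ↔ ∃ c : k, x = c • t)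
    (y : T ⊗[k] W) :
    (∀ h : H, h • y = Coalgebra.counit (R := k) h • y) ↔ ∃ w, y = t ⊗ₜ w := by
  constructor
  · intro hy
    classical
    let b := Module.Basis.ofVectorSpace k W
    let e := TensorProduct.equivFinsuppOfBasisRight (M := T) b
    have he (h : H) (z : T ⊗[k] W) (i) : e (h • z) i = h • e z i := by
      induction z with
      | zero => simp
      | add x y hx hy => simp only [smul_add, map_add, Finsupp.add_apply, hx, hy]
      | tmul x w =>
        rw [smul_tmul']
        simp only [e, TensorProduct.equivFinsuppOfBasisRight_apply_tmul_apply]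
        exact smul_comm _ _ _
    have h1 (i) : ∃ c : k, e y i = c • t := (ht _).1 fun h ↦ by
      rw [← he, hy, map_smul, Finsupp.smul_apply]
    choose c hc using h1
    refine ⟨∑ i ∈ (e y).support, c i • b i, ?_⟩
    refine (e.symm_apply_apply y).symm.trans
      ((TensorProduct.equivFinsuppOfBasisRight_symm_apply b (e y)).trans ?_)
    rw [tmul_sum]
    exact Finset.sum_congr rfl fun i _ ↦ (congrArg (· ⊗ₜ b i) (hc i)).trans (smul_tmul _ _ _)
  · rintro ⟨w, rfl⟩ h
    rw [smul_tmul', smul_tmul', (ht t).2 ⟨1, (one_smul _ _).symm⟩]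

end RightAction

section ExtBimodule

open CategoryTheory CategoryTheory.Abelian TensorProduct

variable {k : Type u} [Field k] {H A B : Type v} [Ring H] [HopfAlgebra k H] [Ring A] [Algebra k A]
  [Ring B] [Algebra k B]

/-- The linear map `h ↦ χ(h₁) ψ(S(h₂))`. -/
noncomputable def windMap (ψ : H →ₐ[k] A) (χ : H →ₐ[k] k) : H →ₗ[k] A :=
  LinearMap.mul' k A ∘ₗ TensorProduct.map (Algebra.linearMap k A ∘ₗ χ.toLinearMap)
    (ψ.toLinearMap ∘ₗ HopfAlgebra.antipode k) ∘ₗ Coalgebra.comul (R := k) (A := H)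

lemma outerAct_eq_mul (b x : H ⊗[k] A) : outerAct H A b x = b * x := by
  induction b with
  | zero => simp
  | add b c hb hc => simp only [map_add, add_mul, LinearMap.add_apply, hb, hc]
  | tmul h a =>
    induction x with
    | zero => simp
    | add b c hb hc => simp only [map_add, mul_add, hb, hc]
    | tmul m w => simp

lemma leftTwist_mul_one_tmul (ψ : H →ₐ[k] A) (a : H) (y β : A) :
    leftTwist ψ A (a ⊗ₜ y) * 1 ⊗ₜ β = leftTwist ψ A (a ⊗ₜ (y * β)) := by
  rw [leftTwist_tmul, leftTwist_tmul]
  generalize Coalgebra.comul (R := k) a = s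
  induction s with
  | zero => simp
  | add x y hx hy => simp only [map_add, add_mul, hx, hy]
  | tmul b c => simp [mul_assoc]

lemma leftTwist_tmul_eq_mul (ψ : H →ₐ[k] A) (a : H) (y : A) :
    leftTwist ψ A (a ⊗ₜ y) = comulTwist ψ a * 1 ⊗ₜ y := by
  have h := leftTwist_mul_tmul ψ a 1 y
  rw [mul_one, outerAct_eq_mul] at h
  rw [h, leftTwist_tmul]
  simp [Bialgebra.comul_one, Algebra.TensorProduct.one_def]

lemma leftTwist_mul_tmul_one (ψ : H →ₐ[k] A) (a α : H) (y : A) :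
    leftTwist ψ A (a ⊗ₜ y) * α ⊗ₜ 1 =
      leftTwist ψ A ((LinearMap.mulLeft k a).rTensor A ((leftTwist ψ A).symm (α ⊗ₜ y))) := by
  have h (z : H ⊗[k] A) : leftTwist ψ A ((LinearMap.mulLeft k a).rTensor A z) =
      comulTwist ψ a * leftTwist ψ A z := by
    induction z with
    | zero => simp
    | add x y hx hy => simp only [map_add, mul_add, hx, hy]
    | tmul b w =>
      rw [LinearMap.rTensor_tmul, LinearMap.mulLeft_apply, leftTwist_mul_tmul, outerAct_eq_mul]
  rw [h, LinearEquiv.apply_symm_apply, leftTwist_tmul_eq_mul, mul_assoc]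
  simp

lemma leftTwist_symm_tmul (ψ : H →ₐ[k] A) (a : H) (y : A) :
    (leftTwist ψ A).symm (a ⊗ₜ y) =
      (((((Algebra.lsmul k k A).comp ψ).toLinearMap ∘ₗ HopfAlgebra.antipode k).flip y).lTensor H)
        (Coalgebra.comul (R := k) a) := hopfTwist_tmul _ a y

/-- The right multiplication pairing on the quotient by a two-sided ideal. -/
def quotientMulRightₗ {J : Submodule H H} (hJ : ∀ a ∈ J, ∀ b, a * b ∈ J) :
    (H ⧸ J) →ₗ[k] H →ₗ[k] (H ⧸ J) :=
  LinearMap.mk₂ k (fun x h ↦ quotientMulRight hJ (Submodule.Quotient.mk h) x)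
    (fun x y h ↦ map_add _ x y) (fun c x h ↦ LinearMap.map_smul_of_tower _ c x)
    (fun x h h' ↦ by
      obtain ⟨a, rfl⟩ := Submodule.Quotient.mk_surjective _ x
      simp only [quotientMulRight_mk, Submodule.Quotient.mk_add, smul_add])
    (fun c x h ↦ by
      obtain ⟨a, rfl⟩ := Submodule.Quotient.mk_surjective _ x
      simp only [quotientMulRight_mk, Submodule.Quotient.mk_smul]
      exact smul_comm _ _ _)

lemma exists_tensor_quotientMulRight (ψ : H →ₐ[k] A) (τ : H ⊗[k] A ≃ₐ[k] B)
    {J : Submodule H H} (hJ : ∀ a ∈ J, ∀ b, a * b ∈ J) {t : H ⧸ J} (χ : H →ₐ[k] k)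
    (hχ : ∀ h : H, quotientMulRight hJ (Submodule.Quotient.mk h) t = χ h • t) (α : H) :
    ∃ g : (H ⧸ J) ⊗[k] A →ₗ[k] (H ⧸ J) ⊗[k] A,
      (∀ x, chainProj ((leftTwist ψ A).toAddEquiv.trans τ.toAddEquiv) J (x * τ (α ⊗ₜ 1)) =
        g (chainProj ((leftTwist ψ A).toAddEquiv.trans τ.toAddEquiv) J x)) ∧
      ∀ y, g (t ⊗ₜ y) = t ⊗ₜ (windMap ψ χ α * y) := by
  let R := quotientMulRightₗ (k := k) hJ
  let g : (H ⧸ J) ⊗[k] A →ₗ[k] (H ⧸ J) ⊗[k] A := TensorProduct.lift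
    (LinearMap.mk₂ k (fun x y ↦ (R x).rTensor A ((leftTwist ψ A).symm (α ⊗ₜ y)))
      (fun x x' y ↦ by rw [map_add, LinearMap.rTensor_add, LinearMap.add_apply])
      (fun c x y ↦ by rw [map_smul, LinearMap.rTensor_smul, LinearMap.smul_apply])
      (fun x y y' ↦ by rw [tmul_add, map_add, map_add])
      (fun c x y ↦ by rw [tmul_smul, map_smul, map_smul]))
  have hg (x y) : g (x ⊗ₜ y) = (R x).rTensor A ((leftTwist ψ A).symm (α ⊗ₜ y)) := rfl
  have hΨ (z) : ((leftTwist ψ A).toAddEquiv.trans τ.toAddEquiv) z = τ (leftTwist ψ A z) := rfl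
  refine ⟨g, fun x ↦ ?_, fun y ↦ ?_⟩
  · obtain ⟨x, rfl⟩ := ((leftTwist ψ A).toAddEquiv.trans τ.toAddEquiv).surjective x
    induction x with
    | zero => simp
    | add x y hx hy => simp only [map_add, add_mul, hx, hy]
    | tmul a y =>
      rw [chainProj_apply, hg]
      rw [hΨ, ← map_mul, leftTwist_mul_tmul_one, ← hΨ]
      generalize (leftTwist ψ A).symm (α ⊗ₜ y) = z
      induction z with
      | zero => simp only [map_zero]
      | add x y hx hy => simp only [map_add, hx, hy]
      | tmul b w =>
        rw [LinearMap.rTensor_tmul, chainProj_apply, LinearMap.rTensor_tmul]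
        rfl
  · rw [hg, leftTwist_symm_tmul]
    have hR (h : H) : R t h = χ h • t := hχ h
    change _ = t ⊗ₜ[k] (LinearMap.mul' k A
      (TensorProduct.map (Algebra.linearMap k A ∘ₗ χ.toLinearMap)
        (ψ.toLinearMap ∘ₗ HopfAlgebra.antipode k) (Coalgebra.comul (R := k) α)) * y)
    generalize Coalgebra.comul (R := k) α = s
    induction s with
    | zero => simp only [map_zero, zero_mul, tmul_zero]
    | add x y hx hy => simp only [map_add, add_mul, tmul_add, hx, hy]
    | tmul b c =>
      rw [LinearMap.lTensor_tmul, LinearMap.rTensor_tmul, hR, smul_tmul]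
      congr 1
      simp [Algebra.smul_def, mul_assoc]

/-- The bimodule structure on the top `Ext` group of the regular module. -/
theorem exists_ext_bimodule (hS : Function.Bijective (HopfAlgebra.antipode k : H →ₗ[k] H))
    (ψ : H →ₐ[k] A) (τ : H ⊗[k] A ≃ₐ[k] B)
    {L : Type v} [AddCommGroup L] [Module B L] {ℓ : L}
    (hℓ : IsUniversalInvariant (τ.toAlgHom.comp (comulTwist ψ)) (Bialgebra.counitAlgHom k H) ℓ)
    {xs : List (Subring.center H)} (hxs : ∀ x ∈ xs, Coalgebra.counit (R := k) (x : H) = 0)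
    {J : Submodule H H} (hJ : RegularChain xs ⊥ J) (hJ2 : ∀ a ∈ J, ∀ b, a * b ∈ J)
    {t : H ⧸ J} (ht0 : t ≠ 0)
    (ht : ∀ x : H ⧸ J, (∀ h : H, h • x = Coalgebra.counit (R := k) h • x) ↔ ∃ c : k, x = c • t)
    (χ : H →ₐ[k] k)
    (hχ : ∀ h : H, quotientMulRight hJ2 (Submodule.Quotient.mk h) t = χ h • t) :
    ∃ η : Ext (ModuleCat.of B L) (ModuleCat.of B B) xs.length ≃+ A,
      (∀ e β, η (e.comp (Ext.mk₀ (ModuleCat.ofHom (LinearMap.toSpanSingleton B B (τ (1 ⊗ₜ β)))))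
        (add_zero _)) = η e * β) ∧
      ∀ e α, η (e.comp (Ext.mk₀ (ModuleCat.ofHom (LinearMap.toSpanSingleton B B (τ (α ⊗ₜ 1)))))
        (add_zero _)) = windMap ψ χ α * η e := by
  let Ψ : H ⊗[k] A ≃+ B := (leftTwist ψ A).toAddEquiv.trans τ.toAddEquiv
  have hΨ' (z) : Ψ z = τ (leftTwist ψ A z) := rfl
  obtain ⟨θ, hθ, hrange, hcomp⟩ := exists_ext_invariants (τ.toAlgHom.comp (comulTwist ψ))
    ((rightTwist hS ψ).trans τ.toLinearEquiv)
    (fun h h' w ↦ by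
      change τ (rightTwist hS ψ _) = τ (rightTwist hS ψ _) * τ (comulTwist ψ h')
      rw [rightTwist_mul_tmul, map_mul])
    (Bialgebra.counitAlgHom k H) hℓ hxs hJ Ψ
    (fun h h' w ↦ by
      change τ (leftTwist ψ A _) = τ (comulTwist ψ h) * τ (leftTwist ψ A _)
      rw [leftTwist_mul_tmul, outerAct_eq_mul, map_mul])
  have hj := tmul_injective_of_ne_zero (k := k) (W := A) ht0
  obtain ⟨η, hη⟩ := exists_addEquiv_of_range_eq θ
    (TensorProduct.mk k (H ⧸ J) A t).toAddMonoidHom hθ hj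
    (fun y ↦ (hrange y).trans ((invariant_tmul_iff ht y).trans
      ⟨fun ⟨w, hw⟩ ↦ ⟨w, hw.symm⟩, fun ⟨w, hw⟩ ↦ ⟨w, hw.symm⟩⟩))
  have hη' (e) : t ⊗ₜ[k] η e = θ e := hη e
  refine ⟨η, fun e β ↦ hj ?_, fun e α ↦ hj ?_⟩
  · change t ⊗ₜ[k] η _ = t ⊗ₜ[k] (η e * β)
    refine (hη' _).trans ((hcomp _
      ((LinearMap.mulRight k β).lTensor (H ⧸ J)).toAddMonoidHom (fun x ↦ ?_) e).trans ?_)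
    · obtain ⟨x, rfl⟩ := Ψ.surjective x
      induction x with
      | zero => simp
      | add x y hx hy => simp only [map_add, hx, hy]
      | tmul a y =>
        rw [chainProj_apply, LinearMap.toSpanSingleton_apply, smul_eq_mul, hΨ', ← map_mul,
          leftTwist_mul_one_tmul, ← hΨ', chainProj_apply]
        rfl
    · rw [← hη']
      rfl
  · obtain ⟨g, hg, hg'⟩ := exists_tensor_quotientMulRight ψ τ hJ2 χ hχ α
    change t ⊗ₜ[k] η _ = t ⊗ₜ[k] (windMap ψ χ α * η e)
    refine (hη' _).trans ((hcomp _ g.toAddMonoidHom (fun x ↦ ?_) e).trans ?_)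
    · rw [LinearMap.toSpanSingleton_apply, smul_eq_mul]
      exact hg x
    · rw [← hη', ← hg']
      rfl

end ExtBimodule

section Character

variable {k H : Type*} [Field k] [Ring H] [HopfAlgebra k H]

lemma exists_character {J : Submodule H H} (hJ : ∀ a ∈ J, ∀ b, a * b ∈ J)
    (h : Module.finrank k (invariantElements k H (H ⧸ J)) = 1) :
    ∃ t : H ⧸ J, t ≠ 0 ∧
      (∀ x : H ⧸ J, (∀ h : H, h • x = Coalgebra.counit (R := k) h • x) ↔ ∃ c : k, x = c • t) ∧
      ∃ χ : H →ₐ[k] k, ∀ h : H, quotientMulRight hJ (Submodule.Quotient.mk h) t = χ h • t := by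
  obtain ⟨⟨t, ht⟩, ht0, hspan⟩ := finrank_eq_one_iff'.1 h
  have ht0' : t ≠ 0 := fun h0 ↦ ht0 (Subtype.ext h0)
  have hinv (x : H ⧸ J) :
      (∀ h : H, h • x = Coalgebra.counit (R := k) h • x) ↔ ∃ c : k, x = c • t := by
    refine ⟨fun hx ↦ ?_, ?_⟩
    · obtain ⟨c, hc⟩ := hspan ⟨x, hx⟩
      exact ⟨c, (congrArg Subtype.val hc).symm⟩
    · rintro ⟨c, rfl⟩
      exact (invariantElements k H (H ⧸ J)).smul_mem c ht
  have hex (h : H) : ∃ c : k, quotientMulRight hJ (Submodule.Quotient.mk h) t = c • t :=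
    (hinv _).1 fun h' ↦ by
      rw [← map_smul, (hinv t).2 ⟨1, (one_smul _ _).symm⟩, LinearMap.map_smul_of_tower]
  choose χ hχ using hex
  have hχ' (h : H) : quotientMulRightₗ (k := k) hJ t h = χ h • t := hχ h
  have hcancel {a b : k} (hab : a • t = b • t) : a = b := smul_left_injective k ht0' hab
  let χₗ : H →ₗ[k] k :=
    { toFun := χ
      map_add' a b := hcancel (by rw [← hχ', map_add, hχ', hχ', add_smul])
      map_smul' c a := hcancel (by rw [← hχ', map_smul, hχ', smul_smul]; rfl) }
  refine ⟨t, ht0', hinv, AlgHom.ofLinearMap χₗ (hcancel ?_) fun a b ↦ hcancel ?_, hχ⟩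
  · refine (hχ 1).symm.trans ?_
    obtain ⟨a, rfl⟩ := Submodule.Quotient.mk_surjective _ t
    rw [quotientMulRight_mk, ← Submodule.Quotient.mk_smul, smul_eq_mul, mul_one, one_smul]
  · refine (hχ (a * b)).symm.trans ?_
    have hmul (x : H ⧸ J) : quotientMulRight hJ (Submodule.Quotient.mk (a * b)) x =
        quotientMulRight hJ (Submodule.Quotient.mk b)
          (quotientMulRight hJ (Submodule.Quotient.mk a) x) := by
      obtain ⟨c, rfl⟩ := Submodule.Quotient.mk_surjective _ x
      simp only [quotientMulRight_mk, ← Submodule.Quotient.mk_smul, smul_eq_mul, mul_assoc]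
    rw [hmul, hχ, LinearMap.map_smul_of_tower, hχ, smul_smul]
    rfl

end Character

section Winding

open TensorProduct MulOpposite

variable (k H : Type*) [Field k] [Ring H] [HopfAlgebra k H]

/-- The square of the antipode, as an algebra map. -/
noncomputable def antipodeSq : H →ₐ[k] H :=
  AlgHom.ofLinearMap (HopfAlgebra.antipode k ∘ₗ HopfAlgebra.antipode k)
    (by simp [HopfAlgebra.antipode_one])
    (fun a b ↦ by simp [HopfAlgebra.antipode_mul_antidistrib])

variable {k H}

lemma antipodeSq_apply (h : H) :
    antipodeSq k H h = HopfAlgebra.antipode k (HopfAlgebra.antipode k h) := rfl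

/-- The left winding endomorphism `h ↦ χ(h₁) h₂`. -/
noncomputable def winding (χ : H →ₐ[k] k) : H →ₐ[k] H :=
  (Algebra.TensorProduct.lid k H).toAlgHom.comp
    ((Algebra.TensorProduct.map χ (AlgHom.id k H)).comp (Bialgebra.comulAlgHom k H))

lemma winding_apply (χ : H →ₐ[k] k) (h : H) :
    winding χ h = TensorProduct.lid k H (χ.toLinearMap.rTensor H (Coalgebra.comul (R := k) h)) := by
  change Algebra.TensorProduct.lid k H (Algebra.TensorProduct.map χ (AlgHom.id k H)
    (Coalgebra.comul h)) = _
  generalize Coalgebra.comul (R := k) h = s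
  induction s with
  | zero => simp
  | add x y hx hy => simp only [map_add, hx, hy]
  | tmul b c => simp

end Winding

section OppositeSide

open TensorProduct MulOpposite

variable {k : Type u} {H : Type v} [Field k] [Ring H] [HopfAlgebra k H]

lemma windMap_eq {A : Type v} [Ring A] [Algebra k A] (ψ : H →ₐ[k] A) (χ : H →ₐ[k] k) (h : H) :
    windMap ψ χ h = ψ (HopfAlgebra.antipode k (winding χ h)) := by
  rw [winding_apply]
  change LinearMap.mul' k A (TensorProduct.map _ _ (Coalgebra.comul (R := k) h)) = _
  generalize Coalgebra.comul (R := k) h = s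
  induction s with
  | zero => simp
  | add x y hx hy => simp only [map_add, hx, hy]
  | tmul b c => simp [← Algebra.smul_def]

/-- The isomorphism `a ⊗ b ↦ b ⊗ S(a)`. -/
noncomputable def swapAntipode (hS : Function.Bijective (HopfAlgebra.antipode k : H →ₗ[k] H)) :
    H ⊗[k] H ≃ₐ[k] H ⊗[k] Hᵐᵒᵖ :=
  (Algebra.TensorProduct.comm k H H).trans (Algebra.TensorProduct.congr AlgEquiv.refl
    (AlgEquiv.ofBijective (HopfAlgebra.antipodeAlgHomOp (R := k) (A := H))
      (opEquiv.bijective.comp hS)))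

lemma swapAntipode_tmul (hS : Function.Bijective (HopfAlgebra.antipode k : H →ₗ[k] H)) (a b : H) :
    swapAntipode hS (a ⊗ₜ b) = b ⊗ₜ op (HopfAlgebra.antipode k a) := rfl

/-- The map `a ⊗ b ↦ S²(b) ⊗ S(a)`. -/
noncomputable def antipodeSqSwap : H ⊗[k] H →ₗ[k] H ⊗[k] Hᵐᵒᵖ :=
  TensorProduct.map (antipodeSq k H).toLinearMap
    ((opLinearEquiv k).toLinearMap ∘ₗ HopfAlgebra.antipode k) ∘ₗ
    (TensorProduct.comm k H H).toLinearMap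

lemma antipodeSqSwap_tmul (a b : H) : antipodeSqSwap (k := k) (a ⊗ₜ b) =
    antipodeSq k H b ⊗ₜ op (HopfAlgebra.antipode k a) := rfl

lemma swapAntipode_comulTwist (hS : Function.Bijective (HopfAlgebra.antipode k : H →ₗ[k] H))
    (h : H) : swapAntipode hS (comulTwist (antipodeSq k H) h) =
      antipodeSqSwap (Coalgebra.comul (R := k) h) := by
  change swapAntipode hS (Algebra.TensorProduct.map (AlgHom.id k H) (antipodeSq k H)
    (Coalgebra.comul h)) = _
  generalize Coalgebra.comul (R := k) h = s
  induction s with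
  | zero => simp
  | add x y hx hy => simp only [map_add, hx, hy]
  | tmul b c =>
    rw [Algebra.TensorProduct.map_tmul, swapAntipode_tmul, antipodeSqSwap_tmul]
    rfl

lemma sum_op_mul_antipodeSqSwap (h : H) :
    LinearMap.mul' k (H ⊗[k] Hᵐᵒᵖ) (TensorProduct.map
      ((TensorProduct.mk k H Hᵐᵒᵖ 1) ∘ₗ (opLinearEquiv k).toLinearMap ∘ₗ
        (antipodeSq k H).toLinearMap)
      (antipodeSqSwap ∘ₗ Coalgebra.comul (R := k) (A := H)) (Coalgebra.comul (R := k) h)) =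
      antipodeSq k H h ⊗ₜ 1 := by
  let g : H ⊗[k] H →ₗ[k] Hᵐᵒᵖ := (opLinearEquiv k).toLinearMap ∘ₗ HopfAlgebra.antipode k ∘ₗ
    LinearMap.mul' k H ∘ₗ (HopfAlgebra.antipode k).rTensor H
  let G : (H ⊗[k] H) ⊗[k] H →ₗ[k] H ⊗[k] Hᵐᵒᵖ :=
    (TensorProduct.comm k Hᵐᵒᵖ H).toLinearMap ∘ₗ TensorProduct.map g (antipodeSq k H).toLinearMap
  have h1 (s : H ⊗[k] H) : LinearMap.mul' k (H ⊗[k] Hᵐᵒᵖ) (TensorProduct.map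
      ((TensorProduct.mk k H Hᵐᵒᵖ 1) ∘ₗ (opLinearEquiv k).toLinearMap ∘ₗ
        (antipodeSq k H).toLinearMap)
      (antipodeSqSwap ∘ₗ Coalgebra.comul (R := k) (A := H)) s) =
      G ((TensorProduct.assoc k H H H).symm
        ((Coalgebra.comul (R := k) (A := H)).lTensor H s)) := by
    induction s with
    | zero => simp
    | add x y hx hy => simp only [map_add, hx, hy]
    | tmul b c =>
      rw [TensorProduct.map_tmul, LinearMap.mul'_apply, LinearMap.lTensor_tmul,
        LinearMap.comp_apply (antipodeSqSwap)]
      generalize Coalgebra.comul (R := k) c = s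
      induction s with
      | zero => simp
      | add x y hx hy => simp only [map_add, tmul_add, mul_add, hx, hy]
      | tmul c d =>
        simp [G, g, antipodeSqSwap_tmul, antipodeSq_apply, HopfAlgebra.antipode_mul_antidistrib]
  have h2 : g ∘ₗ Coalgebra.comul (R := k) (A := H) =
      (LinearMap.toSpanSingleton k Hᵐᵒᵖ 1) ∘ₗ Coalgebra.counit (R := k) (A := H) := by
    ext b
    change op (HopfAlgebra.antipode k (LinearMap.mul' k H ((HopfAlgebra.antipode k).rTensor H
      (Coalgebra.comul b)))) = _
    rw [HopfAlgebra.mul_antipode_rTensor_comul_apply]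
    simp [Algebra.algebraMap_eq_smul_one, HopfAlgebra.antipode_one]
  have h3 (s : H ⊗[k] H) : G ((Coalgebra.comul (R := k) (A := H)).rTensor H s) =
      antipodeSq k H (TensorProduct.lid k H ((Coalgebra.counit (R := k) (A := H)).rTensor H s))
        ⊗ₜ 1 := by
    induction s with
    | zero => simp
    | add x y hx hy => simp only [map_add, add_tmul, hx, hy]
    | tmul b c =>
      have := LinearMap.congr_fun h2 b
      simp only [LinearMap.comp_apply, LinearMap.toSpanSingleton_apply] at this
      simp [G, this, smul_tmul]
  rw [h1, Coalgebra.coassoc_symm_apply, h3, Coalgebra.rTensor_counit_comul]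
  simp

lemma antipodeSqSwap_comul_invariant_iff
    (hS : Function.Bijective (HopfAlgebra.antipode k : H →ₗ[k] H)) {X : Type*} [AddCommGroup X]
    [Module (H ⊗[k] Hᵐᵒᵖ) X] (ξ : X) :
    (∀ h : H, antipodeSqSwap (Coalgebra.comul (R := k) h) • ξ =
      algebraMap k (H ⊗[k] Hᵐᵒᵖ) (Bialgebra.counitAlgHom k H h) • ξ) ↔
    ∀ h : H, (h ⊗ₜ[k] (1 : Hᵐᵒᵖ)) • ξ = ((1 : H) ⊗ₜ[k] op h) • ξ := by
  let _ : Module k X := Module.compHom X (algebraMap k (H ⊗[k] Hᵐᵒᵖ))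
  have : IsScalarTower k (H ⊗[k] Hᵐᵒᵖ) X := ⟨fun c b m ↦
    (congrArg (· • m) (Algebra.smul_def c b)).trans (mul_smul _ b m)⟩
  have halg (c : k) (x : X) : algebraMap k (H ⊗[k] Hᵐᵒᵖ) c • x = c • x := rfl
  let ev : (H ⊗[k] Hᵐᵒᵖ) →ₗ[k] X := (LinearMap.toSpanSingleton (H ⊗[k] Hᵐᵒᵖ) X ξ).restrictScalars k
  have hev (b) : ev b = b • ξ := rfl
  constructor
  · intro hξ h
    obtain ⟨h, rfl⟩ := (hS.comp hS).2 h
    change (antipodeSq k H h ⊗ₜ[k] (1 : Hᵐᵒᵖ)) • ξ = ((1 : H) ⊗ₜ[k] op (antipodeSq k H h)) • ξ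
    rw [← sum_op_mul_antipodeSqSwap]
    have h1 (s : H ⊗[k] H) : LinearMap.mul' k (H ⊗[k] Hᵐᵒᵖ) (TensorProduct.map
      ((TensorProduct.mk k H Hᵐᵒᵖ 1) ∘ₗ (opLinearEquiv k).toLinearMap ∘ₗ
        (antipodeSq k H).toLinearMap)
      (antipodeSqSwap ∘ₗ Coalgebra.comul (R := k) (A := H)) s) • ξ =
      (ev ∘ₗ (TensorProduct.mk k H Hᵐᵒᵖ 1) ∘ₗ (opLinearEquiv k).toLinearMap ∘ₗ
        (antipodeSq k H).toLinearMap)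
        (TensorProduct.rid k H ((Coalgebra.counit (R := k) (A := H)).lTensor H s)) := by
      induction s with
      | zero => simp only [map_zero]; exact zero_smul (H ⊗[k] Hᵐᵒᵖ) ξ
      | add x y hx hy => simp only [map_add, add_smul, hx, hy]
      | tmul b c =>
        rw [TensorProduct.map_tmul, LinearMap.mul'_apply, mul_smul,
          LinearMap.comp_apply (antipodeSqSwap), hξ, LinearMap.lTensor_tmul, rid_tmul, map_smul,
          halg, smul_comm]
        rfl
    rw [h1, Coalgebra.lTensor_counit_comul, rid_tmul, one_smul]
    rfl
  · intro hξ h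
    have h1 (s : H ⊗[k] H) : antipodeSqSwap s • ξ =
        (ev ∘ₗ (TensorProduct.mk k H Hᵐᵒᵖ 1) ∘ₗ (opLinearEquiv k).toLinearMap ∘ₗ
          HopfAlgebra.antipode k) (LinearMap.mul' k H ((HopfAlgebra.antipode k).lTensor H s)) := by
      induction s with
      | zero => simp only [map_zero]; exact zero_smul (H ⊗[k] Hᵐᵒᵖ) ξ
      | add x y hx hy => simp only [map_add, add_smul, hx, hy]
      | tmul b c =>
        have : (antipodeSq k H c ⊗ₜ[k] op (HopfAlgebra.antipode k b)) =
          ((1 : H) ⊗ₜ[k] op (HopfAlgebra.antipode k b)) *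
            (antipodeSq k H c ⊗ₜ[k] (1 : Hᵐᵒᵖ)) := by simp
        rw [antipodeSqSwap_tmul, this, mul_smul, hξ, ← mul_smul, LinearMap.lTensor_tmul,
          LinearMap.mul'_apply]
        simp [hev, ← op_mul, HopfAlgebra.antipode_mul_antidistrib, antipodeSq_apply]
    rw [h1, HopfAlgebra.mul_antipode_lTensor_comul_apply]
    change ((1 : H) ⊗ₜ[k] op (HopfAlgebra.antipode k (algebraMap k H _))) • ξ = _
    congr 1
    rw [Algebra.algebraMap_eq_smul_one, Algebra.algebraMap_eq_smul_one, map_smul,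
      HopfAlgebra.antipode_one, op_smul, tmul_smul]
    rfl

theorem isUniversalInvariant_swapAntipode
    (hS : Function.Bijective (HopfAlgebra.antipode k : H →ₗ[k] H)) :
    IsUniversalInvariant ((swapAntipode hS).toAlgHom.comp (comulTwist (antipodeSq k H)))
      (Bialgebra.counitAlgHom k H) (toAlgBimodule (AlgHom.id k H) 1) := by
  have hU := isUniversalInvariant_algBimodule (AlgHom.id k H)
  have hiff {X : Type v} [AddCommGroup X] [Module (H ⊗[k] Hᵐᵒᵖ) X] (ξ : X) :
      (∀ h, ((swapAntipode hS).toAlgHom.comp (comulTwist (antipodeSq k H))) h • ξ =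
        algebraMap k (H ⊗[k] Hᵐᵒᵖ) (Bialgebra.counitAlgHom k H h) • ξ) ↔
      (∀ h, comulTwist (opAntipode (AlgHom.id k H)) h • ξ =
        algebraMap k (H ⊗[k] Hᵐᵒᵖ) (Bialgebra.counitAlgHom k H h) • ξ) := by
    refine Iff.trans ?_ (comulTwist_opAntipode_invariant_iff (AlgHom.id k H) ξ).symm
    refine Iff.trans ?_ (antipodeSqSwap_comul_invariant_iff hS ξ)
    refine forall_congr' fun h ↦ ?_
    rw [← swapAntipode_comulTwist hS]
    rfl
  exact
    { smul_eq := (hiff _).2 hU.smul_eq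
      exists_hom X _ _ ξ hξ := hU.exists_hom X ξ ((hiff ξ).1 hξ)
      hom_ext := hU.hom_ext }

end OppositeSide

section NakayamaAutomorphism

open CategoryTheory CategoryTheory.Abelian TensorProduct MulOpposite

variable {k : Type u} {H : Type v} [Field k] [Ring H] [HopfAlgebra k H]

/-- The algebra map `h ↦ χ(h₁) S²(h₂)`. -/
noncomputable def nakayama (χ : H →ₐ[k] k) : H →ₐ[k] H := (antipodeSq k H).comp (winding χ)

/-- Central elements act equally on the two sides of `Ext` groups out of the regular bimodule. -/
lemma ext_comp_tmul_one_of_mem_center {z : H} (hz : z ∈ Subring.center H) {n : ℕ}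
    (e : Ext (ModuleCat.of (H ⊗[k] Hᵐᵒᵖ) (AlgBimodule (AlgHom.id k H)))
      (ModuleCat.of (H ⊗[k] Hᵐᵒᵖ) (H ⊗[k] Hᵐᵒᵖ)) n) :
    e.comp (Ext.mk₀ (ModuleCat.ofHom (LinearMap.toSpanSingleton (H ⊗[k] Hᵐᵒᵖ) (H ⊗[k] Hᵐᵒᵖ)
      (z ⊗ₜ 1)))) (add_zero n) =
    e.comp (Ext.mk₀ (ModuleCat.ofHom (LinearMap.toSpanSingleton (H ⊗[k] Hᵐᵒᵖ) (H ⊗[k] Hᵐᵒᵖ)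
      (1 ⊗ₜ op z)))) (add_zero n) := by
  have hz' (h : H) : h * z = z * h := Subring.mem_center_iff.1 hz h
  let c : H ⊗[k] Hᵐᵒᵖ := z ⊗ₜ 1 - 1 ⊗ₜ op z
  have hc : c ∈ Subring.center (H ⊗[k] Hᵐᵒᵖ) := by
    rw [Subring.mem_center_iff]
    intro b
    induction b with
    | zero => simp
    | add x y hx hy => rw [add_mul, mul_add, hx, hy]
    | tmul a p =>
      obtain ⟨p, rfl⟩ := op_surjective p
      simp [c, mul_sub, sub_mul, hz', ← op_mul]
  have h0 : (centralEnd (⟨c, hc⟩ : Subring.center (H ⊗[k] Hᵐᵒᵖ))).app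
      (ModuleCat.of (H ⊗[k] Hᵐᵒᵖ) (AlgBimodule (AlgHom.id k H))) = 0 := by
    refine centralEnd_app_eq_zero _ _ fun m ↦ ?_
    obtain ⟨x, rfl⟩ := (toAlgBimodule (AlgHom.id k H)).surjective m
    refine (sub_smul _ _ _).trans (sub_eq_zero.2 ?_)
    refine (tmul_smul_toAlgBimodule (AlgHom.id k H) z 1 x).trans
      (Eq.trans ?_ (tmul_smul_toAlgBimodule (AlgHom.id k H) 1 z x).symm)
    rw [AlgHom.id_apply, AlgHom.id_apply, mul_one, one_mul, hz']
  have h1 := ext_comp_mk₀_natEndo (centralEnd (⟨c, hc⟩ : Subring.center (H ⊗[k] Hᵐᵒᵖ))) n e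
  rw [h0, Ext.mk₀_zero, Ext.zero_comp] at h1
  let f : ModuleCat.of (H ⊗[k] Hᵐᵒᵖ) (H ⊗[k] Hᵐᵒᵖ) ⟶ ModuleCat.of (H ⊗[k] Hᵐᵒᵖ) (H ⊗[k] Hᵐᵒᵖ) :=
    (centralEnd (⟨c, hc⟩ : Subring.center (H ⊗[k] Hᵐᵒᵖ))).app _
  replace h1 : e.comp (Ext.mk₀ f) (add_zero n) = 0 := h1
  have h2 : ModuleCat.ofHom (LinearMap.toSpanSingleton (H ⊗[k] Hᵐᵒᵖ) (H ⊗[k] Hᵐᵒᵖ) (z ⊗ₜ 1)) =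
      f + ModuleCat.ofHom (LinearMap.toSpanSingleton (H ⊗[k] Hᵐᵒᵖ) (H ⊗[k] Hᵐᵒᵖ) (1 ⊗ₜ op z)) := by
    refine ModuleCat.hom_ext (LinearMap.ext fun x ↦ ?_)
    change x * (z ⊗ₜ 1) = c * x + x * (1 ⊗ₜ op z)
    rw [← Subring.mem_center_iff.1 hc x, ← mul_add, sub_add_cancel]
  rw [h2, Ext.mk₀_add, Ext.comp_add, h1, zero_add]

theorem exists_nakayama (hS : Function.Bijective (HopfAlgebra.antipode k : H →ₗ[k] H))
    [IsNoetherianRing H] [Module.Finite (Subring.center H) H] :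
    ∃ χ : H →ₐ[k] k, (∀ z ∈ Subring.center H, nakayama χ z = z) ∧ ∃ Θ : H ≃+ H,
      (∀ a y, Θ (HopfAlgebra.antipode k a * y) = HopfAlgebra.antipode k (nakayama χ a) * Θ y) ∧
      ∀ a y, Θ (y * nakayama χ a) = Θ y * a := by
  obtain ⟨xs, J, hch, hxs, hJ, hrank⟩ := exists_regularChain_finrank_eq_one (k := k) hS
  obtain ⟨t, ht0, ht, χ, hχ⟩ := exists_character hJ hrank
  obtain ⟨η₁, hη₁, hη₁'⟩ := exists_ext_bimodule hS (opAntipode (AlgHom.id k H)) AlgEquiv.refl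
    (isUniversalInvariant_algBimodule (AlgHom.id k H)) hxs hch hJ ht0 ht χ hχ
  obtain ⟨η₂, hη₂, hη₂'⟩ := exists_ext_bimodule hS (antipodeSq k H) (swapAntipode hS)
    (isUniversalInvariant_swapAntipode hS) hxs hch hJ ht0 ht χ hχ
  have hw₁ (a : H) : windMap (opAntipode (AlgHom.id k H)) χ a = op (nakayama χ a) :=
    windMap_eq _ _ _
  have hw₂ (a : H) : windMap (antipodeSq k H) χ a = HopfAlgebra.antipode k (nakayama χ a) :=
    windMap_eq _ _ _
  simp only [hw₁, hw₂, AlgEquiv.coe_refl, id_eq, swapAntipode_tmul, HopfAlgebra.antipode_one,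
    op_one] at hη₁ hη₁' hη₂ hη₂'
  refine ⟨χ, fun z hz ↦ ?_, opAddEquiv.trans (η₁.symm.trans η₂), fun a y ↦ ?_, fun a y ↦ ?_⟩
  · obtain ⟨e, he⟩ := η₁.surjective 1
    have h1 := hη₁ e (op z)
    rw [← ext_comp_tmul_one_of_mem_center hz, hη₁', he, mul_one, one_mul] at h1
    exact op_injective h1
  · change η₂ (η₁.symm (op _)) = _ * η₂ (η₁.symm (op y))
    rw [← hη₂']
    congr 1
    rw [AddEquiv.symm_apply_eq, hη₁, AddEquiv.apply_symm_apply, op_mul]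
  · change η₂ (η₁.symm (op _)) = η₂ (η₁.symm (op y)) * a
    rw [← hη₂]
    congr 1
    rw [AddEquiv.symm_apply_eq, hη₁', AddEquiv.apply_symm_apply, op_mul]

end NakayamaAutomorphism

section WindingCommutation

open TensorProduct

variable {k H : Type*} [Field k] [Ring H] [HopfAlgebra k H]

lemma counit_winding (χ : H →ₐ[k] k) (h : H) :
    Coalgebra.counit (R := k) (winding χ h) = χ h := by
  have h1 (s : H ⊗[k] H) : Coalgebra.counit (R := k)
      (TensorProduct.lid k H (χ.toLinearMap.rTensor H s)) =
      χ (TensorProduct.rid k H ((Coalgebra.counit (R := k) (A := H)).lTensor H s)) := by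
    induction s with
    | zero => simp
    | add x y hx hy => simp only [map_add, hx, hy]
    | tmul b c => simp [mul_comm]
  rw [winding_apply, h1, Coalgebra.lTensor_counit_comul, rid_tmul, one_smul]

lemma winding_winding (φ χ : H →ₐ[k] k) (h : H) :
    winding χ (winding φ h) = winding (χ.comp (winding φ)) h := by
  let m : H ⊗[k] H →ₗ[k] k := LinearMap.mul' k k ∘ₗ TensorProduct.map φ.toLinearMap χ.toLinearMap
  have h1 (s : H ⊗[k] H) : winding χ (TensorProduct.lid k H (φ.toLinearMap.rTensor H s)) =
      TensorProduct.lid k H (m.rTensor H ((TensorProduct.assoc k H H H).symm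
        ((Coalgebra.comul (R := k) (A := H)).lTensor H s))) := by
    induction s with
    | zero => simp
    | add x y hx hy => simp only [map_add, hx, hy]
    | tmul b c =>
      rw [LinearMap.rTensor_tmul, lid_tmul, map_smul, winding_apply, LinearMap.lTensor_tmul]
      generalize Coalgebra.comul (R := k) c = s
      induction s with
      | zero => simp
      | add x y hx hy => simp only [map_add, smul_add, tmul_add, hx, hy]
      | tmul c d => simp [m, smul_smul]
  have h2 : m ∘ₗ Coalgebra.comul (R := k) (A := H) = (χ.comp (winding φ)).toLinearMap := by
    ext b
    change m _ = χ (winding φ b)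
    rw [winding_apply]
    generalize Coalgebra.comul (R := k) b = s
    induction s with
    | zero => simp
    | add x y hx hy => simp only [map_add, hx, hy]
    | tmul c d => simp [m]
  rw [winding_apply φ, h1, Coalgebra.coassoc_symm_apply, ← LinearMap.rTensor_comp_apply, h2,
    winding_apply]

lemma winding_counit (h : H) : winding (Bialgebra.counitAlgHom k H) h = h := by
  rw [winding_apply]
  change TensorProduct.lid k H ((Coalgebra.counit (R := k) (A := H)).rTensor H _) = h
  rw [Coalgebra.rTensor_counit_comul, lid_tmul, one_smul]

lemma winding_winding_of_comp_eq {φ χ : H →ₐ[k] k}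
    (hφχ : χ.comp (winding φ) = Bialgebra.counitAlgHom k H) (h : H) :
    winding χ (winding φ h) = h := by
  rw [winding_winding, hφχ, winding_counit]

/-- The right winding endomorphism `h ↦ h₁ χ(h₂)`. -/
noncomputable def rightWinding (χ : H →ₐ[k] k) : H →ₐ[k] H :=
  (Algebra.TensorProduct.rid k k H).toAlgHom.comp
    ((Algebra.TensorProduct.map (AlgHom.id k H) χ).comp (Bialgebra.comulAlgHom k H))

lemma rightWinding_apply (χ : H →ₐ[k] k) (h : H) : rightWinding χ h =
    TensorProduct.rid k H (χ.toLinearMap.lTensor H (Coalgebra.comul (R := k) h)) := by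
  change Algebra.TensorProduct.rid k k H (Algebra.TensorProduct.map (AlgHom.id k H) χ
    (Coalgebra.comul h)) = _
  generalize Coalgebra.comul (R := k) h = s
  induction s with
  | zero => simp
  | add x y hx hy => simp only [map_add, hx, hy]
  | tmul b c => simp

lemma rightWinding_rTensor_comul (φ : H →ₐ[k] k) (h : H) :
    (rightWinding φ).toLinearMap.rTensor H (Coalgebra.comul (R := k) h) =
      (winding φ).toLinearMap.lTensor H (Coalgebra.comul (R := k) h) := by
  let F : (H ⊗[k] H) ⊗[k] H →ₗ[k] H ⊗[k] H :=
    ((TensorProduct.rid k H).toLinearMap ∘ₗ φ.toLinearMap.lTensor H).rTensor H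
  have h1 (s : H ⊗[k] H) : (rightWinding φ).toLinearMap.rTensor H s =
      F ((Coalgebra.comul (R := k) (A := H)).rTensor H s) := by
    induction s with
    | zero => simp
    | add x y hx hy => simp only [map_add, hx, hy]
    | tmul b c =>
      rw [LinearMap.rTensor_tmul, AlgHom.toLinearMap_apply, rightWinding_apply]
      rfl
  have h2 (s : H ⊗[k] H) : (winding φ).toLinearMap.lTensor H s =
      F ((TensorProduct.assoc k H H H).symm
        ((Coalgebra.comul (R := k) (A := H)).lTensor H s)) := by
    induction s with
    | zero => simp
    | add x y hx hy => simp only [map_add, hx, hy]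
    | tmul b c =>
      rw [LinearMap.lTensor_tmul, AlgHom.toLinearMap_apply, winding_apply, LinearMap.lTensor_tmul]
      generalize Coalgebra.comul (R := k) c = s
      induction s with
      | zero => simp
      | add x y hx hy => simp only [map_add, tmul_add, hx, hy]
      | tmul c d => simp [F, smul_tmul]
  rw [h1, h2, Coalgebra.coassoc_symm_apply]

lemma map_rightWinding_winding_comul {φ χ : H →ₐ[k] k}
    (hφχ : χ.comp (winding φ) = Bialgebra.counitAlgHom k H) (h : H) :
    TensorProduct.map (rightWinding φ).toLinearMap (winding χ).toLinearMap
      (Coalgebra.comul (R := k) h) = Coalgebra.comul (R := k) h := by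
  have h1 : (winding χ).toLinearMap ∘ₗ (winding φ).toLinearMap = LinearMap.id :=
    LinearMap.ext (winding_winding_of_comp_eq hφχ)
  rw [← LinearMap.lTensor_comp_rTensor, LinearMap.comp_apply, rightWinding_rTensor_comul,
    ← LinearMap.lTensor_comp_apply, h1, LinearMap.lTensor_id_apply]

/-- The convolution inverse of a character. -/
noncomputable def characterInv (χ : H →ₐ[k] k) : H →ₐ[k] k :=
  AlgHom.ofLinearMap (χ.toLinearMap ∘ₗ HopfAlgebra.antipode k)
    (by simp [HopfAlgebra.antipode_one])
    (fun a b ↦ by simp [HopfAlgebra.antipode_mul_antidistrib, mul_comm])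

lemma characterInv_apply (χ : H →ₐ[k] k) (h : H) :
    characterInv χ h = χ (HopfAlgebra.antipode k h) := rfl

lemma characterInv_comp_winding (χ : H →ₐ[k] k) :
    (characterInv χ).comp (winding χ) = Bialgebra.counitAlgHom k H := by
  ext h
  have := congrArg χ (HopfAlgebra.mul_antipode_lTensor_comul_apply (R := k) h)
  rw [AlgHom.commutes] at this
  refine Eq.trans ?_ this
  rw [AlgHom.comp_apply, winding_apply]
  generalize Coalgebra.comul (R := k) h = s
  induction s with
  | zero => simp
  | add x y hx hy => simp only [map_add, hx, hy]
  | tmul b c => simp [characterInv_apply]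

lemma comp_winding_characterInv (χ : H →ₐ[k] k) :
    χ.comp (winding (characterInv χ)) = Bialgebra.counitAlgHom k H := by
  ext h
  have := congrArg χ (HopfAlgebra.mul_antipode_rTensor_comul_apply (R := k) h)
  rw [AlgHom.commutes] at this
  refine Eq.trans ?_ this
  rw [AlgHom.comp_apply, winding_apply]
  generalize Coalgebra.comul (R := k) h = s
  induction s with
  | zero => simp
  | add x y hx hy => simp only [map_add, hx, hy]
  | tmul b c => simp [characterInv_apply]

lemma characterInv_characterInv (χ : H →ₐ[k] k) : characterInv (characterInv χ) = χ := by
  ext h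
  rw [← counit_winding, ← counit_winding χ]
  congr 1
  have h1 := winding_winding_of_comp_eq (characterInv_comp_winding (characterInv χ)) (winding χ h)
  rwa [winding_winding_of_comp_eq (characterInv_comp_winding χ)] at h1

lemma eq_of_convolution_inverse {f g g' : H →ₗ[k] H}
    (h : ∀ a, LinearMap.mul' k H (TensorProduct.map g f (Coalgebra.comul (R := k) a)) =
      algebraMap k H (Coalgebra.counit (R := k) a))
    (h' : ∀ a, LinearMap.mul' k H (TensorProduct.map f g' (Coalgebra.comul (R := k) a)) =
      algebraMap k H (Coalgebra.counit (R := k) a)) : g = g' := by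
  have h1 : WithConv.toConv g * WithConv.toConv f = 1 := by ext a; exact h a
  have h2 : WithConv.toConv f * WithConv.toConv g' = 1 := by ext a; exact h' a
  exact WithConv.toConv_injective (left_inv_eq_right_inv h1 h2)

lemma winding_antipode (χ : H →ₐ[k] k) (h : H) : winding χ (HopfAlgebra.antipode k h) =
    HopfAlgebra.antipode k (rightWinding (characterInv χ) h) := by
  refine (LinearMap.congr_fun (eq_of_convolution_inverse (f := (winding χ).toLinearMap)
    (g := HopfAlgebra.antipode k ∘ₗ (rightWinding (characterInv χ)).toLinearMap)
    (g' := (winding χ).toLinearMap ∘ₗ HopfAlgebra.antipode k) (fun a ↦ ?_) fun a ↦ ?_) h).symm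
  · rw [← LinearMap.rTensor_comp_map, LinearMap.comp_apply,
      map_rightWinding_winding_comul (comp_winding_characterInv χ)]
    exact HopfAlgebra.mul_antipode_rTensor_comul_apply a
  · rw [← AlgHom.commutes (winding χ), ← HopfAlgebra.mul_antipode_lTensor_comul_apply]
    generalize Coalgebra.comul (R := k) a = s
    induction s with
    | zero => simp
    | add x y hx hy => simp only [map_add, hx, hy]
    | tmul b c => simp

lemma rightWinding_antipode (χ : H →ₐ[k] k) (h : H) : rightWinding χ (HopfAlgebra.antipode k h) =
    HopfAlgebra.antipode k (winding (characterInv χ) h) := by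
  refine LinearMap.congr_fun (eq_of_convolution_inverse (f := (rightWinding χ).toLinearMap)
    (g := (rightWinding χ).toLinearMap ∘ₗ HopfAlgebra.antipode k)
    (g' := HopfAlgebra.antipode k ∘ₗ (winding (characterInv χ)).toLinearMap)
    (fun a ↦ ?_) fun a ↦ ?_) h
  · rw [← AlgHom.commutes (rightWinding χ), ← HopfAlgebra.mul_antipode_rTensor_comul_apply]
    generalize Coalgebra.comul (R := k) a = s
    induction s with
    | zero => simp
    | add x y hx hy => simp only [map_add, hx, hy]
    | tmul b c => simp
  · rw [← LinearMap.lTensor_comp_map, LinearMap.comp_apply,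
      map_rightWinding_winding_comul (characterInv_comp_winding χ)]
    exact HopfAlgebra.mul_antipode_lTensor_comul_apply a

lemma antipodeSq_winding (χ : H →ₐ[k] k) (h : H) :
    antipodeSq k H (winding χ h) = winding χ (antipodeSq k H h) := by
  rw [antipodeSq_apply, antipodeSq_apply, winding_antipode, rightWinding_antipode,
    characterInv_characterInv]

lemma winding_injective (χ : H →ₐ[k] k) : Function.Injective (winding χ) :=
  Function.LeftInverse.injective (winding_winding_of_comp_eq (characterInv_comp_winding χ))

end WindingCommutation

section FiniteOrder

variable {k H : Type*} [Field k] [Ring H] [HopfAlgebra k H]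

lemma not_injective_of_eq_on_center [Module.Finite (Subring.center H) H] (χ : ℕ → H →ₐ[k] k)
    (h : ∀ n, ∀ z ∈ Subring.center H, χ n z = Coalgebra.counit (R := k) z) :
    ¬ Function.Injective χ := by
  intro hχ
  obtain ⟨s, hs⟩ := Module.Finite.fg_top (R := Subring.center H) (M := H)
  let V : Submodule k (Module.Dual k H) :=
    { carrier := {f | ∀ z ∈ Subring.center H, ∀ x, f (z * x) = Coalgebra.counit (R := k) z * f x}
      add_mem' hf hg z hz x := by
        rw [LinearMap.add_apply, LinearMap.add_apply, hf z hz, hg z hz, mul_add]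
      zero_mem' z hz x := by simp
      smul_mem' c f hf z hz x := by
        rw [LinearMap.smul_apply, LinearMap.smul_apply, hf z hz, smul_eq_mul, smul_eq_mul,
          mul_left_comm] }
  let r : V →ₗ[k] (s → k) := LinearMap.pi fun i ↦ LinearMap.applyₗ (i : H) ∘ₗ V.subtype
  have hr : Function.Injective r := by
    intro f g hfg
    refine Subtype.ext (LinearMap.ext fun x ↦ ?_)
    have hx : x ∈ Submodule.span (Subring.center H) (s : Set H) := hs ▸ Submodule.mem_top
    induction hx using Submodule.span_induction with
    | mem x hx => exact congrFun hfg ⟨x, hx⟩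
    | zero => rw [map_zero, map_zero]
    | add x y _ _ hx hy => rw [map_add, map_add, hx, hy]
    | smul z x _ hx => exact (f.2 z z.2 x).trans (hx ▸ (g.2 z z.2 x).symm)
  have hV : Module.Finite k V := Module.Finite.of_injective r hr
  let v (n : ℕ) : V := ⟨(χ n).toLinearMap, fun z hz x ↦ by
    rw [AlgHom.toLinearMap_apply, map_mul, h n z hz]; rfl⟩
  have hv : LinearIndependent k v := by
    refine LinearIndependent.of_comp (LinearMap.ltoFun k H k k ∘ₗ V.subtype) ?_
    exact (linearIndependent_monoidHom H k).comp (fun n ↦ ((χ n : H →ₐ[k] k) : H →* k))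
      fun a b hab ↦ hχ (AlgHom.ext fun x ↦ DFunLike.congr_fun hab x)
  exact not_finite_iff_infinite.2 inferInstance hv.finite

theorem exists_nakayama_iterate_eq [Module.Finite (Subring.center H) H] (χ : H →ₐ[k] k)
    (h : ∀ z ∈ Subring.center H, nakayama χ z = z) :
    ∃ n, 0 < n ∧ (nakayama χ)^[n] = (HopfAlgebra.antipode k : H →ₗ[k] H)^[2 * n] := by
  have hsq (n : ℕ) : (antipodeSq k H)^[n] = (HopfAlgebra.antipode k : H →ₗ[k] H)^[2 * n] := by
    rw [Function.iterate_mul]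
    rfl
  have hν (n : ℕ) : (nakayama χ)^[n] = (antipodeSq k H)^[n] ∘ (winding χ)^[n] :=
    Function.Commute.comp_iterate (antipodeSq_winding χ) n
  let χs (n : ℕ) : H →ₐ[k] k := Nat.rec (Bialgebra.counitAlgHom k H)
    (fun _ φ ↦ φ.comp (winding χ)) n
  have hw (n : ℕ) (x : H) : (winding χ)^[n] x = winding (χs n) x := by
    induction n generalizing x with
    | zero => exact (winding_counit x).symm
    | succ n ih =>
      rw [Function.iterate_succ_apply, ih, winding_winding]
  have hcounit (n : ℕ) (x : H) : Coalgebra.counit (R := k) ((antipodeSq k H)^[n] x) =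
      Coalgebra.counit (R := k) x := by
    induction n with
    | zero => rfl
    | succ n ih =>
      rw [Function.iterate_succ_apply', antipodeSq_apply, HopfAlgebra.counit_antipode,
        HopfAlgebra.counit_antipode, ih]
  have hχs (n : ℕ) (z : H) (hz : z ∈ Subring.center H) : χs n z = Coalgebra.counit (R := k) z := by
    rw [← counit_winding, ← hw, ← hcounit n, ← Function.comp_apply (f := (antipodeSq k H)^[n]),
      ← hν, Function.iterate_fixed (h z hz)]
  obtain ⟨i, j, hij, hne⟩ : ∃ i j, χs i = χs j ∧ i < j := by
    have := not_injective_of_eq_on_center χs hχs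
    simp only [Function.Injective, not_forall] at this
    obtain ⟨i, j, hij, hne⟩ := this
    rcases lt_or_gt_of_ne hne with hlt | hlt
    · exact ⟨i, j, hij, hlt⟩
    · exact ⟨j, i, hij.symm, hlt⟩
  refine ⟨j - i, Nat.sub_pos_of_lt hne, ?_⟩
  have hid : (winding χ)^[j - i] = id := by
    ext x
    apply (winding_injective χ).iterate i
    rw [← Function.iterate_add_apply, Nat.add_sub_cancel' hne.le, hw, hw, hij]
    rfl
  rw [hν, hid, hsq]
  rfl

end FiniteOrder

section InnerPower

lemma isUnit_of_mul_eq_one {R : Type*} [Ring R] [IsNoetherianRing R] {y u : R} (h : y * u = 1) :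
    IsUnit u := by
  have hinj := IsNoetherian.injective_of_surjective_endomorphism
    (LinearMap.toSpanSingleton R R u) fun x ↦ ⟨x * y, by simp [mul_assoc, h]⟩
  refine ⟨⟨u, y, hinj ?_, h⟩, rfl⟩
  simp [mul_assoc, h]

lemma exists_unit_iterate_comp {R : Type*} [Monoid R] (σ : R →* R) (ν : R → R) (u : Rˣ)
    (h : ∀ a, σ (ν a) = u * a * ↑u⁻¹) (n : ℕ) :
    ∃ w : Rˣ, ∀ a, σ^[n] (ν^[n] a) = w * a * ↑w⁻¹ := by
  induction n with
  | zero => exact ⟨1, by simp⟩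
  | succ n ih =>
    obtain ⟨w, hw⟩ := ih
    refine ⟨Units.map σ w * u, fun a ↦ ?_⟩
    rw [Function.iterate_succ_apply', Function.iterate_succ_apply, hw, map_mul, map_mul, h]
    simp [mul_assoc]

variable {k H : Type*} [Field k] [Ring H] [HopfAlgebra k H]

theorem exists_antipode_iterate_eq_conj
    (hS : Function.Bijective (HopfAlgebra.antipode k : H →ₗ[k] H))
    [IsNoetherianRing H] [Module.Finite (Subring.center H) H] :
    ∃ n : ℕ, 0 < n ∧ ∃ u : Hˣ,
      ∀ h : H, (HopfAlgebra.antipode k : H →ₗ[k] H)^[n] h = u * h * ↑u⁻¹ := by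
  obtain ⟨χ, hχ, Θ, hΘ, hΘ'⟩ := exists_nakayama (k := k) (H := H) hS
  obtain ⟨n, hn, hνn⟩ := exists_nakayama_iterate_eq χ hχ
  let e := Equiv.ofBijective _ hS
  have he (a : H) : e a = HopfAlgebra.antipode k a := rfl
  have hu : IsUnit (Θ 1) := by
    obtain ⟨y, hy⟩ := Θ.surjective 1
    refine isUnit_of_mul_eq_one (y := HopfAlgebra.antipode k (nakayama χ (e.symm y))) ?_
    rw [← hΘ, ← he, e.apply_symm_apply, mul_one, hy]
  obtain ⟨u, hu⟩ := hu
  let σ : H →* H :=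
    { toFun a := e (nakayama χ (e.symm a))
      map_one' := by
        have : e.symm 1 = 1 := e.symm_apply_eq.2 HopfAlgebra.antipode_one.symm
        rw [this, map_one, he, HopfAlgebra.antipode_one]
      map_mul' a b := by
        have : e.symm (a * b) = e.symm b * e.symm a := by
          rw [e.symm_apply_eq, he, HopfAlgebra.antipode_mul_antidistrib, ← he, ← he,
            e.apply_symm_apply, e.apply_symm_apply]
        rw [this, map_mul, he, HopfAlgebra.antipode_mul_antidistrib, he, he] }
  have hσ (a : H) : σ (nakayama χ a) = u * a * ↑u⁻¹ := by
    rw [Units.eq_mul_inv_iff_mul_eq, hu, ← hΘ', one_mul]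
    refine (hΘ _ 1).symm.trans ?_
    rw [← he, e.apply_symm_apply, mul_one]
  have hσn : σ^[n] = (HopfAlgebra.antipode k : H →ₗ[k] H)^[2 * n] := by
    have h1 : Function.Semiconj e (nakayama χ) σ := fun a ↦ by simp [σ]
    ext a
    obtain ⟨a, rfl⟩ := e.surjective a
    rw [← (h1.iterate_right n).eq, hνn, he, he, ← Function.iterate_succ_apply,
      Function.iterate_succ_apply']
  obtain ⟨w, hw⟩ := exists_unit_iterate_comp σ (nakayama χ) u hσ n
  refine ⟨2 * n + 2 * n, by lia, w, fun h ↦ ?_⟩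
  rw [← hw, hσn, hνn, Function.iterate_add_apply]

end InnerPower

theorem antipode_power_inner_of_module_finite_over_center
    (k : Type u) [Field k] (H : Type v) [Ring H] [HopfAlgebra k H]
    (hS : Function.Bijective (HopfAlgebra.antipode k : H →ₗ[k] H))
    (hnoeth : IsNoetherianRing H) (hnoeth' : IsNoetherianRing Hᵐᵒᵖ)
    (hfin : Module.Finite (Subring.center H) H) :
    ∃ n : ℕ, 0 < n ∧ ∃ u : Hˣ,
      ∀ h : H, (⇑(HopfAlgebra.antipode k : H →ₗ[k] H))^[n] h = u * h * ↑u⁻¹ := by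
  exact exists_antipode_iterate_eq_conj hS
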